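/- Let t be a positive integer and for each i ∈ {1,…,t} let n_i be a positive integer and q_i an odd prime power, and let G = ∏_{i=1}^t G_i where G_i = PSp_{2n_i}(q_i). Then the following three statements are equivalent: (1) every subgroup of odd index in G is pronormal in G; (2) for each i ∈ {1,…,t}, every subgroup of odd index in G_i is pronormal in G_i; (3) for each i ∈ {1,…,t}, if q_i ≡ 3 or 5 (mod 8) then n_i is either a power of 2 or of the form 2^w·(2^(2k)+1) for some non-negative integers w and k. -/

import Mathlib

/-- A subgroup `H` of a group `G` is *pronormal* in `G` if for every `g : G` the subgroups
`H` and `H^g` are conjugate by an element of the subgroup `⟨H, H^g⟩` they generate. -/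
def IsPronormal {G : Type*} [Group G] (H : Subgroup G) : Prop :=
  ∀ g : G, ∃ x ∈ H ⊔ H.map (MulAut.conj g).toMonoidHom,
    H.map (MulAut.conj x).toMonoidHom = H.map (MulAut.conj g).toMonoidHom

set_option linter.unusedSectionVars false
set_option linter.unusedSimpArgs false

/-- `P` is a maximal `2`-subgroup of `N`. -/
structure IsMaxTwo {G : Type*} [Group G] (P N : Subgroup G) : Prop where
  le : P ≤ N
  isPGroup : IsPGroup 2 P
  max : ∀ R : Subgroup G, P ≤ R → R ≤ N → IsPGroup 2 R → R ≤ P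

section GroupLemmas

variable {G : Type*} [Group G]

/-- A subgroup `R` of a finite `p`-group `P` which is self-normalizing in `P` is all of `P`. -/
lemma IsPGroup.le_of_normalizing [Finite G] {p : ℕ} [Fact p.Prime] {P R : Subgroup G}
    (hP : IsPGroup p P) (hRP : R ≤ P)
    (h : ∀ x ∈ P, (∀ r ∈ R, x * r * x⁻¹ ∈ R) → x ∈ R) : P ≤ R := by
  have : Finite P := inferInstance
  have : Group.IsNilpotent P := hP.isNilpotent
  have hnc := @Group.normalizerCondition_of_isNilpotent P _ _
  by_contra hne
  have hlt : R.subgroupOf P < ⊤ := by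
    rw [lt_top_iff_ne_top, Ne, Subgroup.subgroupOf_eq_top]
    exact hne
  have h1 := hnc _ hlt
  obtain ⟨x, hx, hx'⟩ := SetLike.exists_of_lt h1
  apply hx'
  rw [Subgroup.mem_subgroupOf]
  refine h _ x.2 fun r hr => ?_
  rw [Subgroup.mem_normalizer_iff] at hx
  have := (hx ⟨r, hRP hr⟩).1 (by rw [Subgroup.mem_subgroupOf]; exact hr)
  rw [Subgroup.mem_subgroupOf] at this
  simpa using this

lemma IsMaxTwo.mono {P M N : Subgroup G} (h : IsMaxTwo P N) (hPM : P ≤ M) (hMN : M ≤ N) :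
    IsMaxTwo P M :=
  ⟨hPM, h.isPGroup, fun R h1 h2 h3 => h.max R h1 (h2.trans hMN) h3⟩

lemma IsMaxTwo.exists_sylow {P : Subgroup G} (h : IsMaxTwo P ⊤) :
    ∃ S : Sylow 2 G, (S : Subgroup G) = P :=
  ⟨⟨P, h.isPGroup, fun {R} hR hPR => le_antisymm (h.max R hPR le_top hR) hPR⟩, rfl⟩

lemma Sylow.isMaxTwo (S : Sylow 2 G) : IsMaxTwo (S : Subgroup G) ⊤ :=
  ⟨le_top, S.2, fun _ h1 _ h3 => (S.3 h3 h1).le⟩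

lemma IsMaxTwo.subgroupOf {P N : Subgroup G} (h : IsMaxTwo P N) :
    IsMaxTwo (P.subgroupOf N) ⊤ := by
  refine ⟨le_top, h.isPGroup.comap_subtype, fun R h1 _ h3 => ?_⟩
  have h4 : R.map N.subtype ≤ P := h.max _ (by
    intro x hx
    exact ⟨⟨x, h.le hx⟩, h1 (by rw [Subgroup.mem_subgroupOf]; exact hx), rfl⟩)
    (Subgroup.map_subtype_le _) (h3.map _)
  intro x hx
  rw [Subgroup.mem_subgroupOf]
  exact h4 ⟨x, hx, rfl⟩

/-- Sylow's conjugacy theorem inside a subgroup `N`. -/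
lemma IsMaxTwo.exists_conj [Finite G] {P N R : Subgroup G} (h : IsMaxTwo P N) (hR : IsPGroup 2 R)
    (hRN : R ≤ N) : ∃ x ∈ N, ∀ y ∈ R, x * y * x⁻¹ ∈ P := by
  obtain ⟨S, hS⟩ := h.subgroupOf.exists_sylow
  obtain ⟨S', hS'⟩ := (hR.comap_subtype (K := N)).exists_le_sylow
  obtain ⟨x, hx⟩ := MulAction.exists_smul_eq N S' S
  refine ⟨x, x.2, fun y hy => ?_⟩
  have h1 : (⟨y, hRN hy⟩ : N) ∈ (S' : Subgroup N) := hS' hy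
  have h2 : x * (⟨y, hRN hy⟩ : N) * x⁻¹ ∈ (S : Subgroup N) := by
    rw [← hx, Sylow.coe_subgroup_smul]
    exact ⟨_, h1, rfl⟩
  rw [hS, Subgroup.mem_subgroupOf] at h2
  simpa using h2

lemma IsMaxTwo.odd_index [Finite G] {P H : Subgroup G} (h : IsMaxTwo P ⊤) (hPH : P ≤ H) :
    Odd H.index := by
  obtain ⟨S, hS⟩ := h.exists_sylow
  have h1 : ¬ 2 ∣ (S : Subgroup G).index := S.not_dvd_index
  rw [hS] at h1
  rw [← Nat.not_even_iff_odd, even_iff_two_dvd]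
  exact fun h2 => h1 (h2.trans (Subgroup.index_dvd_of_le hPH))

/-- A subgroup of odd index contains a conjugate of every maximal `2`-subgroup. -/
lemma IsMaxTwo.exists_conj_of_odd_index [Finite G] {P H : Subgroup G} (h : IsMaxTwo P ⊤)
    (hH : Odd H.index) : ∃ x : G, ∀ y ∈ P, x * y * x⁻¹ ∈ H := by
  obtain ⟨S⟩ := (inferInstance : Nonempty (Sylow 2 H))
  have hn : Odd (((S : Subgroup H).map H.subtype).index) := by
    rw [Subgroup.index_map_subtype]
    refine Odd.mul ?_ hH
    rw [← Nat.not_even_iff_odd, even_iff_two_dvd]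
    exact S.not_dvd_index
  have h1 : IsMaxTwo ((S : Subgroup H).map H.subtype) ⊤ := by
    have hp : IsPGroup 2 ((S : Subgroup H).map H.subtype) := S.2.map _
    obtain ⟨S', hS'⟩ := hp.exists_le_sylow
    have : (S : Subgroup H).map H.subtype = S' := by
      refine le_antisymm hS' ?_
      have h3 : ((S : Subgroup H).map H.subtype).relIndex S' ∣
        ((S : Subgroup H).map H.subtype).index := Subgroup.relIndex_dvd_index_of_le hS'
      obtain ⟨k, hk⟩ := (S'.2.index (((S : Subgroup H).map H.subtype).subgroupOf S'))
      rw [← Subgroup.relIndex_eq_one]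
      change Subgroup.relIndex _ _ = _ at hk
      rcases k with _ | k
      · simpa using hk
      · exfalso
        rw [hk] at h3
        exact (Nat.not_even_iff_odd.2 hn) (even_iff_two_dvd.2 (dvd_trans (dvd_pow_self 2 (by omega)) h3))
    rw [this]
    exact S'.isMaxTwo
  obtain ⟨x, -, hx⟩ := h1.exists_conj h.isPGroup le_top
  exact ⟨x, fun y hy => (Subgroup.map_subtype_le _) (hx y hy)⟩

end GroupLemmas

section Quaternions

open Quaternion

variable {F : Type*} [Field F]

/-- The group of quaternions of norm one. -/
abbrev UnitQuat (F : Type*) [Field F] := unitary ℍ[F]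

/-- The quaternion units. -/
def qi : ℍ[F] := ⟨0, 1, 0, 0⟩
def qj : ℍ[F] := ⟨0, 0, 1, 0⟩
def qk : ℍ[F] := ⟨0, 0, 0, 1⟩

@[simp] lemma qi_re : (qi : ℍ[F]).re = 0 := rfl
@[simp] lemma qi_imI : (qi : ℍ[F]).imI = 1 := rfl
@[simp] lemma qi_imJ : (qi : ℍ[F]).imJ = 0 := rfl
@[simp] lemma qi_imK : (qi : ℍ[F]).imK = 0 := rfl
@[simp] lemma qj_re : (qj : ℍ[F]).re = 0 := rfl
@[simp] lemma qj_imI : (qj : ℍ[F]).imI = 0 := rfl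
@[simp] lemma qj_imJ : (qj : ℍ[F]).imJ = 1 := rfl
@[simp] lemma qj_imK : (qj : ℍ[F]).imK = 0 := rfl
@[simp] lemma qk_re : (qk : ℍ[F]).re = 0 := rfl
@[simp] lemma qk_imI : (qk : ℍ[F]).imI = 0 := rfl
@[simp] lemma qk_imJ : (qk : ℍ[F]).imJ = 0 := rfl
@[simp] lemma qk_imK : (qk : ℍ[F]).imK = 1 := rfl

/-- The order three quaternion `-(1 + i + j + k) / 2`. -/
def qw : ℍ[F] := ⟨-1/2, -1/2, -1/2, -1/2⟩

@[simp] lemma qw_re : (qw : ℍ[F]).re = -1/2 := rfl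
@[simp] lemma qw_imI : (qw : ℍ[F]).imI = -1/2 := rfl
@[simp] lemma qw_imJ : (qw : ℍ[F]).imJ = -1/2 := rfl
@[simp] lemma qw_imK : (qw : ℍ[F]).imK = -1/2 := rfl

lemma Quaternion.star_mul_self_eq_one_iff {a : ℍ[F]} :
    star a * a = 1 ↔ a.re ^ 2 + a.imI ^ 2 + a.imJ ^ 2 + a.imK ^ 2 = 1 := by
  rw [Quaternion.star_mul_self, Quaternion.normSq_def', ← Quaternion.coe_one,
    Quaternion.coe_inj]

lemma mem_unitQuat {a : ℍ[F]} :
    a ∈ UnitQuat F ↔ a.re ^ 2 + a.imI ^ 2 + a.imJ ^ 2 + a.imK ^ 2 = 1 := by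
  rw [← Quaternion.star_mul_self_eq_one_iff, Unitary.mem_iff]
  constructor
  · exact fun h => h.1
  · refine fun h => ⟨h, ?_⟩
    rw [Quaternion.self_mul_star, ← Quaternion.star_mul_self, h]

/-- The eight quaternion units `±1, ±i, ±j, ±k`. -/
def IsQ8 (a : ℍ[F]) : Prop :=
  a = 1 ∨ a = -1 ∨ a = qi ∨ a = -qi ∨ a = qj ∨ a = -qj ∨ a = qk ∨ a = -qk

lemma qi_mul_qi : (qi * qi : ℍ[F]) = -1 := by ext <;> simp
lemma qj_mul_qj : (qj * qj : ℍ[F]) = -1 := by ext <;> simp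
lemma qk_mul_qk : (qk * qk : ℍ[F]) = -1 := by ext <;> simp
lemma qi_mul_qj : (qi * qj : ℍ[F]) = qk := by ext <;> simp
lemma qj_mul_qi : (qj * qi : ℍ[F]) = -qk := by ext <;> simp
lemma qj_mul_qk : (qj * qk : ℍ[F]) = qi := by ext <;> simp
lemma qk_mul_qj : (qk * qj : ℍ[F]) = -qi := by ext <;> simp
lemma qk_mul_qi : (qk * qi : ℍ[F]) = qj := by ext <;> simp
lemma qi_mul_qk : (qi * qk : ℍ[F]) = -qj := by ext <;> simp
@[simp] lemma star_qi : star (qi : ℍ[F]) = -qi := by ext <;> simp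
@[simp] lemma star_qj : star (qj : ℍ[F]) = -qj := by ext <;> simp
@[simp] lemma star_qk : star (qk : ℍ[F]) = -qk := by ext <;> simp

lemma IsQ8.mul {a b : ℍ[F]} (ha : IsQ8 a) (hb : IsQ8 b) : IsQ8 (a * b) := by
  unfold IsQ8 at *
  rcases ha with rfl | rfl | rfl | rfl | rfl | rfl | rfl | rfl <;>
  rcases hb with rfl | rfl | rfl | rfl | rfl | rfl | rfl | rfl <;>
  simp [qi_mul_qi, qj_mul_qj, qk_mul_qk, qi_mul_qj, qj_mul_qi, qj_mul_qk, qk_mul_qj, qk_mul_qi,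
    qi_mul_qk]

lemma IsQ8.star {a : ℍ[F]} (ha : IsQ8 a) : IsQ8 (star a) := by
  unfold IsQ8 at *
  rcases ha with rfl | rfl | rfl | rfl | rfl | rfl | rfl | rfl <;> simp

lemma IsQ8.neg {a : ℍ[F]} (ha : IsQ8 a) : IsQ8 (-a) := by
  unfold IsQ8 at *
  rcases ha with rfl | rfl | rfl | rfl | rfl | rfl | rfl | rfl <;> simp

lemma IsQ8.mem_unitQuat {a : ℍ[F]} (ha : IsQ8 a) : a ∈ UnitQuat F := by
  rw [_root_.mem_unitQuat]
  rcases ha with rfl | rfl | rfl | rfl | rfl | rfl | rfl | rfl <;> simp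

lemma isQ8_one : IsQ8 (1 : ℍ[F]) := Or.inl rfl
lemma isQ8_qi : IsQ8 (qi : ℍ[F]) := by simp [IsQ8]
lemma isQ8_qj : IsQ8 (qj : ℍ[F]) := by simp [IsQ8]
lemma isQ8_qk : IsQ8 (qk : ℍ[F]) := by simp [IsQ8]
lemma isQ8_neg_one : IsQ8 (-1 : ℍ[F]) := by simp [IsQ8]

/-- The quaternion group of order eight. -/
def quatGroup (F : Type*) [Field F] : Subgroup (UnitQuat F) where
  carrier := {a | IsQ8 (a : ℍ[F])}
  mul_mem' ha hb := by simpa using IsQ8.mul ha hb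
  one_mem' := by simpa using isQ8_one
  inv_mem' ha := IsQ8.star ha

lemma mem_quatGroup {a : UnitQuat F} : a ∈ quatGroup F ↔ IsQ8 (a : ℍ[F]) := Iff.rfl

lemma quatGroup_sq {a : UnitQuat F} (ha : a ∈ quatGroup F) : a ^ 4 = 1 := by
  rw [mem_quatGroup] at ha
  ext1
  have h4 : (a : ℍ[F]) ^ 4 = ((a : ℍ[F]) * a) * (a * a) := by noncomm_ring
  rw [SubmonoidClass.coe_pow, h4]
  rcases ha with h | h | h | h | h | h | h | h <;>
    simp [h, qi_mul_qi, qj_mul_qj, qk_mul_qk]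

lemma isPGroup_quatGroup : IsPGroup 2 (quatGroup F) := by
  intro a
  exact ⟨2, Subtype.ext (quatGroup_sq a.2)⟩

/-- Quaternion units commute up to sign. -/
lemma IsQ8.comm {a b : ℍ[F]} (ha : IsQ8 a) (hb : IsQ8 b) : a * b = b * a ∨ a * b = -(b * a) := by
  unfold IsQ8 at *
  rcases ha with rfl | rfl | rfl | rfl | rfl | rfl | rfl | rfl <;>
  rcases hb with rfl | rfl | rfl | rfl | rfl | rfl | rfl | rfl <;>
  simp [qi_mul_qi, qj_mul_qj, qk_mul_qk, qi_mul_qj, qj_mul_qi, qj_mul_qk, qk_mul_qj, qk_mul_qi,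
    qi_mul_qk]

lemma qw_mul_qi : (qw * qi : ℍ[F]) = qj * qw := by
  ext <;> simp
lemma qw_mul_qj : (qw * qj : ℍ[F]) = qk * qw := by
  ext <;> simp
lemma qw_mul_qk : (qw * qk : ℍ[F]) = qi * qw := by
  ext <;> simp

instance [Finite F] : Finite ℍ[F] := Finite.of_equiv _ (Quaternion.equivProd F).symm

variable [NeZero (2 : F)]

lemma qw_mem_unitQuat : (qw : ℍ[F]) ∈ UnitQuat F := by
  have h2 := NeZero.ne (2 : F)
  rw [mem_unitQuat]
  simp
  field_simp
  norm_num

lemma qw_mul_qw : (qw * qw : ℍ[F]) = star qw := by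
  have h2 := NeZero.ne (2 : F)
  ext <;> simp <;> field_simp <;> norm_num

/-- The element `ω` as a quaternion of norm one. -/
def omega (F : Type*) [Field F] [NeZero (2 : F)] : UnitQuat F := ⟨qw, qw_mem_unitQuat⟩

@[simp] lemma coe_omega : (omega F : ℍ[F]) = qw := rfl

lemma omega_mul_omega : omega F * omega F = (omega F)⁻¹ := Subtype.ext qw_mul_qw

lemma omega_pow_three : omega F ^ 3 = 1 := by
  rw [pow_succ, pow_two, omega_mul_omega, inv_mul_cancel]

/-- Powers of `ω` indexed by `ZMod 3`. -/
def wpow (e : ZMod 3) : UnitQuat F := omega F ^ e.val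

@[simp] lemma wpow_zero : wpow (F := F) 0 = 1 := by simp [wpow]

lemma wpow_one : wpow (F := F) 1 = omega F := by simp [wpow, ZMod.val_one]

lemma wpow_add (e f : ZMod 3) : wpow (F := F) (e + f) = wpow e * wpow f := by
  unfold wpow
  rw [ZMod.val_add, ← pow_add]
  conv_rhs => rw [← Nat.div_add_mod (e.val + f.val) 3, pow_add, pow_mul, omega_pow_three, one_pow,
    one_mul]

lemma wpow_neg (e : ZMod 3) : wpow (F := F) (-e) = (wpow e)⁻¹ := by
  rw [eq_inv_iff_mul_eq_one, ← wpow_add]; simp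

/-- Conjugation by `ω` normalizes the quaternion group. -/
lemma omega_conj_mem {a : UnitQuat F} (ha : a ∈ quatGroup F) :
    omega F * a * (omega F)⁻¹ ∈ quatGroup F := by
  rw [mem_quatGroup] at ha ⊢
  have h1 : (qw * star qw : ℍ[F]) = 1 := (Unitary.mem_iff.1 qw_mem_unitQuat).2
  have h : ((omega F * a * (omega F)⁻¹ : UnitQuat F) : ℍ[F]) = qw * (a : ℍ[F]) * star qw := rfl
  rw [h]
  rcases ha with h | h | h | h | h | h | h | h <;>
    simp [h, h1, IsQ8, qw_mul_qi, qw_mul_qj, qw_mul_qk, mul_assoc]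

lemma wpow_conj_mem (e : ZMod 3) {a : UnitQuat F} (ha : a ∈ quatGroup F) :
    (wpow e : UnitQuat F) * a * (wpow e)⁻¹ ∈ quatGroup F := by
  unfold wpow
  induction e.val with
  | zero => simpa
  | succ n ih =>
    have := omega_conj_mem ih
    rw [pow_succ']
    simpa [mul_assoc] using this

lemma wpow_conj_mem' (e : ZMod 3) {a : UnitQuat F} (ha : a ∈ quatGroup F) :
    (wpow e : UnitQuat F)⁻¹ * a * wpow e ∈ quatGroup F := by
  have := wpow_conj_mem (-e) ha
  rwa [wpow_neg, inv_inv] at this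

lemma isQ8_of_fix_qi (hns : ¬ IsSquare (2 : F)) {u : ℍ[F]} (hu : u ∈ UnitQuat F)
    (hi : u * qi = qi * u ∨ u * qi = -(qi * u)) (hj : IsQ8 (u * qj * star u)) : IsQ8 u := by
  have h2 := NeZero.ne (2 : F)
  have hn := mem_unitQuat.1 hu
  have hs : ∀ x : F, 2 * (x * x) ≠ 1 := fun x hx => hns ⟨2 * x, by linear_combination -2 * hx⟩
  have key : ∀ a b : F, a ^ 2 + b ^ 2 = 1 → a * b = 0 →
      (a = 0 ∧ b = 1) ∨ (a = 0 ∧ b = -1) ∨ (a = 1 ∧ b = 0) ∨ (a = -1 ∧ b = 0) := by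
    intro a b h1 h2
    rcases mul_eq_zero.1 h2 with h | h
    · subst h
      have : (b - 1) * (b + 1) = 0 := by linear_combination h1
      rcases mul_eq_zero.1 this with h | h
      · exact Or.inl ⟨rfl, by linear_combination h⟩
      · exact Or.inr (Or.inl ⟨rfl, by linear_combination h⟩)
    · subst h
      have : (a - 1) * (a + 1) = 0 := by linear_combination h1
      rcases mul_eq_zero.1 this with h | h
      · exact Or.inr (Or.inr (Or.inl ⟨by linear_combination h, rfl⟩))
      · exact Or.inr (Or.inr (Or.inr ⟨by linear_combination h, rfl⟩))
  have hj' : (u.re ^ 2 - u.imI ^ 2 + u.imJ ^ 2 - u.imK ^ 2 = 0 ∨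
      2 * (u.re * u.imI + u.imJ * u.imK) = 0) := by
    rcases hj with h | h | h | h | h | h | h | h <;>
    · have e3 := congrArg QuaternionAlgebra.imJ h
      have e4 := congrArg QuaternionAlgebra.imK h
      simp at e3 e4
      first
      | (left; linear_combination e3)
      | (right; linear_combination e4)
  rcases hi with hi | hi
  · have e3 := congrArg QuaternionAlgebra.imJ hi
    have e4 := congrArg QuaternionAlgebra.imK hi
    simp at e3 e4
    have hd : u.imK = 0 := by
      have : 2 * u.imK = 0 := by linear_combination e3
      simpa [h2] using this
    have hc : u.imJ = 0 := by
      have : 2 * u.imJ = 0 := by linear_combination -e4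
      simpa [h2] using this
    rw [hc, hd] at hj' hn
    rcases hj' with h | h
    · exact absurd (by linear_combination h + hn) (hs u.re)
    · rcases key u.re u.imI (by linear_combination hn) (by simpa [h2] using h) with
        ⟨h5, h6⟩ | ⟨h5, h6⟩ | ⟨h5, h6⟩ | ⟨h5, h6⟩
      · exact Or.inr (Or.inr (Or.inl (by ext <;> simp [h5, h6, hc, hd])))
      · exact Or.inr (Or.inr (Or.inr (Or.inl (by ext <;> simp [h5, h6, hc, hd]))))
      · exact Or.inl (by ext <;> simp [h5, h6, hc, hd])
      · exact Or.inr (Or.inl (by ext <;> simp [h5, h6, hc, hd]))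
  · have e3 := congrArg QuaternionAlgebra.re hi
    have e4 := congrArg QuaternionAlgebra.imI hi
    simp at e3 e4
    have hd : u.imI = 0 := by
      have : 2 * u.imI = 0 := by linear_combination -e3
      simpa [h2] using this
    have hc : u.re = 0 := by
      have : 2 * u.re = 0 := by linear_combination e4
      simpa [h2] using this
    rw [hc, hd] at hj' hn
    rcases hj' with h | h
    · exact absurd (by linear_combination h + hn) (hs u.imJ)
    · rcases key u.imJ u.imK (by linear_combination hn) (by simpa [h2] using h) with
        ⟨h5, h6⟩ | ⟨h5, h6⟩ | ⟨h5, h6⟩ | ⟨h5, h6⟩ <;> unfold IsQ8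
      · iterate 6 right
        left; ext <;> simp [h5, h6, hc, hd]
      · iterate 7 right
        ext <;> simp [h5, h6, hc, hd]
      · iterate 4 right
        left; ext <;> simp [h5, h6, hc, hd]
      · iterate 5 right
        left; ext <;> simp [h5, h6, hc, hd]

/-- The normalizer of the quaternion group, when `2` is not a square. -/
lemma exists_wpow_mul_mem (hns : ¬ IsSquare (2 : F)) {u : UnitQuat F}
    (hu : ∀ a ∈ quatGroup F, u * a * u⁻¹ ∈ quatGroup F) :
    ∃ e : ZMod 3, wpow e * u ∈ quatGroup F := by
  have h1 : ∀ (e : ZMod 3), ((wpow e * u * ⟨qi, isQ8_qi.mem_unitQuat⟩ * (wpow e * u)⁻¹ : UnitQuat F) : ℍ[F]) = qi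
      ∨ ((wpow e * u * ⟨qi, isQ8_qi.mem_unitQuat⟩ * (wpow e * u)⁻¹ : UnitQuat F) : ℍ[F]) = -qi →
      wpow e * u ∈ quatGroup F := by
    intro e he
    apply isQ8_of_fix_qi hns (wpow e * u).2
    · have h4 : ((wpow e * u * ⟨qi, isQ8_qi.mem_unitQuat⟩ * (wpow e * u)⁻¹ : UnitQuat F) : ℍ[F])
        * ((wpow e * u : UnitQuat F) : ℍ[F]) = ((wpow e * u : UnitQuat F) : ℍ[F]) * qi := by
        rw [← Submonoid.coe_mul, inv_mul_cancel_right]; rfl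
      rw [← h4]
      rcases he with he | he <;> rw [he] <;> simp
    · have := wpow_conj_mem e (hu ⟨qj, isQ8_qj.mem_unitQuat⟩ isQ8_qj)
      rw [mem_quatGroup] at this
      have h5 : wpow e * (u * ⟨qj, isQ8_qj.mem_unitQuat⟩ * u⁻¹) * (wpow e)⁻¹ =
        (wpow e * u) * ⟨qj, isQ8_qj.mem_unitQuat⟩ * (wpow e * u)⁻¹ := by group
      rw [h5] at this
      exact this
  have h0 := hu ⟨qi, isQ8_qi.mem_unitQuat⟩ isQ8_qi
  have h3 : ∀ e : ZMod 3, ((wpow e * u * ⟨qi, isQ8_qi.mem_unitQuat⟩ * (wpow e * u)⁻¹ : UnitQuat F) : ℍ[F]) =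
     (wpow e : UnitQuat F) * ((u * ⟨qi, isQ8_qi.mem_unitQuat⟩ * u⁻¹ : UnitQuat F) : ℍ[F]) * star ((wpow e : UnitQuat F) : ℍ[F]) := by
    intro e
    have : wpow e * u * ⟨qi, isQ8_qi.mem_unitQuat⟩ * (wpow e * u)⁻¹ = wpow e *  (u * ⟨qi, isQ8_qi.mem_unitQuat⟩ * u⁻¹) * (wpow e)⁻¹ := by group
    rw [this]; rfl
  rw [mem_quatGroup] at h0
  have hw1 : (qw * star qw : ℍ[F]) = 1 := (Unitary.mem_iff.1 qw_mem_unitQuat).2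
  have hw2 : (star qw * qw : ℍ[F]) = 1 := (Unitary.mem_iff.1 qw_mem_unitQuat).1
  have hwp1 : ((wpow (1 : ZMod 3) : UnitQuat F) : ℍ[F]) = qw := by rw [wpow_one]; rfl
  have hwp2 : ((wpow (-1 : ZMod 3) : UnitQuat F) : ℍ[F]) = star qw := by
    rw [wpow_neg, wpow_one]; rfl
  have hne : u * ⟨qi, isQ8_qi.mem_unitQuat⟩ * u⁻¹ ≠ 1 ∧ ((u * ⟨qi, isQ8_qi.mem_unitQuat⟩ * u⁻¹ : UnitQuat F) : ℍ[F]) ≠ -1 := by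
    constructor
    · rw [Ne, conj_eq_one_iff, Subtype.ext_iff]
      intro h
      simpa using congrArg QuaternionAlgebra.re h
    · intro h
      have h6 : ((u * ⟨qi, isQ8_qi.mem_unitQuat⟩ * u⁻¹ : UnitQuat F) : ℍ[F]) * (u : ℍ[F]) = (u : ℍ[F]) * qi := by
        rw [← Submonoid.coe_mul, inv_mul_cancel_right]; rfl
      rw [h] at h6
      have h7 : ((u⁻¹ : UnitQuat F) : ℍ[F]) * ((u : ℍ[F]) * qi) = qi := by
        rw [← mul_assoc, ← Submonoid.coe_mul, inv_mul_cancel]; simp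
      rw [← h6] at h7
      have h8 : ((u⁻¹ : UnitQuat F) : ℍ[F]) * (u : ℍ[F]) = 1 := by
        rw [← Submonoid.coe_mul, inv_mul_cancel]; rfl
      rw [neg_one_mul, mul_neg, h8] at h7
      have h9 := congrArg QuaternionAlgebra.imI h7
      simp at h9
  rcases h0 with h | h | h | h | h | h | h | h
  · exact absurd (Subtype.ext h) hne.1
  · exact absurd h hne.2
  · exact ⟨0, h1 0 (by rw [h3, h]; simp)⟩
  · exact ⟨0, h1 0 (by rw [h3, h]; simp)⟩
  · refine ⟨-1, h1 (-1) (Or.inl ?_)⟩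
    rw [h3, h, hwp2, star_star, mul_assoc, ← qw_mul_qi, ← mul_assoc, hw2, one_mul]
  · refine ⟨-1, h1 (-1) (Or.inr ?_)⟩
    rw [h3, h, hwp2, star_star, mul_assoc, neg_mul, ← qw_mul_qi, mul_neg, ← mul_assoc, hw2, one_mul]
  · refine ⟨1, h1 1 (Or.inl ?_)⟩
    rw [h3, h, hwp1, qw_mul_qk, mul_assoc, hw1, mul_one]
  · refine ⟨1, h1 1 (Or.inr ?_)⟩
    rw [h3, h, hwp1, mul_neg, qw_mul_qk, neg_mul, mul_assoc, hw1, mul_one]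

end Quaternions

section Quaternions

open Quaternion

variable {F : Type*} [Field F] [NeZero (2 : F)]

/-- The quaternion with given coordinates. -/
def qmk (a b c d : F) : ℍ[F] := ⟨a, b, c, d⟩

omit [NeZero (2 : F)] in
@[simp] lemma qmk_re (a b c d : F) : (qmk a b c d).re = a := rfl
omit [NeZero (2 : F)] in
@[simp] lemma qmk_imI (a b c d : F) : (qmk a b c d).imI = b := rfl
omit [NeZero (2 : F)] in
@[simp] lemma qmk_imJ (a b c d : F) : (qmk a b c d).imJ = c := rfl
omit [NeZero (2 : F)] in
@[simp] lemma qmk_imK (a b c d : F) : (qmk a b c d).imK = d := rfl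

lemma wpow_mem_iff {e : ZMod 3} : wpow (F := F) e ∈ quatGroup F ↔ e = 0 := by
  refine ⟨fun h => ?_, fun h => by rw [h, wpow_zero]; exact one_mem _⟩
  have h2 := NeZero.ne (2 : F)
  have key : ¬ IsQ8 (qw : ℍ[F]) := by
    rintro (h | h | h | h | h | h | h | h) <;>
    · have e2 := congrArg QuaternionAlgebra.imI h
      have e3 := congrArg QuaternionAlgebra.imJ h
      simp [h2] at e2 e3
  fin_cases e
  · rfl
  · have : wpow (F := F) 1 ∈ quatGroup F := h
    rw [wpow_one] at this
    exact absurd this key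
  · have : wpow (F := F) (-1) ∈ quatGroup F := h
    rw [wpow_neg, inv_mem_iff, wpow_one] at this
    exact absurd this key

/-- `u` lies in the coset of `ω ^ e` in the normalizer of the quaternion group. -/
def IsCls (u : UnitQuat F) (e : ZMod 3) : Prop := (wpow e)⁻¹ * u ∈ quatGroup F

lemma IsCls.mul {u v : UnitQuat F} {e f : ZMod 3} (hu : IsCls u e) (hv : IsCls v f) :
    IsCls (u * v) (e + f) := by
  unfold IsCls at *
  have h := mul_mem (wpow_conj_mem' f hu) hv
  rw [wpow_add]
  convert h using 1
  simp only [mul_inv_rev, mul_assoc, mul_inv_cancel_left]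

lemma IsCls.eq {u : UnitQuat F} {e f : ZMod 3} (hu : IsCls u e) (hv : IsCls u f) : e = f := by
  unfold IsCls at *
  have := mul_mem hu (inv_mem hv)
  rw [show (wpow e)⁻¹ * u * ((wpow f)⁻¹ * u)⁻¹ = (wpow e)⁻¹ * wpow (F := F) f by group, ← wpow_neg,
    ← wpow_add, wpow_mem_iff] at this
  linear_combination -this

lemma isCls_zero {u : UnitQuat F} : IsCls u 0 ↔ u ∈ quatGroup F := by simp [IsCls]

lemma isCls_wpow (e : ZMod 3) : IsCls (wpow (F := F) e) e := by
  simp [IsCls]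

lemma IsCls.inv {u : UnitQuat F} {e : ZMod 3} (hu : IsCls u e) : IsCls u⁻¹ (-e) := by
  unfold IsCls at *
  have := wpow_conj_mem e (inv_mem hu)
  rw [wpow_neg, inv_inv]
  convert this using 1
  group

lemma IsCls.conj_mem {u a : UnitQuat F} {e : ZMod 3} (hu : IsCls u e) (ha : a ∈ quatGroup F) :
    u * a * u⁻¹ ∈ quatGroup F := by
  have := (hu.mul (isCls_zero.2 ha)).mul hu.inv
  rwa [add_zero, add_neg_cancel, isCls_zero] at this

lemma exists_isCls (hns : ¬ IsSquare (2 : F)) {u : UnitQuat F}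
    (hu : ∀ a ∈ quatGroup F, u * a * u⁻¹ ∈ quatGroup F) : ∃ e : ZMod 3, IsCls u e := by
  obtain ⟨e, he⟩ := exists_wpow_mul_mem hns hu
  exact ⟨-e, by rwa [IsCls, wpow_neg, inv_inv]⟩

variable [Finite F]

omit [Finite F] in
lemma wpow_pow_three (e : ZMod 3) : wpow (F := F) e ^ 3 = 1 := by
  rw [wpow, ← pow_mul, mul_comm, pow_mul, omega_pow_three, one_pow]

/-- When `2` is not a square, the quaternion group is a Sylow `2`-subgroup. -/
lemma isMaxTwo_quatGroup (hns : ¬ IsSquare (2 : F)) : IsMaxTwo (quatGroup F) ⊤ := by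
  refine ⟨le_top, isPGroup_quatGroup, fun R hQR _ hR => ?_⟩
  have : Fact (Nat.Prime 2) := ⟨Nat.prime_two⟩
  refine hR.le_of_normalizing hQR fun x hx h => ?_
  obtain ⟨e, he⟩ := exists_wpow_mul_mem hns h
  have h1 : wpow e ∈ R := by
    have := mul_mem (hQR he) (inv_mem hx)
    rwa [mul_inv_cancel_right] at this
  obtain ⟨k, hk⟩ := hR ⟨_, h1⟩
  have hk' : wpow (F := F) e ^ 2 ^ k = 1 := congrArg Subtype.val hk
  have h3 : wpow (F := F) e = 1 := by
    have hc : Nat.Coprime 3 (2 ^ k) := Nat.Coprime.pow_right _ (by norm_num)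
    have h4 := Nat.dvd_gcd (orderOf_dvd_of_pow_eq_one (wpow_pow_three (F := F) e))
      (orderOf_dvd_of_pow_eq_one hk')
    rw [hc.gcd_eq_one, Nat.dvd_one, orderOf_eq_one_iff] at h4
    exact h4
  rwa [h3, one_mul] at he

lemma IsPGroup.comm_up_to_sign (hns : ¬ IsSquare (2 : F)) {R : Subgroup (UnitQuat F)}
    (hR : IsPGroup 2 R) {a b : UnitQuat F} (ha : a ∈ R) (hb : b ∈ R) :
    (a : ℍ[F]) * b = b * a ∨ (a : ℍ[F]) * b = -(b * a) := by
  obtain ⟨x, -, hx⟩ := (isMaxTwo_quatGroup hns).exists_conj hR le_top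
  have h1 := IsQ8.comm (hx a ha) (hx b hb)
  have hxx : ((x⁻¹ : UnitQuat F) : ℍ[F]) * (x : ℍ[F]) = 1 := by
    rw [← Submonoid.coe_mul, inv_mul_cancel]; rfl
  have e1 : ∀ c d : UnitQuat F, ((x * c * x⁻¹ : UnitQuat F) : ℍ[F]) * ((x * d * x⁻¹ : UnitQuat F) : ℍ[F])
    = (x : ℍ[F]) * ((c : ℍ[F]) * (d : ℍ[F])) * ((x⁻¹ : UnitQuat F) : ℍ[F]) := by
    intro c d
    simp only [← Submonoid.coe_mul]
    congr 1; group
  have e2 : ∀ c : ℍ[F], ((x⁻¹ : UnitQuat F) : ℍ[F]) * ((x : ℍ[F]) * c * ((x⁻¹ : UnitQuat F) : ℍ[F])) * (x : ℍ[F]) = c := by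
    intro c
    rw [mul_assoc, mul_assoc, hxx, mul_one, ← mul_assoc, hxx, one_mul]
  rw [e1, e1] at h1
  refine h1.imp (fun h => ?_) (fun h => ?_)
  · rw [← e2 ((a : ℍ[F]) * b), h, e2]
  · rw [← e2 ((a : ℍ[F]) * b), h, mul_neg, neg_mul, e2]

omit [Finite F] in
lemma coords_of_comm_qi {u : ℍ[F]} (hu : u * qi = qi * u) : u.imJ = 0 ∧ u.imK = 0 := by
  have h2 := NeZero.ne (2 : F)
  have e3 := congrArg QuaternionAlgebra.imJ hu
  have e4 := congrArg QuaternionAlgebra.imK hu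
  simp at e3 e4
  constructor
  · have : 2 * u.imJ = 0 := by linear_combination -e4
    simpa [h2] using this
  · have : 2 * u.imK = 0 := by linear_combination e3
    simpa [h2] using this

omit [Finite F] in
lemma coords_of_anticomm_qi {u : ℍ[F]} (hu : u * qi = -(qi * u)) : u.re = 0 ∧ u.imI = 0 := by
  have h2 := NeZero.ne (2 : F)
  have e3 := congrArg QuaternionAlgebra.re hu
  have e4 := congrArg QuaternionAlgebra.imI hu
  simp at e3 e4
  constructor
  · have : 2 * u.re = 0 := by linear_combination e4
    simpa [h2] using this
  · have : 2 * u.imI = 0 := by linear_combination -e3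
    simpa [h2] using this

/-- The unit `j` as an element of the norm one group. -/
def unitJ (F : Type*) [Field F] : UnitQuat F := ⟨qj, isQ8_qj.mem_unitQuat⟩

omit [NeZero (2 : F)] [Finite F] in
@[simp] lemma coe_unitJ : (unitJ F : ℍ[F]) = qj := rfl

omit [Finite F] in
lemma commute_of_comm_qi {u v : UnitQuat F} (hu : (u : ℍ[F]) * qi = qi * (u : ℍ[F]))
    (hv : (v : ℍ[F]) * qi = qi * (v : ℍ[F])) : Commute u v := by
  obtain ⟨a1, a2⟩ := coords_of_comm_qi hu
  obtain ⟨a3, a4⟩ := coords_of_comm_qi hv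
  apply Subtype.ext
  rw [Submonoid.coe_mul, Submonoid.coe_mul]
  ext <;> simp [a1, a2, a3, a4] <;> ring

/-- The `2`-elements commuting with `i`. -/
def comTwo (F : Type*) [Field F] [NeZero (2 : F)] : Subgroup (UnitQuat F) where
  carrier := {u | (∃ k, u ^ 2 ^ k = 1) ∧ (u : ℍ[F]) * qi = qi * (u : ℍ[F])}
  one_mem' := ⟨⟨0, by simp⟩, by simp⟩
  inv_mem' := by
    rintro u ⟨⟨k, hk⟩, hu⟩
    refine ⟨⟨k, by rw [inv_pow, hk, inv_one]⟩, ?_⟩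
    have h := congrArg star hu
    change star (u : ℍ[F]) * qi = qi * star (u : ℍ[F])
    simp only [star_mul, star_qi, neg_mul, mul_neg, neg_inj] at h
    exact h.symm
  mul_mem' := by
    rintro u v ⟨⟨k, hk⟩, hu⟩ ⟨⟨l, hl⟩, hv⟩
    refine ⟨⟨k + l, ?_⟩, ?_⟩
    · rw [(commute_of_comm_qi hu hv).mul_pow, pow_add, pow_mul, hk, one_pow, mul_comm, pow_mul, hl,
        one_pow, one_mul]
    · rw [Submonoid.coe_mul, mul_assoc, hv, ← mul_assoc, hu, mul_assoc]

omit [Finite F] in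
lemma unitJ_conj {u : UnitQuat F} (hu : (u : ℍ[F]) * qi = qi * (u : ℍ[F])) :
    unitJ F * u = u⁻¹ * unitJ F := by
  obtain ⟨a1, a2⟩ := coords_of_comm_qi hu
  apply Subtype.ext
  change qj * (u : ℍ[F]) = star (u : ℍ[F]) * qj
  ext <;> simp [a1, a2]

omit [Finite F] in
lemma unitJ_sq_mem : unitJ F * unitJ F ∈ comTwo F := by
  have h : ((unitJ F * unitJ F : UnitQuat F) : ℍ[F]) = -1 := qj_mul_qj
  refine ⟨⟨1, ?_⟩, ?_⟩
  · apply Subtype.ext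
    rw [SubmonoidClass.coe_pow, h]; simp
  · rw [h]; simp

/-- A Sylow `2`-subgroup of the norm one quaternions, when `2` is a square. -/
def bigQuatGroup (F : Type*) [Field F] [NeZero (2 : F)] : Subgroup (UnitQuat F) where
  carrier := {u | u ∈ comTwo F ∨ u * unitJ F ∈ comTwo F}
  one_mem' := Or.inl (one_mem _)
  inv_mem' := by
    rintro u (hu | hu)
    · exact Or.inl (inv_mem hu)
    · right
      have h := unitJ_conj (inv_mem hu).2
      rw [inv_inv] at h
      have h2 : u⁻¹ * unitJ F = u * unitJ F * (unitJ F * unitJ F) := by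
        rw [← mul_assoc, ← h]; group
      rw [h2]
      exact mul_mem hu unitJ_sq_mem
  mul_mem' := by
    rintro u v (hu | hu) (hv | hv)
    · exact Or.inl (mul_mem hu hv)
    · right; rw [mul_assoc]; exact mul_mem hu hv
    · right
      have h := unitJ_conj (inv_mem hv).2
      rw [inv_inv] at h
      rw [mul_assoc, ← h, ← mul_assoc]
      exact mul_mem hu (inv_mem hv)
    · left
      have h := unitJ_conj (inv_mem hv).2
      have h2 : u * v = u * unitJ F * (v * unitJ F)⁻¹ * (unitJ F * unitJ F)⁻¹ := by
        rw [mul_inv_rev (unitJ F), ← mul_assoc, mul_assoc u, h]; group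
      rw [h2]
      exact mul_mem (mul_mem hu (inv_mem hv)) (inv_mem unitJ_sq_mem)

omit [Finite F] in
lemma bigQuatGroup_comm_or_anticomm {u : UnitQuat F} (hu : u ∈ bigQuatGroup F) :
    (u : ℍ[F]) * qi = qi * (u : ℍ[F]) ∨ (u : ℍ[F]).re = 0 := by
  rcases hu with hu | hu
  · exact Or.inl hu.2
  · right
    have := (coords_of_comm_qi hu.2).1
    simpa using this

omit [Finite F] in
lemma quatGroup_le_bigQuatGroup : quatGroup F ≤ bigQuatGroup F := by
  have h1 : ∀ u : UnitQuat F, u ∈ quatGroup F → (u : ℍ[F]) * qi = qi * (u : ℍ[F]) → u ∈ comTwo F :=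
    fun u hu h => ⟨⟨2, quatGroup_sq hu⟩, h⟩
  intro u hu
  have hu' := mul_mem hu (show unitJ F ∈ quatGroup F from isQ8_qj)
  have h3 : ((u * unitJ F : UnitQuat F) : ℍ[F]) = (u : ℍ[F]) * qj := rfl
  rcases id hu with h | h | h | h | h | h | h | h
  iterate 4 exact Or.inl (h1 _ hu (by simp [h]))
  all_goals exact Or.inr (h1 _ hu' (by simp [h3, h, qj_mul_qj, qk_mul_qj]))

omit [Finite F] in
lemma isPGroup_bigQuatGroup : IsPGroup 2 (bigQuatGroup F) := by
  rintro ⟨u, hu⟩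
  have hd : ∀ v : UnitQuat F, v ∈ comTwo F → ∃ k, v ^ 2 ^ k = 1 := fun v hv => hv.1
  have h2 : u ^ 2 ∈ comTwo F := by
    rcases hu with hu | hu
    · exact pow_mem hu 2
    · have h := unitJ_conj (inv_mem hu).2
      rw [inv_inv] at h
      have h2 : u ^ 2 = (unitJ F * unitJ F)⁻¹ := by
        rw [eq_inv_iff_mul_eq_one, pow_two, ← mul_assoc, mul_assoc u u, mul_assoc u, ← h]; group
      rw [h2]
      exact inv_mem unitJ_sq_mem
  obtain ⟨k, hk⟩ := hd _ h2
  refine ⟨1 + k, Subtype.ext ?_⟩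
  rw [SubmonoidClass.coe_pow, pow_add, pow_mul, pow_one, hk]; rfl

omit [Finite F] in
/-- When `2` is a square, `bigQuatGroup` is self-normalizing. -/
lemma mem_bigQuatGroup_of_normalizing (hs : IsSquare (2 : F)) {g : UnitQuat F}
    (hg : ∀ u ∈ bigQuatGroup F, g * u * g⁻¹ ∈ bigQuatGroup F) : g ∈ bigQuatGroup F := by
  have h20 := NeZero.ne (2 : F)
  obtain ⟨s, hs⟩ := hs
  have hs0 : s ≠ 0 := by rintro rfl; simp [h20] at hs
  have hJ : unitJ F ∈ bigQuatGroup F := quatGroup_le_bigQuatGroup isQ8_qj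
  -- the case where `g` commutes with `i`
  have key : ∀ g : UnitQuat F, (∀ u ∈ bigQuatGroup F, g * u * g⁻¹ ∈ bigQuatGroup F) →
      (g : ℍ[F]) * qi = qi * (g : ℍ[F]) → g ∈ bigQuatGroup F := by
    intro g hg h
    have h1 := mul_mem (hg _ hJ) (inv_mem hJ)
    have h3 := unitJ_conj h
    have h2 : g * unitJ F * g⁻¹ * (unitJ F)⁻¹ = g * g := by
      have h4 : g * unitJ F = unitJ F * g⁻¹ := by
        rw [eq_mul_inv_iff_mul_eq, mul_assoc, h3, mul_inv_cancel_left]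
      rw [mul_assoc g, ← h4]; group
    rw [h2] at h1
    have h5 : g * g ∈ comTwo F := by
      rcases h1 with h1 | h1
      · exact h1
      · exfalso
        have a := coords_of_comm_qi h1.2
        have b := coords_of_comm_qi h
        have hn := mem_unitQuat.1 (g * g).2
        simp [b.1, b.2] at a hn
        simp [a.1, a.2] at hn
    obtain ⟨⟨k, hk⟩, -⟩ := h5
    exact Or.inl ⟨⟨1 + k, by rw [pow_add, pow_mul, pow_one, pow_two, hk]⟩, h⟩
  have hsi : s⁻¹ * s⁻¹ = 2⁻¹ := by rw [hs, mul_inv]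
  let η : UnitQuat F := ⟨qmk s⁻¹ s⁻¹ 0 0, by
    rw [mem_unitQuat]; simp only [qmk_re, qmk_imI, qmk_imJ, qmk_imK]
    linear_combination 2 * hsi + inv_mul_cancel₀ h20⟩
  have hη4 : η ^ 2 ^ 3 = 1 := by
    have h1 : η ^ 2 = ⟨qi, isQ8_qi.mem_unitQuat⟩ := by
      apply Subtype.ext
      rw [pow_two]
      ext <;> simp [η, hsi]
      field_simp; norm_num
    rw [show 2 ^ 3 = 2 * 4 from rfl, pow_mul, h1]
    exact quatGroup_sq isQ8_qi
  have hη : η ∈ bigQuatGroup F := Or.inl ⟨⟨3, hη4⟩, by ext <;> simp [η]⟩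
  have hv := hg η hη
  set v := g * η * g⁻¹ with hvdef
  have hvg : (v : ℍ[F]) * (g : ℍ[F]) = (g : ℍ[F]) * (η : ℍ[F]) := by
    rw [← Submonoid.coe_mul, hvdef, inv_mul_cancel_right]; rfl
  have hvre : (v : ℍ[F]).re = s⁻¹ := by
    have hn := mem_unitQuat.1 g.2
    have : (v : ℍ[F]) = (g : ℍ[F]) * (η : ℍ[F]) * star (g : ℍ[F]) := rfl
    rw [this]
    simp [η]
    linear_combination s⁻¹ * hn
  rcases bigQuatGroup_comm_or_anticomm hv with h | h
  · obtain ⟨c1, c2⟩ := coords_of_comm_qi h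
    have hn := mem_unitQuat.1 v.2
    have hb : ((v : ℍ[F]).imI - s⁻¹) * ((v : ℍ[F]).imI + s⁻¹) = 0 := by
      rw [c1, c2, hvre] at hn
      have h6 : (2 : F)⁻¹ * 2 = 1 := inv_mul_cancel₀ h20
      linear_combination hn - 2 * hsi - h6
    have e1 := congrArg QuaternionAlgebra.re hvg
    have e2 := congrArg QuaternionAlgebra.imI hvg
    have e3 := congrArg QuaternionAlgebra.imJ hvg
    have e4 := congrArg QuaternionAlgebra.imK hvg
    simp [η, c1, c2, hvre] at e1 e2 e3 e4
    have hsi0 : s⁻¹ ≠ 0 := inv_ne_zero hs0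
    rcases mul_eq_zero.1 hb with hb | hb
    · have hb' : (v : ℍ[F]).imI = s⁻¹ := by linear_combination hb
      rw [hb'] at e1 e2 e3 e4
      refine key g hg ?_
      have d1 : (g : ℍ[F]).imJ = 0 := by
        have : (2 * s⁻¹) * (g : ℍ[F]).imJ = 0 := by linear_combination e4
        simpa [h20, hsi0] using this
      have d2 : (g : ℍ[F]).imK = 0 := by
        have : (2 * s⁻¹) * (g : ℍ[F]).imK = 0 := by linear_combination -e3
        simpa [h20, hsi0] using this
      ext <;> simp [d1, d2]
    · have hb' : (v : ℍ[F]).imI = -s⁻¹ := by linear_combination hb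
      rw [hb'] at e1 e2 e3 e4
      have d1 : (g : ℍ[F]).re = 0 := by
        have : (2 * s⁻¹) * (g : ℍ[F]).re = 0 := by linear_combination -e2
        simpa [h20, hsi0] using this
      have d2 : (g : ℍ[F]).imI = 0 := by
        have : (2 * s⁻¹) * (g : ℍ[F]).imI = 0 := by linear_combination e1
        simpa [h20, hsi0] using this
      have h7 : g * unitJ F ∈ bigQuatGroup F := by
        refine key _ (fun u hu => ?_) (by ext <;> simp [d1, d2])
        have := hg _ (mul_mem (mul_mem hJ hu) (inv_mem hJ))
        rw [mul_inv_rev]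
        simpa [mul_assoc] using this
      have := mul_mem h7 (inv_mem hJ)
      rwa [mul_inv_cancel_right] at this
  · exact absurd (hvre.symm.trans h) (inv_ne_zero hs0)

/-- A self-normalizing Sylow `2`-subgroup exists when `2` is a square. -/
lemma isMaxTwo_bigQuatGroup (hs : IsSquare (2 : F)) : IsMaxTwo (bigQuatGroup F) ⊤ := by
  refine ⟨le_top, isPGroup_bigQuatGroup, fun R hQR _ hR => ?_⟩
  have : Fact (Nat.Prime 2) := ⟨Nat.prime_two⟩
  exact hR.le_of_normalizing hQR fun x hx h => mem_bigQuatGroup_of_normalizing hs h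

end Quaternions

section Burnside

variable {G : Type*} [Group G] [Finite G]

/-- Burnside's transfer theorem, modulo a normal `2`-subgroup. -/
lemma exists_normal_of_normalizer_le {Z P : Subgroup G} [Z.Normal] (hP : IsMaxTwo P ⊤) (hZP : Z ≤ P)
    (h : ∀ x, (∀ p ∈ P, x * p * x⁻¹ ∈ P) → ∀ p ∈ P, x * p * x⁻¹ * p⁻¹ ∈ Z) :
    ∃ R : Subgroup G, R.Normal ∧ (∃ m, Odd m ∧ ∀ r ∈ R, r ^ m ∈ Z) ∧
      ∀ x y, x * y * x⁻¹ * y⁻¹ ∈ R := by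
  have : Fact (Nat.Prime 2) := ⟨Nat.prime_two⟩
  obtain ⟨S, rfl⟩ := hP.exists_sylow
  let f := QuotientGroup.mk' Z
  have hf : Function.Surjective f := QuotientGroup.mk'_surjective Z
  let T : Sylow 2 (G ⧸ Z) := S.mapSurjective hf
  have hT : (T : Subgroup (G ⧸ Z)) = (S : Subgroup G).map f := rfl
  have hmem : ∀ x : G, f x ∈ (T : Subgroup (G ⧸ Z)) ↔ x ∈ (S : Subgroup G) := by
    intro x
    rw [hT]
    refine ⟨?_, fun hx => ⟨x, hx, rfl⟩⟩
    rintro ⟨y, hy, hxy⟩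
    have := (QuotientGroup.eq (s := Z)).1 hxy
    have := mul_mem hy (hZP this)
    rwa [mul_inv_cancel_left] at this
  have hN : Subgroup.normalizer (T : Set (G ⧸ Z)) ≤ Subgroup.centralizer (T : Set (G ⧸ Z)) := by
    intro x hx
    obtain ⟨x, rfl⟩ := hf x
    rw [Subgroup.mem_centralizer_iff]
    intro y hy
    obtain ⟨y, rfl⟩ := hf y
    replace hx := (Subgroup.mem_normalizer_iff (H := (T : Subgroup (G ⧸ Z)))).1 hx
    have h1 := h x (fun p hp => by
      rw [← hmem, map_mul, map_mul, map_inv]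
      exact (hx _).1 ((hmem p).2 hp)) y ((hmem y).1 hy)
    rw [← QuotientGroup.eq_one_iff] at h1
    change f _ = 1 at h1
    rw [map_mul, map_mul, map_mul, map_inv, map_inv, mul_inv_eq_one, mul_inv_eq_iff_eq_mul] at h1
    exact h1.symm
  have hcomm : ∀ a b : T, a * b = b * a := fun a b => Subtype.ext
    ((Subgroup.mem_centralizer_iff.1 (hN (Subgroup.le_normalizer b.2))) a a.2)
  let τ := MonoidHom.transferSylow T hN
  refine ⟨τ.ker.comap f, inferInstance, ⟨Nat.card τ.ker, ?_, ?_⟩, ?_⟩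
  · rw [← Nat.not_even_iff_odd, even_iff_two_dvd]
    exact MonoidHom.not_dvd_card_ker_transferSylow T hN
  · intro r hr
    rw [← QuotientGroup.eq_one_iff]
    have := pow_card_eq_one' (x := (⟨f r, hr⟩ : τ.ker))
    exact congrArg Subtype.val this
  · intro x y
    rw [Subgroup.mem_comap, MonoidHom.mem_ker]
    simp only [map_mul, map_inv]
    rw [hcomm (τ (f x)), mul_inv_cancel_right, mul_inv_cancel]

end Burnside

section Conj

open Quaternion

variable {F : Type*} [Field F]

lemma UnitQuat.coe_inv_mul (x : UnitQuat F) : ((x⁻¹ : UnitQuat F) : ℍ[F]) * (x : ℍ[F]) = 1 :=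
  (Unitary.mem_iff.1 x.2).1

lemma UnitQuat.coe_mul_inv (x : UnitQuat F) : (x : ℍ[F]) * ((x⁻¹ : UnitQuat F) : ℍ[F]) = 1 :=
  (Unitary.mem_iff.1 x.2).2

/-- Conjugation by a quaternion of norm one. -/
def conjQ (x : UnitQuat F) : ℍ[F] →ₐ[F] ℍ[F] where
  toFun a := (x : ℍ[F]) * a * ((x⁻¹ : UnitQuat F) : ℍ[F])
  map_one' := by rw [mul_one, UnitQuat.coe_mul_inv x]
  map_zero' := by simp
  map_mul' a b := by
    have : ∀ c : ℍ[F], ((x⁻¹ : UnitQuat F) : ℍ[F]) * ((x : ℍ[F]) * c) = c := fun c => by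
      rw [← mul_assoc, UnitQuat.coe_inv_mul x, one_mul]
    simp only [mul_assoc, this]
  map_add' a b := by rw [mul_add, add_mul]
  commutes' r := by
    rw [← Algebra.commutes, mul_assoc, UnitQuat.coe_mul_inv x, mul_one]

lemma conjQ_apply (x : UnitQuat F) (a : ℍ[F]) : conjQ x a = (x : ℍ[F]) * a * star (x : ℍ[F]) := rfl

lemma conjQ_coe (x y : UnitQuat F) : conjQ x (y : ℍ[F]) = ((x * y * x⁻¹ : UnitQuat F) : ℍ[F]) := rfl

lemma conjQ_mul (x y : UnitQuat F) (a : ℍ[F]) : conjQ (x * y) a = conjQ x (conjQ y a) := by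
  simp [conjQ_apply, mul_assoc]

@[simp] lemma conjQ_one (a : ℍ[F]) : conjQ 1 a = a := by
  simp [conjQ_apply]

@[simp] lemma conjQ_inv_conjQ (x : UnitQuat F) (a : ℍ[F]) : conjQ x⁻¹ (conjQ x a) = a := by
  rw [← conjQ_mul]; simp

lemma conjQ_injective (x : UnitQuat F) : Function.Injective (conjQ x) :=
  Function.LeftInverse.injective (conjQ_inv_conjQ x)

@[simp] lemma conjQ_re (x : UnitQuat F) (a : ℍ[F]) : (conjQ x a).re = a.re := by
  have hn := mem_unitQuat.1 x.2
  rw [conjQ_apply]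
  simp
  linear_combination a.re * hn

lemma conjQ_star (x : UnitQuat F) (a : ℍ[F]) : conjQ x (star a) = star (conjQ x a) := by
  simp [conjQ_apply, mul_assoc]

@[simp] lemma conjQ_normSq (x : UnitQuat F) (a : ℍ[F]) : normSq (conjQ x a) = normSq a := by
  rw [normSq_def, normSq_def, ← conjQ_star, ← map_mul, conjQ_re]

lemma conjQ_eq_self_iff (x : UnitQuat F) (a : ℍ[F]) : conjQ x a = a ↔ (x : ℍ[F]) * a = a * x := by
  have h1 := UnitQuat.coe_inv_mul x
  have h2 := UnitQuat.coe_mul_inv x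
  constructor
  · intro h
    have : conjQ x a * x = (x : ℍ[F]) * a := by
      rw [conjQ_apply, mul_assoc]
      change _ * (((x⁻¹ : UnitQuat F) : ℍ[F]) * x) = _
      rw [h1, mul_one]
    rw [← this, h]
  · intro h
    rw [conjQ_apply, h, mul_assoc]
    change _ * ((x : ℍ[F]) * ((x⁻¹ : UnitQuat F) : ℍ[F])) = _
    rw [h2, mul_one]

/-- The pure part of a quaternion. -/
def pureQ (a : ℍ[F]) : ℍ[F] := a - (a.re : ℍ[F])

@[simp] lemma pureQ_re (a : ℍ[F]) : (pureQ a).re = 0 := by simp [pureQ]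

lemma pureQ_add (a : ℍ[F]) : pureQ a + (a.re : ℍ[F]) = a := by rw [pureQ, sub_add_cancel]

lemma conjQ_pureQ (x : UnitQuat F) (a : ℍ[F]) : conjQ x (pureQ a) = pureQ (conjQ x a) := by
  rw [pureQ, pureQ, map_sub, conjQ_re]
  congr 1
  exact (conjQ x).commutes a.re

lemma pureQ_comm {a b : ℍ[F]} (h : a * b = b * a) : pureQ a * pureQ b = pureQ b * pureQ a := by
  have h1 := Quaternion.coe_commutes a.re b
  have h2 := Quaternion.coe_commutes b.re a
  have h3 := Quaternion.coe_commutes a.re (b.re : ℍ[F])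
  simp only [pureQ, sub_mul, mul_sub, h, h1, h2, h3]
  abel

lemma coe_pureQ_eq_zero {a : UnitQuat F} (h : pureQ (a : ℍ[F]) = 0) :
    (a : ℍ[F]) = 1 ∨ (a : ℍ[F]) = -1 := by
  have h1 : (a : ℍ[F]) = ((a : ℍ[F]).re : ℍ[F]) := sub_eq_zero.1 h
  have hn := mem_unitQuat.1 a.2
  rw [h1] at hn
  simp at hn
  rcases hn with hn | hn
  · left; rw [h1, hn]; rfl
  · right; rw [h1, hn]; ext <;> simp

variable [NeZero (2 : F)]

lemma exists_smul_of_comm {u v : ℍ[F]} (hu : u.re = 0) (hv : v.re = 0) (hu0 : u ≠ 0)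
    (h : u * v = v * u) : ∃ c : F, v = c • u := by
  have h2 := NeZero.ne (2 : F)
  have e2 := congrArg QuaternionAlgebra.imI h
  have e3 := congrArg QuaternionAlgebra.imJ h
  have e4 := congrArg QuaternionAlgebra.imK h
  simp [hu, hv] at e2 e3 e4
  have f2 : u.imJ * v.imK = u.imK * v.imJ := by
    apply mul_left_cancel₀ h2; linear_combination e2
  have f3 : u.imI * v.imK = u.imK * v.imI := by
    apply mul_left_cancel₀ h2; linear_combination -e3
  have f4 : u.imI * v.imJ = u.imJ * v.imI := by
    apply mul_left_cancel₀ h2; linear_combination e4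
  by_cases h1 : u.imI = 0
  · by_cases h3 : u.imJ = 0
    · have h4 : u.imK ≠ 0 := fun h4 => hu0 (by ext <;> simp [*])
      refine ⟨v.imK / u.imK, ?_⟩
      ext <;> simp [hu, hv] <;> field_simp
      · linear_combination -f3
      · linear_combination -f2
    · refine ⟨v.imJ / u.imJ, ?_⟩
      ext <;> simp [hu, hv] <;> field_simp
      · linear_combination -f4
      · linear_combination f2
  · refine ⟨v.imI / u.imI, ?_⟩
    ext <;> simp [hu, hv] <;> field_simp
    · linear_combination f4
    · linear_combination f3

/-- Two orthogonal isotropic pure quaternions are proportional. -/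
lemma exists_smul_of_isotropic {u v : ℍ[F]} (hu : u.re = 0) (hv : v.re = 0) (hu0 : u ≠ 0)
    (huu : u * u = 0) (hvv : v * v = 0) (h : (u * v).re = 0) : ∃ c : F, v = c • u := by
  have hanti : v * u = -(u * v) := by
    simp [hu, hv] at h
    ext <;> simp [hu, hv]
    · linear_combination 2 * h
    · ring
    · ring
    · ring
  by_cases huv : u * v = 0
  · exact exists_smul_of_comm hu hv hu0 (by rw [hanti, huv, neg_zero])
  have hv0 : v ≠ 0 := by rintro rfl; simp at huv
  obtain ⟨c, hc⟩ := exists_smul_of_comm hu h hu0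
    (by rw [← mul_assoc, huu, mul_assoc, hanti, mul_neg, ← mul_assoc, huu]; simp)
  obtain ⟨d, hd⟩ := exists_smul_of_comm hv h hv0
    (by rw [← mul_assoc, hanti, neg_mul, mul_assoc, hvv]; simp)
  have hd0 : d ≠ 0 := by rintro rfl; rw [zero_smul] at hd; exact huv hd
  refine ⟨d⁻¹ * c, ?_⟩
  rw [mul_smul, ← hc, hd, smul_smul, inv_mul_cancel₀ hd0, one_smul]

end Conj

section Transfer

open Quaternion

lemma not_dvd_orderOf_of_mem_commutator {G : Type*} [Group G] [Finite G] {p : ℕ} [Fact p.Prime]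
    (P : Sylow p G) (hP : ∀ x, (∀ y ∈ P, x * y * x⁻¹ ∈ P) → ∀ y ∈ P, x * y = y * x)
    {a : G} (ha : a ∈ commutator G) : ¬ p ∣ orderOf a := by
  have hN : Subgroup.normalizer (P : Set G) ≤ Subgroup.centralizer (P : Set G) := by
    intro x hx
    rw [Subgroup.mem_centralizer_iff]
    intro y hy
    exact (hP x (fun z hz => ((Subgroup.mem_normalizer_iff (H := (P : Subgroup G))).1 hx z).1 hz)
      y hy).symm
  have hcomm : ∀ y ∈ P, ∀ z ∈ P, y * z = z * y := fun y hy z hz =>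
    hP y (fun w hw => mul_mem (mul_mem hy hw) (inv_mem hy)) z hz
  have hle : commutator G ≤ (MonoidHom.transferSylow P hN).ker := by
    rw [commutator_def, Subgroup.commutator_le]
    intro g _ h _
    rw [MonoidHom.mem_ker, map_commutatorElement, commutatorElement_eq_one_iff_mul_comm]
    exact Subtype.ext (hcomm _ (Subtype.prop _) _ (Subtype.prop _))
  intro hdvd
  apply MonoidHom.not_dvd_card_ker_transferSylow P hN
  refine hdvd.trans ?_
  rw [← Subgroup.orderOf_mk a (hle ha)]
  exact orderOf_dvd_natCard _

end Transfer

section Unipotent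

open Quaternion

variable {F : Type*} [Field F] [NeZero (2 : F)]

omit [NeZero (2 : F)] in
lemma UnitQuat.sq_eq (a : UnitQuat F) :
    (a : ℍ[F]) * (a : ℍ[F]) = (2 * (a : ℍ[F]).re) • (a : ℍ[F]) - 1 := by
  have hn := mem_unitQuat.1 a.2
  ext <;> simp
  · linear_combination -hn
  · ring
  · ring
  · ring

omit [NeZero (2 : F)] in
lemma UnitQuat.pureQ_mul_self (a : UnitQuat F) :
    pureQ (a : ℍ[F]) * pureQ (a : ℍ[F]) = (((a : ℍ[F]).re ^ 2 - 1 : F) : ℍ[F]) := by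
  have hn := mem_unitQuat.1 a.2
  ext <;> simp [pureQ, -Quaternion.coe_pow]
  · linear_combination -hn
  · ring
  · ring
  · ring

lemma exists_smul_pureQ {a b : UnitQuat F} (ha : pureQ (a : ℍ[F]) ≠ 0)
    (h : a * b = b * a) : ∃ c : F, pureQ (b : ℍ[F]) = c • pureQ (a : ℍ[F]) :=
  exists_smul_of_comm (pureQ_re _) (pureQ_re _) ha (pureQ_comm (congrArg Subtype.val h))

omit [NeZero (2 : F)] in
lemma mul_comm_of_pureQ_smul {a b : UnitQuat F} {c d : F} {n : ℍ[F]}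
    (ha : pureQ (a : ℍ[F]) = c • n) (hb : pureQ (b : ℍ[F]) = d • n) : a * b = b * a := by
  apply Subtype.ext
  change (a : ℍ[F]) * (b : ℍ[F]) = (b : ℍ[F]) * (a : ℍ[F])
  rw [← pureQ_add (a : ℍ[F]), ← pureQ_add (b : ℍ[F]), ha, hb]
  ext <;> simp <;> ring

omit [NeZero (2 : F)] in
lemma conjQ_pow (x : UnitQuat F) (m : ℕ) (a : ℍ[F]) : conjQ (x ^ m) a = (conjQ x)^[m] a := by
  induction m with
  | zero => simp
  | succ k ih => rw [pow_succ', conjQ_mul, ih, Function.iterate_succ_apply']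

omit [NeZero (2 : F)] in
lemma conjQ_of_coe_eq_one_or {x : UnitQuat F} (h : (x : ℍ[F]) = 1 ∨ (x : ℍ[F]) = -1) (a : ℍ[F]) :
    conjQ x a = a := by
  rw [conjQ_eq_self_iff]
  rcases h with h | h <;> rw [h] <;> simp

omit [NeZero (2 : F)] in
lemma conjQ_iterate_smul {x : UnitQuat F} {c : F} {n : ℍ[F]} (h : conjQ x n = c • n) (m : ℕ) :
    (conjQ x)^[m] n = c ^ m • n := by
  induction m with
  | zero => simp
  | succ k ih => rw [Function.iterate_succ_apply', ih, map_smul, h, smul_smul, pow_succ]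

variable [Finite F]

/-- A norm-one quaternion with real part `±1` has order dividing twice the characteristic. -/
lemma pow_two_mul_char_eq_one {p : ℕ} [Fact p.Prime] [CharP F p] {a : UnitQuat F}
    (h : (a : ℍ[F]).re ^ 2 = 1) : a ^ (2 * p) = 1 := by
  have hsq := UnitQuat.sq_eq a
  set r := (a : ℍ[F]).re
  have hc : CharP ℍ[F] p := charP_of_injective_algebraMap' F p
  have h0 : ((a : ℍ[F]) - algebraMap F ℍ[F] r) ^ 2 = 0 := by
    have := UnitQuat.pureQ_mul_self a
    rw [pow_two]
    change pureQ (a : ℍ[F]) * pureQ (a : ℍ[F]) = 0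
    rw [this, show (a : ℍ[F]).re ^ 2 - 1 = (0 : F) by rw [h, sub_self]]
    rfl
  have hp2 : 2 ≤ p := (Fact.out : p.Prime).two_le
  have h1 : ((a : ℍ[F]) - algebraMap F ℍ[F] r) ^ p = 0 := pow_eq_zero_of_le hp2 h0
  rw [sub_pow_char_of_commute p (Algebra.commutes r (a : ℍ[F])).symm, sub_eq_zero] at h1
  apply Subtype.ext
  change (a : ℍ[F]) ^ (2 * p) = 1
  rw [mul_comm, pow_mul, h1, ← pow_mul, mul_comm, pow_mul, ← map_pow, h, map_one, one_pow]

/-- A norm-one quaternion whose order is a power of the characteristic is unipotent. -/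
lemma re_eq_one_of_pow_char_pow {p b : ℕ} [Fact p.Prime] [CharP F p] {a : UnitQuat F}
    (h : a ^ p ^ b = 1) : (a : ℍ[F]).re = 1 := by
  have hc : CharP ℍ[F] p := charP_of_injective_algebraMap' F p
  have h1 : ((a : ℍ[F]) - 1) ^ p ^ b = 0 := by
    rw [sub_pow_char_pow_of_commute p b (Commute.one_right _), one_pow, sub_eq_zero]
    exact congrArg Subtype.val h
  have h2 : normSq ((a : ℍ[F]) - 1) = 0 := by
    have := congrArg (normSq (R := F)) h1
    rw [map_pow, map_zero] at this
    exact pow_eq_zero_iff (pow_ne_zero _ (Fact.out : p.Prime).ne_zero) |>.1 this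
  have hn := mem_unitQuat.1 a.2
  rw [normSq_def'] at h2
  simp at h2
  apply mul_left_cancel₀ (NeZero.ne (2 : F))
  linear_combination hn - h2

omit [NeZero (2 : F)] [Finite F] in
lemma UnitQuat.eq_one_of_coe {a : UnitQuat F} (h : (a : ℍ[F]) = 1) : a = 1 := Subtype.ext h

omit [NeZero (2 : F)] [Finite F] in
lemma sq_eq_one_of_coe {a : UnitQuat F} (h : (a : ℍ[F]) = 1 ∨ (a : ℍ[F]) = -1) : a ^ 2 = 1 := by
  apply Subtype.ext
  change (a : ℍ[F]) ^ 2 = 1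
  rcases h with h | h <;> rw [h] <;> simp

lemma sylow_centralized {R : Subgroup (UnitQuat F)} {m : ℕ} (hm : Odd m)
    (hR : ∀ r ∈ R, ((r ^ m : UnitQuat F) : ℍ[F]) = 1 ∨ ((r ^ m : UnitQuat F) : ℍ[F]) = -1)
    {p l : ℕ} [Fact p.Prime] [Fact l.Prime] [CharP F p] (hl2 : l ≠ 2) (hlp : l ≠ p)
    (P : Sylow l R) (x : R) (hx : ∀ y ∈ P, x * y * x⁻¹ ∈ P) : ∀ y ∈ P, x * y = y * x := by
  by_cases hP : ∀ y ∈ P, y = 1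
  · intro y hy
    rw [hP y hy]; simp
  push Not at hP
  obtain ⟨y0, hy0, hy01⟩ := hP
  have : Nontrivial P := ⟨⟨⟨y0, hy0⟩, 1, fun h => hy01 (congrArg Subtype.val h)⟩⟩
  obtain ⟨c, hc1⟩ := @exists_ne (Subgroup.center P) P.2.center_nontrivial 1
  set d : UnitQuat F := (((c : P) : R) : UnitQuat F) with hd
  have hd1 : d ≠ 1 := fun h => hc1 (Subtype.ext (Subtype.ext (Subtype.ext h)))
  obtain ⟨k, hk⟩ := P.2 (c : P)
  have hdk : d ^ l ^ k = 1 := congrArg (fun z : P => ((z : R) : UnitQuat F)) hk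
  have hre : (d : ℍ[F]).re ^ 2 ≠ 1 := by
    intro h
    have h1 := pow_two_mul_char_eq_one (p := p) h
    apply hd1
    have hl : l.Prime := Fact.out
    have hp : p.Prime := Fact.out
    have hcop : Nat.Coprime (l ^ k) (2 * p) := by
      apply Nat.Coprime.pow_left
      exact Nat.Coprime.mul_right ((Nat.coprime_primes hl Nat.prime_two).2 hl2)
        ((Nat.coprime_primes hl hp).2 hlp)
    have h2 := Nat.dvd_gcd (orderOf_dvd_of_pow_eq_one hdk) (orderOf_dvd_of_pow_eq_one h1)
    rw [hcop, Nat.dvd_one] at h2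
    exact orderOf_eq_one_iff.1 h2
  set n := pureQ (d : ℍ[F])
  have hnn := UnitQuat.pureQ_mul_self d
  have hn0 : n ≠ 0 := by
    intro h
    change n * n = _ at hnn
    rw [h, zero_mul] at hnn
    apply hre
    have := congrArg QuaternionAlgebra.re hnn
    simp [-Quaternion.coe_pow] at this
    linear_combination -this
  have hdcomm : ∀ y ∈ P, d * (y : UnitQuat F) = (y : UnitQuat F) * d := fun y hy =>
    congrArg (fun z : P => ((z : R) : UnitQuat F))
      ((Subgroup.mem_center_iff.1 c.2 ⟨y, hy⟩).symm)
  have hxd : ∃ e : F, conjQ (x : UnitQuat F) n = e • n := by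
    rw [conjQ_pureQ, conjQ_coe]
    have h1 := hx (c : P) (c : P).2
    exact exists_smul_pureQ hn0 (hdcomm _ h1)
  obtain ⟨e, he⟩ := hxd
  have he2 : e ^ 2 = 1 := by
    have h1 := congrArg (normSq (R := F)) he
    have h2 : normSq n ≠ 0 := by
      intro h
      have h3 : n * n = -((normSq n : F) : ℍ[F]) := by
        have : star n = -n := by
          have : n.re = 0 := pureQ_re _
          ext <;> simp [this]
        rw [← Quaternion.self_mul_star, this, mul_neg, neg_neg]
      rw [h] at h3
      change n * n = _ at hnn
      rw [h3] at hnn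
      apply hre
      have := congrArg QuaternionAlgebra.re hnn
      simp [-Quaternion.coe_pow] at this
      linear_combination -this
    rw [conjQ_normSq, normSq_smul] at h1
    exact mul_right_cancel₀ h2 (by rw [one_mul]; exact h1.symm)
  have hem : e ^ m = 1 := by
    have h1 := conjQ_iterate_smul he m
    rw [← conjQ_pow, conjQ_of_coe_eq_one_or (hR x x.2)] at h1
    have h2 : (1 : F) • n = e ^ m • n := by rw [one_smul]; exact h1
    exact (smul_left_injective F hn0 h2).symm
  have he1 : e = 1 := by
    obtain ⟨j, rfl⟩ := hm
    rwa [pow_succ, pow_mul, he2, one_pow, one_mul] at hem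
  rw [he1, one_smul, conjQ_pureQ] at he
  have hxd : x.1 * d = d * x.1 := by
    have h1 : conjQ (x : UnitQuat F) (d : ℍ[F]) = d := by
      rw [← pureQ_add (d : ℍ[F]), map_add, conjQ_pureQ, he]
      congr 1
      exact (conjQ (x : UnitQuat F)).commutes (d : ℍ[F]).re
    exact Subtype.ext ((conjQ_eq_self_iff _ _).1 h1)
  intro y hy
  obtain ⟨e1, h1⟩ := exists_smul_pureQ hn0 hxd.symm
  obtain ⟨e2, h2⟩ := exists_smul_pureQ hn0 (hdcomm y hy)
  exact Subtype.ext (mul_comm_of_pureQ_smul h1 h2)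

lemma re_sq_eq_one_of_mem_commutator {R : Subgroup (UnitQuat F)} {m : ℕ} (hm : Odd m)
    (hR : ∀ r ∈ R, ((r ^ m : UnitQuat F) : ℍ[F]) = 1 ∨ ((r ^ m : UnitQuat F) : ℍ[F]) = -1)
    {a : UnitQuat F} (ha : a ∈ ⁅R, R⁆) : (a : ℍ[F]).re ^ 2 = 1 := by
  obtain ⟨p, hp⟩ := CharP.exists F
  have hpp : p.Prime := CharP.char_is_prime F p
  have : Fact p.Prime := ⟨hpp⟩
  rw [← Subgroup.map_subtype_commutator] at ha
  obtain ⟨a, ha, rfl⟩ := ha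
  have hord : ∀ l : ℕ, l.Prime → l ∣ orderOf a → l = 2 ∨ l = p := by
    intro l hl hla
    by_contra! hne
    have : Fact l.Prime := ⟨hl⟩
    exact not_dvd_orderOf_of_mem_commutator default
      (sylow_centralized hm hR hne.1 hne.2 default) ha hla
  have h2m : (a ^ 2) ^ m = 1 := by
    apply Subtype.ext
    rw [← pow_mul, mul_comm, pow_mul]
    exact sq_eq_one_of_coe (hR a a.2)
  have hord2 : orderOf (a ^ 2) = p ^ (orderOf (a ^ 2)).primeFactorsList.length := by
    apply Nat.eq_prime_pow_of_unique_prime_dvd (orderOf_pos _).ne'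
    intro l hl hla
    refine (hord l hl (hla.trans (orderOf_pow_dvd 2))).resolve_left ?_
    rintro rfl
    have := hla.trans (orderOf_dvd_of_pow_eq_one h2m)
    exact (Nat.not_even_iff_odd.2 hm) (even_iff_two_dvd.2 this)
  have h3 : ((a : UnitQuat F) ^ 2) ^ p ^ (orderOf (a ^ 2)).primeFactorsList.length = 1 := by
    rw [← hord2]
    exact congrArg Subtype.val (pow_orderOf_eq_one (a ^ 2))
  have h4 := re_eq_one_of_pow_char_pow h3
  have h5 := UnitQuat.sq_eq (a : UnitQuat F)
  rw [show (((a : UnitQuat F) ^ 2 : UnitQuat F) : ℍ[F]) =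
    ((a : UnitQuat F) : ℍ[F]) * ((a : UnitQuat F) : ℍ[F]) by rw [pow_two]; rfl, h5] at h4
  simp at h4
  apply mul_left_cancel₀ (NeZero.ne (2 : F))
  simp
  linear_combination h4

/-- A group of norm-one quaternions normalizing a noncentral subgroup of odd exponent modulo
`±1` fixes a line of pure quaternions. -/
lemma exists_fixed_line {N R : Subgroup (UnitQuat F)} (hNR : ∀ x ∈ N, ∀ r ∈ R, x * r * x⁻¹ ∈ R)
    {m : ℕ} (hm : Odd m)
    (hR : ∀ r ∈ R, ((r ^ m : UnitQuat F) : ℍ[F]) = 1 ∨ ((r ^ m : UnitQuat F) : ℍ[F]) = -1)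
    {r : UnitQuat F} (hr : r ∈ R) (hr1 : (r : ℍ[F]) ≠ 1) (hr2 : (r : ℍ[F]) ≠ -1) :
    ∃ n : ℍ[F], n ≠ 0 ∧ n.re = 0 ∧ ∀ x ∈ N, ∃ c : F, conjQ x n = c • n := by
  have h20 := NeZero.ne (2 : F)
  by_cases hA : ∀ a ∈ ⁅R, R⁆, (a : ℍ[F]) = 1 ∨ (a : ℍ[F]) = -1
  · have hcomm : ∀ x ∈ R, ∀ y ∈ R, x * y = y * x := by
      intro x hx y hy
      have h1 := hA _ (Subgroup.commutator_mem_commutator hx hy)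
      rcases h1 with h1 | h1
      · exact commutatorElement_eq_one_iff_mul_comm.1 (UnitQuat.eq_one_of_coe h1)
      exfalso
      have h3 : conjQ x (y : ℍ[F]) = (-1 : F) • (y : ℍ[F]) := by
        rw [conjQ_coe, show x * y * x⁻¹ = (x * y * x⁻¹ * y⁻¹) * y by group]
        change ((x * y * x⁻¹ * y⁻¹ : UnitQuat F) : ℍ[F]) * (y : ℍ[F]) = _
        rw [commutatorElement_def] at h1
        rw [h1]; simp
      have h4 := conjQ_iterate_smul h3 m
      rw [← conjQ_pow, conjQ_of_coe_eq_one_or (hR x hx), hm.neg_one_pow] at h4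
      have hy0 : (y : ℍ[F]) ≠ 0 := fun h => by
        have := UnitQuat.coe_mul_inv y
        rw [h, zero_mul] at this
        exact zero_ne_one this
      have h5 : (1 : F) • (y : ℍ[F]) = (-1 : F) • (y : ℍ[F]) := by rw [one_smul]; exact h4
      have h6 := smul_left_injective F hy0 h5
      apply h20
      linear_combination h6
    have hn0 : pureQ (r : ℍ[F]) ≠ 0 := fun h => (coe_pureQ_eq_zero h).elim hr1 hr2
    refine ⟨pureQ (r : ℍ[F]), hn0, pureQ_re _, fun x hx => ?_⟩
    rw [conjQ_pureQ, conjQ_coe]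
    exact exists_smul_pureQ hn0 (hcomm _ hr _ (hNR x hx r hr))
  · push Not at hA
    obtain ⟨a, ha, ha1, ha2⟩ := hA
    have hu0 : pureQ (a : ℍ[F]) ≠ 0 := fun h => (coe_pureQ_eq_zero h).elim ha1 ha2
    refine ⟨pureQ (a : ℍ[F]), hu0, pureQ_re _, fun x hx => ?_⟩
    have hb : x * a * x⁻¹ ∈ ⁅R, R⁆ := by
      have h1 : (⁅R, R⁆).map (MulAut.conj x).toMonoidHom ≤ ⁅R, R⁆ := by
        rw [Subgroup.map_commutator]
        have : R.map (MulAut.conj x).toMonoidHom ≤ R := by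
          rintro _ ⟨y, hy, rfl⟩
          exact hNR x hx y hy
        exact Subgroup.commutator_mono this this
      exact h1 ⟨a, ha, rfl⟩
    have hunit : ∀ c ∈ ⁅R, R⁆, (c : ℍ[F]).re ^ 2 = 1 := fun c hc =>
      re_sq_eq_one_of_mem_commutator hm hR hc
    have h1 := hunit a ha
    have hre : ((x * a * x⁻¹ : UnitQuat F) : ℍ[F]).re = (a : ℍ[F]).re := by
      rw [← conjQ_coe, conjQ_re]
    rw [conjQ_pureQ, conjQ_coe]
    set b := x * a * x⁻¹
    have h2 := hunit b hb
    have h3 := hunit _ (mul_mem ha hb)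
    have h4 := hunit _ (mul_mem (mul_mem ha hb) hb)
    have hz : ∀ c : UnitQuat F, (c : ℍ[F]).re ^ 2 = 1 → pureQ (c : ℍ[F]) * pureQ (c : ℍ[F]) = 0 := by
      intro c hc
      rw [UnitQuat.pureQ_mul_self, hc, sub_self]; rfl
    refine exists_smul_of_isotropic (pureQ_re _) (pureQ_re _) hu0 (hz a h1) (hz b h2) ?_
    set s := (pureQ (a : ℍ[F]) * pureQ (b : ℍ[F])).re with hs
    have hab : ((a * b : UnitQuat F) : ℍ[F]).re = 1 + s := by
      change ((a : ℍ[F]) * (b : ℍ[F])).re = _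
      rw [hs]
      simp [pureQ]
      rw [hre]
      linear_combination h1
    have habb : ((a * b * b : UnitQuat F) : ℍ[F]).re = (a : ℍ[F]).re * (1 + 2 * s) := by
      have : ((a * b * b : UnitQuat F) : ℍ[F]) = (a : ℍ[F]) * ((b : ℍ[F]) * (b : ℍ[F])) := by
        rw [mul_assoc]; rfl
      rw [this, UnitQuat.sq_eq, hre, mul_sub, mul_smul_comm, mul_one, re_sub, re_smul]
      change 2 * (a : ℍ[F]).re * ((a * b : UnitQuat F) : ℍ[F]).re - _ = _
      rw [hab]; ring
    rw [hab] at h3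
    rw [habb, mul_pow, h1, one_mul] at h4
    have h5 : s * (2 + s) = 0 := by linear_combination h3
    have h6 : (2 * 2) * (s * (1 + s)) = 0 := by linear_combination h4
    rcases mul_eq_zero.1 h6 with h7 | h7
    · exact absurd h7 (mul_ne_zero h20 h20)
    · linear_combination h5 - h7

end Unipotent

section LineLemma

open Quaternion

variable {F : Type*} [Field F]

/-- The subgroup `{1, -1}` of the norm-one quaternions. -/
def signGroup (F : Type*) [Field F] : Subgroup (UnitQuat F) where
  carrier := {u | (u : ℍ[F]) = 1 ∨ (u : ℍ[F]) = -1}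
  one_mem' := Or.inl rfl
  mul_mem' {a b} ha hb := by
    change (a : ℍ[F]) * (b : ℍ[F]) = 1 ∨ (a : ℍ[F]) * (b : ℍ[F]) = -1
    rcases ha with ha | ha <;> rcases hb with hb | hb <;> rw [ha, hb] <;> simp
  inv_mem' {a} ha := by
    change star (a : ℍ[F]) = 1 ∨ star (a : ℍ[F]) = -1
    rcases ha with ha | ha <;> rw [ha] <;> simp

lemma mem_signGroup {u : UnitQuat F} : u ∈ signGroup F ↔ (u : ℍ[F]) = 1 ∨ (u : ℍ[F]) = -1 := Iff.rfl

lemma signGroup_comm {u : UnitQuat F} (hu : u ∈ signGroup F) (v : UnitQuat F) : v * u = u * v := by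
  apply Subtype.ext
  change (v : ℍ[F]) * (u : ℍ[F]) = (u : ℍ[F]) * (v : ℍ[F])
  rcases hu with hu | hu <;> rw [hu] <;> simp

instance : (signGroup F).Normal :=
  ⟨fun u hu v => by rw [signGroup_comm hu, mul_inv_cancel_right]; exact hu⟩

lemma sq_coe_eq_neg_one {a : UnitQuat F} (h : (a : ℍ[F]).re = 0) :
    (a : ℍ[F]) * (a : ℍ[F]) = -1 := by
  rw [UnitQuat.sq_eq, h]; simp

lemma pow_odd_coe {a : UnitQuat F} (h : (a : ℍ[F]).re = 0) {m : ℕ} (hm : Odd m) :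
    ((a ^ m : UnitQuat F) : ℍ[F]) = a ∨ ((a ^ m : UnitQuat F) : ℍ[F]) = -a := by
  obtain ⟨j, rfl⟩ := hm
  change (a : ℍ[F]) ^ (2 * j + 1) = a ∨ (a : ℍ[F]) ^ (2 * j + 1) = -a
  rw [pow_succ, pow_mul, pow_two, sq_coe_eq_neg_one h]
  rcases neg_one_pow_eq_or ℍ[F] j with h | h <;> rw [h] <;> simp

variable [NeZero (2 : F)] [Finite F]

/-- The conjugates under `N` of a pure norm-one quaternion `I`, when a Sylow `2`-subgroup of `N`
containing `I` is centralized modulo `±1` by its normalizer in `N`: none of them is orthogonal to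
`I`, and they are contained in a common plane or line. -/
lemma IsMaxTwo.conjQ_constraint {N P : Subgroup (UnitQuat F)} (hP : IsMaxTwo P N)
    (h : ∀ x ∈ N, (∀ p ∈ P, x * p * x⁻¹ ∈ P) → ∀ p ∈ P, x * p * x⁻¹ * p⁻¹ ∈ signGroup F)
    {I : UnitQuat F} (hI : I ∈ P) (hre : (I : ℍ[F]).re = 0) :
    (∀ x ∈ N, (conjQ x (I : ℍ[F]) * (I : ℍ[F])).re ≠ 0) ∧
    ∃ n : ℍ[F], n ≠ 0 ∧ n.re = 0 ∧ ((∀ x ∈ N, (conjQ x (I : ℍ[F]) * n).re = 0) ∨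
      ∀ x ∈ N, ∃ c : F, conjQ x (I : ℍ[F]) = c • n) := by
  have h20 := NeZero.ne (2 : F)
  have hII := sq_coe_eq_neg_one hre
  have hI0 : (I : ℍ[F]) ≠ 0 := fun h0 => by
    rw [h0, zero_mul] at hII
    simp at hII
  have hsign : signGroup F ≤ P := by
    rintro u (hu | hu)
    · rw [UnitQuat.eq_one_of_coe hu]; exact one_mem _
    · have : u = I * I := Subtype.ext (by rw [hu]; exact hII.symm)
      rw [this]; exact mul_mem hI hI
  obtain ⟨R, hRn, ⟨m, hm, hRm⟩, hRc⟩ := exists_normal_of_normalizer_le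
    (Z := (signGroup F).subgroupOf N) hP.subgroupOf
    (fun x hx => hsign hx) (by
      intro x hx p hp
      refine h x x.2 (fun y hy => ?_) p hp
      exact hx ⟨y, hP.le hy⟩ hy)
  have hN' : ∀ x ∈ N, ∀ r ∈ R.map N.subtype, x * r * x⁻¹ ∈ R.map N.subtype := by
    rintro x hx _ ⟨r, hr, rfl⟩
    exact Subgroup.mem_map_of_mem N.subtype (hRn.conj_mem r hr ⟨x, hx⟩)
  have hR' : ∀ r ∈ R.map N.subtype,
      ((r ^ m : UnitQuat F) : ℍ[F]) = 1 ∨ ((r ^ m : UnitQuat F) : ℍ[F]) = -1 := by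
    rintro _ ⟨r, hr, rfl⟩
    exact hRm r hr
  have hc : ∀ x ∈ N, x * I * x⁻¹ * I⁻¹ ∈ R.map N.subtype := fun x hx =>
    Subgroup.mem_map_of_mem N.subtype (hRc ⟨x, hx⟩ ⟨I, hP.le hI⟩)
  have hIinv : ((I⁻¹ : UnitQuat F) : ℍ[F]) = -(I : ℍ[F]) := by
    change star (I : ℍ[F]) = _
    ext <;> simp [hre]
  have hcoe : ∀ x, ((x * I * x⁻¹ * I⁻¹ : UnitQuat F) : ℍ[F]) = -(conjQ x (I : ℍ[F]) * (I : ℍ[F])) := by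
    intro x
    rw [← mul_neg, ← hIinv]; rfl
  refine ⟨fun x hx h0 => ?_, ?_⟩
  · have hr0 : ((x * I * x⁻¹ * I⁻¹ : UnitQuat F) : ℍ[F]).re = 0 := by
      rw [hcoe, re_neg, h0, neg_zero]
    have h1 := hR' _ (hc x hx)
    have h2 := pow_odd_coe hr0 hm
    have h3 : ((x * I * x⁻¹ * I⁻¹ : UnitQuat F) : ℍ[F]) = 1 ∨
        ((x * I * x⁻¹ * I⁻¹ : UnitQuat F) : ℍ[F]) = -1 := by
      rcases h1 with h1 | h1 <;> rcases h2 with h2 | h2 <;> rw [h1] at h2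
      · exact Or.inl h2.symm
      · exact Or.inr (by rw [h2, neg_neg])
      · exact Or.inr h2.symm
      · exact Or.inl (by rw [← neg_inj, ← h2])
    rcases h3 with h3 | h3 <;> rw [h3] at hr0 <;> simp at hr0
  · by_cases hR : ∀ r ∈ R.map N.subtype, (r : ℍ[F]) = 1 ∨ (r : ℍ[F]) = -1
    · refine ⟨I, hI0, hre, Or.inr fun x hx => ?_⟩
      have h1 : conjQ x (I : ℍ[F]) = ((x * I * x⁻¹ * I⁻¹ : UnitQuat F) : ℍ[F]) * (I : ℍ[F]) := by
        rw [hcoe, neg_mul, mul_assoc, hII]; simp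
      rw [h1]
      rcases hR _ (hc x hx) with h2 | h2
      · exact ⟨1, by rw [h2]; simp⟩
      · exact ⟨-1, by rw [h2]; simp⟩
    · push Not at hR
      obtain ⟨r, hr, hr1, hr2⟩ := hR
      obtain ⟨n, hn0, hnre, hn⟩ := exists_fixed_line hN' hm hR' hr hr1 hr2
      refine ⟨n, hn0, hnre, ?_⟩
      obtain ⟨c, hcI⟩ := hn I (hP.le hI)
      have hc2 : c ^ 2 = 1 := by
        have h1 := conjQ_iterate_smul hcI 2
        rw [← conjQ_pow, conjQ_of_coe_eq_one_or (Or.inr (by rw [pow_two]; exact hII))] at h1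
        have h2 : (1 : F) • n = c ^ 2 • n := by rw [one_smul]; exact h1
        exact (smul_left_injective F hn0 h2).symm
      rcases (sq_eq_one_iff.1 hc2) with rfl | rfl
      · right
        rw [one_smul, conjQ_eq_self_iff] at hcI
        obtain ⟨d, hd⟩ := exists_smul_of_comm hnre hre hn0 hcI.symm
        intro x hx
        obtain ⟨e, he⟩ := hn x hx
        exact ⟨d * e, by rw [hd, map_smul, he, smul_smul]⟩
      · left
        have h1 : (I : ℍ[F]) * n = -(n * (I : ℍ[F])) := by
          have h2 : conjQ I n * (I : ℍ[F]) = (I : ℍ[F]) * n := by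
            rw [conjQ_apply, mul_assoc]
            change _ * (((I⁻¹ : UnitQuat F) : ℍ[F]) * (I : ℍ[F])) = _
            rw [UnitQuat.coe_inv_mul, mul_one]
          rw [← h2, hcI]; simp
        have h2 : ((I : ℍ[F]) * n).re = 0 := by
          have h3 := congrArg QuaternionAlgebra.re h1
          simp [hre, hnre] at h3 ⊢
          apply mul_left_cancel₀ h20
          linear_combination h3
        intro x hx
        obtain ⟨e, he⟩ := hn x hx
        have he0 : e ≠ 0 := by
          rintro rfl
          rw [zero_smul] at he
          exact hn0 (conjQ_injective x (by rw [he, map_zero]))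
        have h3 : (conjQ x ((I : ℍ[F]) * n)).re = 0 := by rw [conjQ_re, h2]
        rw [map_mul, he, mul_smul_comm, re_smul] at h3
        exact (mul_eq_zero.1 h3).resolve_left he0

end LineLemma

section QuatGroupRigid

open Quaternion

variable {F : Type*} [Field F]

/-- The unit `i` as an element of the norm one group. -/
def unitI (F : Type*) [Field F] : UnitQuat F := ⟨qi, isQ8_qi.mem_unitQuat⟩

@[simp] lemma coe_unitI : (unitI F : ℍ[F]) = qi := rfl

lemma unitI_mem : unitI F ∈ quatGroup F := isQ8_qi

lemma unitJ_mem : unitJ F ∈ quatGroup F := isQ8_qj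

lemma conjQ_unitJ (a : ℍ[F]) : conjQ (unitJ F) a = qmk a.re (-a.imI) a.imJ (-a.imK) := by
  rw [conjQ_apply]; ext <;> simp

lemma mem_quatGroup_mul_inv_mem_signGroup {x p : UnitQuat F} (hx : x ∈ quatGroup F)
    (hp : p ∈ quatGroup F) : x * p * x⁻¹ * p⁻¹ ∈ signGroup F := by
  rcases IsQ8.comm hx hp with h | h
  · have : x * p = p * x := Subtype.ext h
    rw [this, mul_inv_cancel_right, mul_inv_cancel]; exact one_mem _
  · right
    have h2 : ((x * p * x⁻¹ * p⁻¹ : UnitQuat F) : ℍ[F]) =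
      ((x : ℍ[F]) * (p : ℍ[F])) * ((x⁻¹ * p⁻¹ : UnitQuat F) : ℍ[F]) := by rw [mul_assoc (x * p)]; rfl
    rw [h2, h, neg_mul]
    congr 1
    change ((p * x * (x⁻¹ * p⁻¹) : UnitQuat F) : ℍ[F]) = 1
    rw [show p * x * (x⁻¹ * p⁻¹) = 1 by group]; rfl

lemma conjQ_pure (p q : ℍ[F]) {y : UnitQuat F} (hy : (y : ℍ[F]) = q) (hp : p.re = 0) (hq : q.re = 0) :
    conjQ y p = (2 * (p.imI * q.imI + p.imJ * q.imJ + p.imK * q.imK)) • q - p := by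
  have hn := mem_unitQuat.1 y.2
  rw [hy, hq] at hn
  rw [conjQ_apply, hy]
  ext <;> simp [hp, hq]
  · ring
  · linear_combination -p.imI * hn
  · linear_combination -p.imJ * hn
  · linear_combination -p.imK * hn

variable [NeZero (2 : F)]

lemma conjQ_omega (a : ℍ[F]) : conjQ (omega F) a = qmk a.re a.imK a.imI a.imJ := by
  have h2 := NeZero.ne (2 : F)
  rw [conjQ_apply]
  ext <;> simp <;> field_simp <;> ring

lemma conjQ_omega_inv (a : ℍ[F]) : conjQ (omega F)⁻¹ a = qmk a.re a.imJ a.imK a.imI := by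
  have h : a = conjQ (omega F) (qmk a.re a.imJ a.imK a.imI) := by
    rw [conjQ_omega]; ext <;> simp
  conv_lhs => rw [h, conjQ_inv_conjQ]

lemma wpow_mem_of_ne_zero {N : Subgroup (UnitQuat F)} {e : ZMod 3} (he : e ≠ 0)
    (h : wpow e ∈ N) : omega F ∈ N := by
  have h1 : ∀ e : ZMod 3, e ≠ 0 → e = 1 ∨ e = -1 := by decide
  rcases h1 e he with rfl | rfl
  · rwa [wpow_one] at h
  · rw [wpow_neg, inv_mem_iff, wpow_one] at h; exact h

lemma conjQ_wpow_of_ne_zero {e : ZMod 3} (he : e ≠ 0) (a : ℍ[F]) :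
    conjQ (wpow e) a = qmk a.re a.imK a.imI a.imJ ∨
    conjQ (wpow e) a = qmk a.re a.imJ a.imK a.imI := by
  have h1 : ∀ e : ZMod 3, e ≠ 0 → e = 1 ∨ e = -1 := by decide
  rcases h1 e he with rfl | rfl
  · rw [wpow_one, conjQ_omega]; exact Or.inl rfl
  · rw [wpow_neg, wpow_one, conjQ_omega_inv]; exact Or.inr rfl

variable [Finite F]

lemma mem_quatGroup_of_normalizing (hns : ¬ IsSquare (2 : F)) {N : Subgroup (UnitQuat F)}
    (hQN : quatGroup F ≤ N) (hω : omega F ∉ N) {x : UnitQuat F} (hx : x ∈ N)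
    (h : ∀ p ∈ quatGroup F, x * p * x⁻¹ ∈ quatGroup F) : x ∈ quatGroup F := by
  obtain ⟨e, he⟩ := exists_wpow_mul_mem hns h
  have h1 : wpow e ∈ N := by
    have := mul_mem (hQN he) (inv_mem hx)
    rwa [mul_inv_cancel_right] at this
  by_cases h0 : e = 0
  · rwa [h0, wpow_zero, one_mul] at he
  · exact absurd (wpow_mem_of_ne_zero h0 h1) hω

lemma conj_unitI_mem (hns : ¬ IsSquare (2 : F)) {M N : Subgroup (UnitQuat F)}
    (hQM : quatGroup F ≤ M) (hMN : M ≤ N) (hω : omega F ∉ N) {e : ZMod 3} (he : e ≠ 0)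
    (hM : ∀ x ∈ M, wpow e * x * (wpow e)⁻¹ ∈ N) {x : UnitQuat F} (hx : x ∈ M) :
    x * unitI F * x⁻¹ ∈ quatGroup F := by
  have h20 := NeZero.ne (2 : F)
  have hQN := hQM.trans hMN
  obtain ⟨ha, n, hn0, hnre, hb⟩ := ((isMaxTwo_quatGroup hns).mono hQN le_top).conjQ_constraint
    (fun x hx h p hp => mem_quatGroup_mul_inv_mem_signGroup
      (mem_quatGroup_of_normalizing hns hQN hω hx h) hp) (I := unitI F) unitI_mem rfl
  simp only [coe_unitI] at ha hb
  have hp : ((x * unitI F * x⁻¹ : UnitQuat F) : ℍ[F]) = conjQ x qi := rfl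
  set P := x * unitI F * x⁻¹ with hP
  have hPM : P ∈ M := mul_mem (mul_mem hx (hQM unitI_mem)) (inv_mem hx)
  have hxN := hMN hx
  set p : ℍ[F] := conjQ x qi with hpdef
  have hpre : p.re = 0 := by rw [hpdef, conjQ_re]; rfl
  have hpn := mem_unitQuat.1 P.2
  rw [hp, hpre] at hpn
  have hα : p.imI ≠ 0 := by
    intro h0
    apply ha x hxN
    change (p * qi).re = 0
    simp [h0]
  have hnotpar : ¬ (p.imJ = 0 ∧ p.imK = 0) ∨ P ∈ quatGroup F := by
    by_cases h : p.imJ = 0 ∧ p.imK = 0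
    · right
      have h1 : p.imI ^ 2 = 1 := by rw [h.1, h.2] at hpn; linear_combination hpn
      rw [mem_quatGroup, hp]
      rcases sq_eq_one_iff.1 h1 with h1 | h1
      · have : p = qi := by ext <;> simp [hpre, h.1, h.2, h1]
        rw [this]; exact isQ8_qi
      · have : p = -qi := by ext <;> simp [hpre, h.1, h.2, h1]
        rw [this]; exact isQ8_qi.neg
    · exact Or.inl h
  rcases hnotpar with hnp | hnp
  swap
  · exact hnp
  exfalso
  rcases hb with hb | hb
  · have hn1 : n.imI = 0 := by
      have := hb 1 (one_mem _)
      simp at this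
      exact this
    have hn1' : p.imJ * n.imJ + p.imK * n.imK = 0 := by
      have := hb x hxN
      change (p * n).re = 0 at this
      simp [hpre, hn1] at this
      linear_combination -this
    have hn2' : p.imJ * n.imJ - p.imK * n.imK = 0 := by
      have := hb (unitJ F * x) (mul_mem (hQN unitJ_mem) hxN)
      rw [conjQ_mul] at this
      change (conjQ (unitJ F) p * n).re = 0 at this
      rw [conjQ_unitJ] at this
      simp [hpre, hn1] at this
      linear_combination -this
    have hJ : p.imJ * n.imJ = 0 := by
      apply mul_left_cancel₀ h20; linear_combination hn1' + hn2'
    have hK : p.imK * n.imK = 0 := by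
      apply mul_left_cancel₀ h20; linear_combination hn1' - hn2'
    have hp' : ((wpow e * P * (wpow e)⁻¹ : UnitQuat F) : ℍ[F]) = conjQ (wpow e) p := by
      rw [← conjQ_coe, hp]
    have h4 := hb (wpow e * P * (wpow e)⁻¹ * x) (mul_mem (hM _ hPM) hxN)
    rw [conjQ_mul] at h4
    change (conjQ _ p * n).re = 0 at h4
    rw [conjQ_pure p _ hp' hpre (by rw [conjQ_re, hpre])] at h4
    have hnn : n.imJ ≠ 0 ∨ n.imK ≠ 0 := by
      by_contra! h
      exact hn0 (by ext <;> simp [hnre, hn1, h.1, h.2])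
    have hcases : (p.imJ = 0 ∧ n.imK = 0 ∧ p.imK ≠ 0 ∧ n.imJ ≠ 0) ∨
        (p.imK = 0 ∧ n.imJ = 0 ∧ p.imJ ≠ 0 ∧ n.imK ≠ 0) := by
      clear hb ha h4 hp' hM
      clear_value p P
      rcases mul_eq_zero.1 hJ with h1 | h1 <;> rcases mul_eq_zero.1 hK with h2 | h2
      · exact absurd ⟨h1, h2⟩ hnp
      · exact Or.inl ⟨h1, h2, fun h => hnp ⟨h1, h⟩, hnn.resolve_right (not_not.2 h2)⟩
      · exact Or.inr ⟨h2, h1, fun h => hnp ⟨h, h2⟩, hnn.resolve_left (not_not.2 h1)⟩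
      · exact absurd hnn (by simp [h1, h2])
    rcases conjQ_wpow_of_ne_zero he p with hw | hw <;> rw [hw] at h4 <;>
    rcases hcases with ⟨h1, h2, h3, h5⟩ | ⟨h1, h2, h3, h5⟩ <;>
    simp [h1, h2, hn1, hpre, h3, h5, hα, h20] at h4
  · obtain ⟨c, hc⟩ := hb 1 (one_mem _)
    obtain ⟨d, hd⟩ := hb x hxN
    change p = d • n at hd
    rw [conjQ_one] at hc
    have hc0 : c ≠ 0 := by
      rintro rfl
      have := congrArg QuaternionAlgebra.imI hc
      simp at this
    have c2 := congrArg QuaternionAlgebra.imJ hc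
    have c3 := congrArg QuaternionAlgebra.imK hc
    simp [hc0] at c2 c3
    apply hnp
    rw [hd]
    simp [c2, c3]

lemma exists_wpow_conj_eq_unitI {a : UnitQuat F} (ha : a ∈ quatGroup F) (hre : (a : ℍ[F]).re = 0) :
    ∃ f : ZMod 3, (conjQ (wpow f) (a : ℍ[F]) = qi ∨ conjQ (wpow f) (a : ℍ[F]) = -qi) := by
  have h2 : conjQ (wpow (F := F) 1) qk = qi := by
    rw [wpow_one, conjQ_omega]; ext <;> simp
  have h3 : conjQ (wpow (F := F) (-1)) qj = qi := by
    rw [wpow_neg, wpow_one, conjQ_omega_inv]; ext <;> simp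
  rcases ha with h | h | h | h | h | h | h | h <;> rw [h] at hre ⊢
  · simp at hre
  · simp at hre
  · exact ⟨0, by simp⟩
  · exact ⟨0, by simp⟩
  · exact ⟨-1, by simp only [h3, true_or]⟩
  · exact ⟨-1, by simp only [map_neg, h3, or_true]⟩
  · exact ⟨1, by simp only [h2, true_or]⟩
  · exact ⟨1, by simp only [map_neg, h2, or_true]⟩

/-- Rigidity of the quaternion group: if `Q ≤ M ≤ N`, `ω ∉ N` but `N` contains the conjugate of
`M` by a nontrivial power of `ω`, then `M = Q`. -/
lemma le_quatGroup_of_wpow_conj (hns : ¬ IsSquare (2 : F)) {M N : Subgroup (UnitQuat F)}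
    (hQM : quatGroup F ≤ M) (hMN : M ≤ N) (hω : omega F ∉ N) {e : ZMod 3} (he : e ≠ 0)
    (hM : ∀ x ∈ M, wpow e * x * (wpow e)⁻¹ ∈ N) : M ≤ quatGroup F := by
  have key : ∀ a ∈ quatGroup F, (a : ℍ[F]).re = 0 → ∀ x ∈ M, x * a * x⁻¹ ∈ quatGroup F := by
    intro a ha hre x hx
    obtain ⟨f, hf⟩ := exists_wpow_conj_eq_unitI ha hre
    have hcomm : wpow (F := F) e * wpow f = wpow f * wpow e := by
      rw [← wpow_add, ← wpow_add, add_comm]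
    have hQ' : ∀ K : Subgroup (UnitQuat F), quatGroup F ≤ K →
        quatGroup F ≤ K.map (MulAut.conj (wpow f)).toMonoidHom := fun K hK q hq =>
      ⟨(wpow f)⁻¹ * q * wpow f, hK (wpow_conj_mem' f hq), by simp; group⟩
    have h1 := conj_unitI_mem hns (M := M.map (MulAut.conj (wpow f)).toMonoidHom)
      (N := N.map (MulAut.conj (wpow f)).toMonoidHom) (hQ' M hQM) (Subgroup.map_mono hMN)
      (by
        rintro ⟨y, hy, h⟩
        simp at h
        apply hω
        have h2 : y = (wpow f)⁻¹ * omega F * wpow f := by rw [← h]; group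
        have h3 : (wpow (F := F) f)⁻¹ * omega F * wpow f = omega F := by
          rw [← wpow_one, ← wpow_neg, ← wpow_add, ← wpow_add]
          congr 1; ring
        rw [h3] at h2
        rwa [← h2]) he
      (by
        rintro _ ⟨y, hy, rfl⟩
        refine ⟨_, hM y hy, ?_⟩
        simp only [MulEquiv.toMonoidHom_eq_coe, MonoidHom.coe_coe, MulAut.conj_apply]
        rw [show wpow f * (wpow e * y * (wpow e)⁻¹) * (wpow f)⁻¹ =
          (wpow f * wpow e) * y * (wpow f * wpow (F := F) e)⁻¹ by group, ← hcomm]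
        group)
      (x := wpow f * x * (wpow f)⁻¹) ⟨x, hx, rfl⟩
    have h2 : wpow f * a * (wpow f)⁻¹ = unitI F ∨ wpow f * a * (wpow f)⁻¹ = unitI F * (unitI F * unitI F) := by
      rcases hf with hf | hf
      · left; exact Subtype.ext hf
      · right
        apply Subtype.ext
        rw [← conjQ_coe, hf]
        change _ = (qi : ℍ[F]) * (qi * qi)
        rw [qi_mul_qi]; simp
    have h3 : wpow f * (x * a * x⁻¹) * (wpow f)⁻¹ = (wpow f * x * (wpow f)⁻¹) *
        (wpow f * a * (wpow f)⁻¹) * (wpow f * x * (wpow f)⁻¹)⁻¹ := by group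
    have h4 : wpow f * (x * a * x⁻¹) * (wpow f)⁻¹ ∈ quatGroup F := by
      rw [h3]
      rcases h2 with h2 | h2 <;> rw [h2]
      · exact h1
      · have := mul_mem h1 (mul_mem h1 h1)
        convert this using 1
        group
    have h5 := wpow_conj_mem' f h4
    convert h5 using 1
    group
  intro x hx
  refine mem_quatGroup_of_normalizing hns (hQM.trans hMN) hω (hMN hx) fun p hp => ?_
  by_cases hre : (p : ℍ[F]).re = 0
  · exact key p hp hre x hx
  · have : p ∈ signGroup F := by
      rw [mem_signGroup]
      rcases hp with h | h | h | h | h | h | h | h <;> simp [h] at hre ⊢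
    rw [signGroup_comm this x, mul_inv_cancel_right]
    exact hp

end QuatGroupRigid

section Unitary

open Quaternion Matrix

variable {F : Type*} [Field F] {ι κ : Type*} [Fintype ι] [DecidableEq ι] [Fintype κ] [DecidableEq κ]

/-- The group of unitary matrices over the (split) quaternion algebra `ℍ[F]`. -/
abbrev UnitMat (ι F : Type*) [Fintype ι] [DecidableEq ι] [Field F] := unitary (Matrix ι ι ℍ[F])

lemma UnitMat.coe_inv_mul (k : UnitMat ι F) :
    k.1ᴴ * k.1 = 1 := (Unitary.mem_iff.1 k.2).1

lemma UnitMat.coe_mul_inv (k : UnitMat ι F) :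
    k.1 * k.1ᴴ = 1 := (Unitary.mem_iff.1 k.2).2

/-- A matrix with orthonormal columns embeds the smaller unitary group into the larger one. -/
def emb (M : Matrix ι κ ℍ[F]) (hM : Mᴴ * M = 1) : UnitMat κ F →* UnitMat ι F :=
  have key : ∀ X Y : Matrix κ κ ℍ[F], (1 + M * X * Mᴴ) * (1 + M * Y * Mᴴ) =
      1 + M * (X + Y + X * Y) * Mᴴ := by
    intro X Y
    have : M * X * Mᴴ * (M * Y * Mᴴ) = M * X * (Mᴴ * M) * Y * Mᴴ := by
      simp only [Matrix.mul_assoc]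
    rw [mul_add, mul_one, add_mul, one_mul, this, hM, Matrix.mul_one, Matrix.mul_add,
      Matrix.mul_add, Matrix.add_mul, Matrix.add_mul, Matrix.mul_assoc M X Y]
    abel
  have hst : ∀ A : UnitMat κ F, star (1 + M * (A.1 - 1) * Mᴴ) =
      1 + M * (star A.1 - 1) * Mᴴ := by
    intro A
    simp [star_eq_conjTranspose, conjTranspose_mul, conjTranspose_add, Matrix.mul_assoc]
  { toFun := fun A => ⟨1 + M * (A.1 - 1) * Mᴴ, by
      rw [Unitary.mem_iff, hst, key, key]
      have h1 := (Unitary.mem_iff.1 A.2).1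
      have h2 := (Unitary.mem_iff.1 A.2).2
      constructor
      · rw [show star A.1 - 1 + (A.1 - 1) +
          (star A.1 - 1) * (A.1 - 1) = 0 by
            rw [sub_mul, mul_sub, h1]; simp]
        simp
      · rw [show (A.1 - 1) + (star A.1 - 1) +
          (A.1 - 1) * (star A.1 - 1) = 0 by
            rw [sub_mul, mul_sub, h2]; simp]
        simp⟩
    map_one' := by
      apply Subtype.ext
      simp
    map_mul' := fun A B => by
      apply Subtype.ext
      change _ = (1 + M * (A.1 - 1) * Mᴴ) * (1 + M * (B.1 - 1) * Mᴴ)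
      refine Eq.trans ?_ (key _ _).symm
      change 1 + M * ((A * B).1 - 1) * Mᴴ = _
      congr 3
      change A.1 * B.1 - 1 = _
      rw [sub_mul, mul_sub]
      simp }

/-- Norm-one quaternions as unitary matrices of size one. -/
def unitScalar (F : Type*) [Field F] : UnitQuat F →* UnitMat Unit F where
  toFun a := ⟨Matrix.of fun _ _ => (a : ℍ[F]), by
    have h := Unitary.mem_iff.1 a.2
    rw [Unitary.mem_iff]
    constructor <;> ext1 x y <;> rw [Matrix.mul_apply] <;> simp [star_eq_conjTranspose, h.1, h.2]⟩
  map_one' := by apply Subtype.ext; ext1 x y; simp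
  map_mul' a b := by
    apply Subtype.ext
    ext1 x y
    change _ = ((Matrix.of fun _ _ => (a : ℍ[F])) * (Matrix.of fun _ _ => (b : ℍ[F])) : Matrix Unit Unit ℍ[F]) x y
    rw [Matrix.mul_apply]; simp

/-- Column vectors of norm one. -/
structure UnitVec (ι F : Type*) [Fintype ι] [Field F] where
  /-- the underlying column -/
  val : ι → ℍ[F]
  star_dotProduct_self : star val ⬝ᵥ val = 1

instance : CoeFun (UnitVec ι F) (fun _ => ι → ℍ[F]) := ⟨UnitVec.val⟩

@[ext] lemma UnitVec.ext {v w : UnitVec ι F} (h : ∀ p, v p = w p) : v = w := by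
  cases v; cases w
  congr 1
  exact funext h

instance : MulAction (UnitMat ι F) (UnitVec ι F) where
  smul k w := ⟨k.1 *ᵥ w, by
    rw [star_mulVec, ← dotProduct_mulVec, mulVec_mulVec, UnitMat.coe_inv_mul, one_mulVec, w.2]⟩
  one_smul w := UnitVec.ext (congrFun (one_mulVec w.1))
  mul_smul k l w := UnitVec.ext (congrFun (mulVec_mulVec w.1 _ _).symm)

lemma UnitVec.coe_smul (k : UnitMat ι F) (w : UnitVec ι F) :
    ((k • w : UnitVec ι F) : ι → ℍ[F]) = k.1 *ᵥ w := rfl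

/-- Right multiplication of a vector by a norm-one quaternion. -/
def UnitVec.rsmul (w : UnitVec ι F) (u : UnitQuat F) : UnitVec ι F :=
  ⟨fun p => w p * (u : ℍ[F]), by
    have h1 := w.2
    have h2 : star (u : ℍ[F]) * (u : ℍ[F]) = 1 := (Unitary.mem_iff.1 u.2).1
    simp only [dotProduct, Pi.star_apply, star_mul] at h1 ⊢
    calc ∑ x, star (u : ℍ[F]) * star (w x) * (w x * (u : ℍ[F]))
        = star (u : ℍ[F]) * (∑ x, star (w x) * w x) * (u : ℍ[F]) := by
          rw [Finset.mul_sum, Finset.sum_mul]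
          simp only [mul_assoc]
      _ = 1 := by rw [h1, mul_one, h2]⟩

lemma UnitVec.rsmul_apply (w : UnitVec ι F) (u : UnitQuat F) (p : ι) :
    w.rsmul u p = w p * (u : ℍ[F]) := rfl

lemma UnitVec.smul_rsmul (k : UnitMat ι F) (w : UnitVec ι F) (u : UnitQuat F) :
    k • w.rsmul u = (k • w).rsmul u := by
  ext1 p
  rw [rsmul_apply, coe_smul, coe_smul]
  simp only [mulVec, dotProduct, rsmul_apply, Finset.sum_mul, mul_assoc]

lemma UnitVec.rsmul_rsmul (w : UnitVec ι F) (u v : UnitQuat F) :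
    (w.rsmul u).rsmul v = w.rsmul (u * v) := by
  ext1 p
  simp only [rsmul_apply, mul_assoc]; rfl

@[simp] lemma UnitVec.rsmul_one (w : UnitVec ι F) : w.rsmul 1 = w := by
  ext1 p
  simp [rsmul_apply]

lemma UnitVec.col_unitary (w : UnitVec ι F) :
    (replicateCol Unit (w : ι → ℍ[F]))ᴴ * replicateCol Unit (w : ι → ℍ[F]) = 1 := by
  ext1 x y
  rw [Matrix.mul_apply]
  have := w.2
  simp only [dotProduct, Pi.star_apply] at this
  simp [this]

/-- The embedding of the norm-one quaternions along a unit vector. -/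
def rootHom (w : UnitVec ι F) : UnitQuat F →* UnitMat ι F :=
  (emb (replicateCol Unit (w : ι → ℍ[F])) w.col_unitary).comp (unitScalar F)

lemma rootHom_apply (w : UnitVec ι F) (a : UnitQuat F) (p q : ι) :
    (rootHom w a).1 p q = (1 : Matrix ι ι ℍ[F]) p q +
      w p * ((a : ℍ[F]) - 1) * star (w q) := by
  change ((1 + replicateCol Unit (w : ι → ℍ[F]) *
    ((Matrix.of fun _ _ => (a : ℍ[F]) : Matrix Unit Unit ℍ[F]) - 1) *
      (replicateCol Unit (w : ι → ℍ[F]))ᴴ : Matrix ι ι ℍ[F])) p q = _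
  rw [Matrix.add_apply, Matrix.mul_apply]
  simp [Matrix.mul_apply]

lemma rootHom_smul_apply (w : UnitVec ι F) (a : UnitQuat F) (v : UnitVec ι F) (p : ι) :
    (rootHom w a • v) p = v p + w p * ((a : ℍ[F]) - 1) * (star (w : ι → ℍ[F]) ⬝ᵥ v) := by
  rw [UnitVec.coe_smul]
  simp only [mulVec, dotProduct, rootHom_apply, add_mul, Finset.sum_add_distrib, Matrix.one_apply,
    ite_mul, one_mul, zero_mul, Finset.sum_ite_eq, Finset.mem_univ, if_true, Finset.mul_sum,
    Pi.star_apply, mul_assoc]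

lemma conj_rootHom (k : UnitMat ι F) (w : UnitVec ι F) (a : UnitQuat F) :
    k * rootHom w a * k⁻¹ = rootHom (k • w) a := by
  apply Subtype.ext
  have h : replicateCol Unit ((k • w : UnitVec ι F) : ι → ℍ[F]) =
      k.1 * replicateCol Unit (w : ι → ℍ[F]) := by
    rw [UnitVec.coe_smul, replicateCol_mulVec]
  change k.1 * (1 + _ * _ * _) * k.1ᴴ =
    1 + replicateCol Unit ((k • w : UnitVec ι F) : ι → ℍ[F]) * _ *
      (replicateCol Unit ((k • w : UnitVec ι F) : ι → ℍ[F]))ᴴ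
  rw [h, mul_add, mul_one, add_mul, UnitMat.coe_mul_inv, conjTranspose_mul]
  simp only [Matrix.mul_assoc]

lemma rootHom_rsmul (w : UnitVec ι F) (u a : UnitQuat F) :
    rootHom (w.rsmul u) a = rootHom w (u * a * u⁻¹) := by
  apply Subtype.ext
  ext1 p q
  rw [rootHom_apply, rootHom_apply]
  congr 1
  simp only [UnitVec.rsmul_apply, star_mul]
  have : ((u * a * u⁻¹ : UnitQuat F) : ℍ[F]) - 1 = (u : ℍ[F]) * ((a : ℍ[F]) - 1) * star (u : ℍ[F]) := by
    rw [mul_sub, sub_mul, mul_one]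
    have h2 : (u : ℍ[F]) * star (u : ℍ[F]) = 1 := (Unitary.mem_iff.1 u.2).2
    rw [h2]; rfl
  rw [this]
  simp only [mul_assoc]

/-- The image of a unit vector under a matrix with orthonormal columns. -/
def UnitVec.embVec (M : Matrix ι κ ℍ[F]) (hM : Mᴴ * M = 1) (w : UnitVec κ F) : UnitVec ι F :=
  ⟨M *ᵥ w, by rw [star_mulVec, ← dotProduct_mulVec, mulVec_mulVec, hM, one_mulVec, w.2]⟩

lemma emb_rootHom (M : Matrix ι κ ℍ[F]) (hM : Mᴴ * M = 1) (w : UnitVec κ F) (a : UnitQuat F) :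
    emb M hM (rootHom w a) = rootHom (w.embVec M hM) a := by
  apply Subtype.ext
  have h : replicateCol Unit ((w.embVec M hM : UnitVec ι F) : ι → ℍ[F]) =
      M * replicateCol Unit (w : κ → ℍ[F]) := by
    change replicateCol Unit (M *ᵥ (w : κ → ℍ[F])) = _
    rw [replicateCol_mulVec]
  change 1 + M * (1 + _ * _ * _ - 1) * Mᴴ =
    1 + replicateCol Unit ((w.embVec M hM : UnitVec ι F) : ι → ℍ[F]) * _ *
      (replicateCol Unit ((w.embVec M hM : UnitVec ι F) : ι → ℍ[F]))ᴴ
  rw [h, conjTranspose_mul, add_sub_cancel_left]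
  simp only [Matrix.mul_assoc]

/-- The standard basis vectors. -/
def stdVec (F : Type*) [Field F] (l : ι) : UnitVec ι F :=
  ⟨Pi.single l 1, by simp⟩

lemma stdVec_apply (l p : ι) : stdVec F l p = if p = l then 1 else 0 := Pi.single_apply _ _ _

lemma smul_stdVec_apply (k : UnitMat ι F) (l p : ι) :
    (k • stdVec F l) p = k.1 p l := by
  rw [UnitVec.coe_smul]
  change (k.1 *ᵥ Pi.single l 1) p = _
  simp

lemma UnitMat.ext_stdVec {k k' : UnitMat ι F} (h : ∀ l : ι, k • stdVec F l = k' • stdVec F l) : k = k' := by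
  apply Subtype.ext
  ext1 p l
  rw [← smul_stdVec_apply, ← smul_stdVec_apply, h]

/-- Monomial unitary matrices. -/
def mon (σ : Equiv.Perm ι) (d : ι → UnitQuat F) : UnitMat ι F :=
  ⟨Matrix.of fun p q => if p = σ q then (d q : ℍ[F]) else 0, by
    rw [Unitary.mem_iff]
    constructor <;> ext1 x y <;> rw [Matrix.mul_apply]
    · have h := (Unitary.mem_iff.1 (d x).2).1
      by_cases hxy : x = y
      · subst hxy; simp [star_eq_conjTranspose, h]
      · simp [star_eq_conjTranspose, hxy, Ne.symm hxy]
    · have h := (Unitary.mem_iff.1 (d (σ.symm x)).2).2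
      have e : ∀ x q : ι, (x = σ q) ↔ (q = σ.symm x) := fun x q => by
        rw [Equiv.eq_symm_apply, eq_comm]
      by_cases hxy : x = y
      · subst hxy; simp [star_eq_conjTranspose, h, e]
      · simp [star_eq_conjTranspose, hxy, e, Matrix.one_apply, Ne.symm hxy]⟩

lemma coe_mon (σ : Equiv.Perm ι) (d : ι → UnitQuat F) (p q : ι) :
    (mon σ d).1 p q = if p = σ q then (d q : ℍ[F]) else 0 := rfl

lemma mon_smul_stdVec (σ : Equiv.Perm ι) (d : ι → UnitQuat F) (l : ι) :
    mon σ d • stdVec F l = (stdVec F (σ l)).rsmul (d l) := by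
  ext1 p
  rw [smul_stdVec_apply, coe_mon, UnitVec.rsmul_apply, stdVec_apply]
  simp

lemma stdVec_rsmul_inj {l m : ι} {u v : UnitQuat F} (h : (stdVec F l).rsmul u = (stdVec F m).rsmul v) :
    l = m ∧ u = v := by
  have h1 := congrArg (fun w : UnitVec ι F => w l) h
  simp only [UnitVec.rsmul_apply, stdVec_apply, if_true, one_mul] at h1
  by_cases hlm : l = m
  · rw [if_pos hlm, one_mul] at h1
    exact ⟨hlm, Subtype.ext h1⟩
  · rw [if_neg hlm, zero_mul] at h1
    have h2 := (Unitary.mem_iff.1 u.2).1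
    rw [h1, mul_zero] at h2
    exact absurd h2 zero_ne_one

lemma mon_mul_mon (σ τ : Equiv.Perm ι) (d d' : ι → UnitQuat F) :
    mon σ d * mon τ d' = mon (σ * τ) (fun q => d (τ q) * d' q) := by
  apply UnitMat.ext_stdVec
  intro l
  rw [mul_smul, mon_smul_stdVec, mon_smul_stdVec, UnitVec.smul_rsmul, mon_smul_stdVec,
    UnitVec.rsmul_rsmul]
  rfl

lemma mon_one : mon (1 : Equiv.Perm ι) (1 : ι → UnitQuat F) = 1 := by
  apply UnitMat.ext_stdVec
  intro l
  rw [mon_smul_stdVec]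
  simp

lemma mon_inv (σ : Equiv.Perm ι) (d : ι → UnitQuat F) :
    (mon σ d)⁻¹ = mon σ⁻¹ (fun q => (d (σ⁻¹ q))⁻¹) := by
  rw [inv_eq_iff_mul_eq_one, mon_mul_mon, ← mon_one]
  congr 1
  · simp
  · ext1 q; simp

lemma mon_inj {σ τ : Equiv.Perm ι} {d d' : ι → UnitQuat F} (h : mon σ d = mon τ d') :
    σ = τ ∧ d = d' := by
  have h1 : ∀ l, σ l = τ l ∧ d l = d' l := fun l => by
    apply stdVec_rsmul_inj
    rw [← mon_smul_stdVec, ← mon_smul_stdVec, h]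
  exact ⟨Equiv.ext fun l => (h1 l).1, funext fun l => (h1 l).2⟩

lemma rootHom_stdVec (l : ι) (a : UnitQuat F) :
    rootHom (stdVec F l) a = mon 1 (Pi.mulSingle l a) := by
  apply Subtype.ext
  ext1 p q
  rw [rootHom_apply, coe_mon, stdVec_apply, stdVec_apply, Matrix.one_apply]
  by_cases hp : p = l
  · by_cases hq : q = l
    · subst hp; subst hq; simp
    · subst hp; simp [hq, Ne.symm hq]
  · by_cases hpq : p = q
    · subst hpq; simp [hp]
    · simp [hp, hpq]

end Unitary

section Monomial

open Quaternion Matrix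

variable {F : Type*} [Field F] {ι : Type*} [Fintype ι] [DecidableEq ι]

/-- Monomial matrices with permutation part in `T` and entries in `D`. -/
def monGroup (T : Subgroup (Equiv.Perm ι)) (D : Subgroup (UnitQuat F)) :
    Subgroup (UnitMat ι F) where
  carrier := {k | ∃ σ ∈ T, ∃ d : ι → UnitQuat F, (∀ l, d l ∈ D) ∧ k = mon σ d}
  one_mem' := ⟨1, T.one_mem, 1, fun _ => D.one_mem, mon_one.symm⟩
  mul_mem' := by
    rintro _ _ ⟨σ, hσ, d, hd, rfl⟩ ⟨τ, hτ, d', hd', rfl⟩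
    exact ⟨_, T.mul_mem hσ hτ, _, fun l => D.mul_mem (hd _) (hd' l), mon_mul_mon _ _ _ _⟩
  inv_mem' := by
    rintro _ ⟨σ, hσ, d, hd, rfl⟩
    exact ⟨_, T.inv_mem hσ, _, fun l => D.inv_mem (hd _), mon_inv _ _⟩

lemma mon_mem_monGroup {T : Subgroup (Equiv.Perm ι)} {D : Subgroup (UnitQuat F)}
    {σ : Equiv.Perm ι} {d : ι → UnitQuat F} :
    mon σ d ∈ monGroup T D ↔ σ ∈ T ∧ ∀ l, d l ∈ D := by
  constructor
  · rintro ⟨τ, hτ, d', hd', h⟩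
    obtain ⟨rfl, rfl⟩ := mon_inj h
    exact ⟨hτ, hd'⟩
  · rintro ⟨h1, h2⟩
    exact ⟨σ, h1, d, h2, rfl⟩

lemma mem_monGroup_top {k : UnitMat ι F} :
    k ∈ monGroup ⊤ ⊤ ↔ ∃ σ d, k = mon σ d :=
  ⟨fun ⟨σ, _, d, _, h⟩ => ⟨σ, d, h⟩, fun ⟨σ, d, h⟩ => ⟨σ, trivial, d, fun _ => trivial, h⟩⟩

lemma rsmul_eq_iff {v w : UnitVec ι F} {u : UnitQuat F} : v.rsmul u = w ↔ v = w.rsmul u⁻¹ := by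
  constructor
  · rintro rfl
    rw [UnitVec.rsmul_rsmul]; simp
  · rintro rfl
    rw [UnitVec.rsmul_rsmul]; simp

/-- A unitary matrix permuting the coordinate lines is monomial. -/
lemma mem_monGroup_of_stdVec {k : UnitMat ι F}
    (h : ∀ l : ι, ∃ m u, k • stdVec F l = (stdVec F m).rsmul u) : k ∈ monGroup ⊤ ⊤ := by
  choose m u h using h
  have hinj : Function.Injective m := by
    intro l l' hl
    have h1 := h l
    rw [hl, eq_comm, rsmul_eq_iff, ← UnitVec.smul_rsmul] at h1
    have h2 := h l'
    rw [eq_comm, rsmul_eq_iff, ← UnitVec.smul_rsmul, h1] at h2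
    exact (stdVec_rsmul_inj (MulAction.injective k h2)).1
  rw [mem_monGroup_top]
  refine ⟨Equiv.ofBijective m (Finite.injective_iff_bijective.1 hinj), u, ?_⟩
  apply UnitMat.ext_stdVec
  intro l
  rw [mon_smul_stdVec, h]
  rfl

/-- A unit vector `w` is a root of `K` if `K` contains the copy of the quaternion group along
`w`. -/
def IsRoot (K : Subgroup (UnitMat ι F)) (w : UnitVec ι F) : Prop :=
  ∀ a ∈ quatGroup F, rootHom w a ∈ K

lemma IsRoot.mono {K N : Subgroup (UnitMat ι F)} {w : UnitVec ι F} (h : IsRoot K w) (hKN : K ≤ N) :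
    IsRoot N w := fun a ha => hKN (h a ha)

lemma IsRoot.smul_of_normalizing {K N : Subgroup (UnitMat ι F)} {w : UnitVec ι F} (h : IsRoot K w)
    {k : UnitMat ι F} (hk : ∀ x ∈ K, k * x * k⁻¹ ∈ N) : IsRoot N (k • w) := fun a ha => by
  rw [← conj_rootHom]; exact hk _ (h a ha)

lemma IsRoot.smul {K : Subgroup (UnitMat ι F)} {w : UnitVec ι F} (h : IsRoot K w)
    {k : UnitMat ι F} (hk : k ∈ K) : IsRoot K (k • w) :=
  h.smul_of_normalizing fun _ hx => K.mul_mem (K.mul_mem hk hx) (K.inv_mem hk)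

/-- The norm-one quaternions embedded along `w` that lie in `K`. -/
def localGroup (K : Subgroup (UnitMat ι F)) (w : UnitVec ι F) : Subgroup (UnitQuat F) :=
  K.comap (rootHom w)

lemma mem_localGroup {K : Subgroup (UnitMat ι F)} {w : UnitVec ι F} {a : UnitQuat F} :
    a ∈ localGroup K w ↔ rootHom w a ∈ K := Iff.rfl

lemma stdVec_isRoot_monGroup (T : Subgroup (Equiv.Perm ι)) {D : Subgroup (UnitQuat F)}
    (hD : quatGroup F ≤ D) (l : ι) : IsRoot (monGroup T D) (stdVec F l) := fun a ha => by
  rw [rootHom_stdVec, mon_mem_monGroup]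
  refine ⟨T.one_mem, fun m => ?_⟩
  by_cases h : m = l
  · subst h; simpa using hD ha
  · simp [h, D.one_mem]

lemma normSq_mul_star (a : ℍ[F]) : a * star a = ((normSq a : F) : ℍ[F]) := Quaternion.self_mul_star a

lemma UnitVec.sum_normSq (w : UnitVec ι F) : ∑ p, (normSq (w p) : F) = 1 := by
  have h := w.star_dotProduct_self
  simp only [dotProduct, Pi.star_apply, Quaternion.star_mul_self] at h
  apply Quaternion.coe_injective
  rw [Quaternion.coe_one, ← h]
  exact map_sum (algebraMap F ℍ[F]) _ _

variable [NeZero (2 : F)]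

/-- Roots of groups of monomial matrices are multiples of the standard basis vectors. -/
lemma IsRoot.eq_stdVec {y : UnitVec ι F} (h : IsRoot (monGroup ⊤ ⊤) y) :
    ∃ l u, y = (stdVec F l).rsmul u := by
  have hI : unitI F ∈ quatGroup F := unitI_mem
  obtain ⟨σ, d, hk⟩ := mem_monGroup_top.1 (h _ hI)
  have hent : ∀ p q, (1 : Matrix ι ι ℍ[F]) p q + y p * (qi - 1) * star (y q) =
      if p = σ q then (d q : ℍ[F]) else 0 := by
    intro p q
    rw [← coe_mon, ← hk, rootHom_apply, coe_unitI]
  have hdiag : ∀ p, p = σ p := by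
    intro p
    by_contra hp
    have h1 := hent p p
    rw [if_neg hp, Matrix.one_apply_eq] at h1
    have h2 : y p * (qi - 1) * star (y p) = y p * qi * star (y p) - ((normSq (y p) : F) : ℍ[F]) := by
      rw [← normSq_mul_star, mul_sub, sub_mul, mul_one]
    rw [h2] at h1
    have h3 := congrArg QuaternionAlgebra.re h1
    have h4 : (y p * qi * star (y p)).re = 0 := by
      simp; ring
    have h5 : (normSq (y p) : F) = 1 := by
      rw [Quaternion.re_add, Quaternion.re_sub, h4, Quaternion.re_coe, Quaternion.re_one, Quaternion.re_zero] at h3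
      linear_combination -h3
    rw [h5] at h1
    have h6 : y p * qi * star (y p) = 0 := by
      simpa using h1
    have h7 := congrArg (fun x : ℍ[F] => (normSq x : F)) h6
    simp only [map_mul, normSq_star, h5, map_zero] at h7
    rw [Quaternion.normSq_def'] at h7
    simp at h7
  obtain ⟨l, hl⟩ : ∃ l, (normSq (y l) : F) ≠ 0 := by
    by_contra! hc
    have := y.sum_normSq
    simp [hc] at this
  have hoff : ∀ q, q ≠ l → y q = 0 := by
    intro q hq
    have h1 := hent l q
    rw [← hdiag q, if_neg hq.symm, Matrix.one_apply_ne hq.symm, zero_add] at h1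
    have h2 : star (qi - 1) * (star (y l) * (y l * (qi - 1) * star (y q))) =
        ((2 * normSq (y l) : F) : ℍ[F]) * star (y q) := by
      have e1 : star (y l) * y l = ((normSq (y l) : F) : ℍ[F]) := Quaternion.star_mul_self _
      have e2 : star (qi - 1 : ℍ[F]) * (qi - 1) = ((2 : F) : ℍ[F]) := by
        ext <;> simp; norm_num
      calc _ = star (qi - 1) * ((star (y l) * y l) * (qi - 1)) * star (y q) := by simp only [mul_assoc]
        _ = star (qi - 1) * ((qi - 1) * (star (y l) * y l)) * star (y q) := by
            rw [e1, Quaternion.coe_commutes]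
        _ = (star (qi - 1 : ℍ[F]) * (qi - 1)) * (star (y l) * y l) * star (y q) := by simp only [mul_assoc]
        _ = _ := by rw [e1, e2, Quaternion.coe_mul]
    rw [h1, mul_zero, mul_zero, eq_comm, Quaternion.coe_mul_eq_smul, smul_eq_zero] at h2
    rcases h2 with h2 | h2
    · exact absurd h2 (mul_ne_zero (NeZero.ne _) hl)
    · exact star_eq_zero.1 h2
  have hn : (normSq (y l) : F) = 1 := by
    rw [← y.sum_normSq, Finset.sum_eq_single l]
    · intro q _ hq
      rw [hoff q hq, map_zero]
    · simp
  refine ⟨l, ⟨y l, ?_⟩, ?_⟩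
  · rw [mem_unitQuat, ← Quaternion.normSq_def', hn]
  · ext1 p
    rw [UnitVec.rsmul_apply, stdVec_apply]
    by_cases hp : p = l
    · subst hp; simp
    · rw [hoff p hp, if_neg hp, zero_mul]

variable [Finite F]

/-- A `2`-group for which each standard basis vector is either a root or fixed is monomial. -/
lemma IsPGroup.le_monGroup {P : Subgroup (UnitMat ι F)} (hP : IsPGroup 2 P)
    (h : ∀ l, IsRoot P (stdVec F l) ∨ ∀ k ∈ P, k • stdVec F l = stdVec F l) :
    P ≤ monGroup ⊤ ⊤ := by
  have key : P ≤ P ⊓ monGroup ⊤ ⊤ := by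
    apply hP.le_of_normalizing inf_le_left
    intro x hx hnx
    refine ⟨hx, mem_monGroup_of_stdVec fun l => ?_⟩
    rcases h l with hl | hl
    · have hr : IsRoot (P ⊓ monGroup ⊤ ⊤) (stdVec F l) := fun a ha =>
        ⟨hl a ha, stdVec_isRoot_monGroup ⊤ le_top l a ha⟩
      exact ((hr.smul_of_normalizing hnx).mono inf_le_right).eq_stdVec
    · exact ⟨l, 1, by rw [hl x hx, UnitVec.rsmul_one]⟩
  exact key.trans inf_le_right

lemma exists_isMaxTwo_ge {G : Type*} [Group G] [Finite G] {R N : Subgroup G} (hR : IsPGroup 2 R)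
    (hRN : R ≤ N) : ∃ P, R ≤ P ∧ IsMaxTwo P N := by
  obtain ⟨S, hS⟩ := (hR.comap_subtype (K := N)).exists_le_sylow
  refine ⟨S.1.map N.subtype, ?_, Subgroup.map_subtype_le _, S.2.map _, ?_⟩
  · intro x hx
    exact ⟨⟨x, hRN hx⟩, hS hx, rfl⟩
  · intro R' h1 h2 h3 x hx
    have h4 : S.1 ≤ R'.comap N.subtype := Subgroup.map_le_iff_le_comap.1 h1
    have h5 := S.3 (h3.comap_subtype (K := N)) h4
    have h6 : (⟨x, h2 hx⟩ : N) ∈ S.1 := by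
      rw [← h5]; exact hx
    exact Subgroup.mem_map_of_mem N.subtype h6

lemma isPGroup_monGroup {T : Subgroup (Equiv.Perm ι)} {D : Subgroup (UnitQuat F)}
    (hT : IsPGroup 2 T) (hD : IsPGroup 2 D) : IsPGroup 2 (monGroup T D) := by
  have hpow : ∀ (d : ι → UnitQuat F) (n : ℕ), mon 1 d ^ n = mon 1 (fun l => d l ^ n) := by
    intro d n
    induction n with
    | zero => rw [pow_zero, ← mon_one]; simp only [pow_zero]; rfl
    | succ n ih => rw [pow_succ, ih, mon_mul_mon]; simp [pow_succ]
  have hpow2 : ∀ (σ : Equiv.Perm ι) (d : ι → UnitQuat F) (_ : ∀ l, d l ∈ D) (n : ℕ),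
      ∃ d' : ι → UnitQuat F, (∀ l, d' l ∈ D) ∧ mon σ d ^ n = mon (σ ^ n) d' := by
    intro σ d hd n
    induction n with
    | zero => exact ⟨1, fun _ => D.one_mem, by rw [pow_zero, pow_zero, mon_one]⟩
    | succ n ih =>
      obtain ⟨d', hd', h⟩ := ih
      exact ⟨_, fun l => D.mul_mem (hd' _) (hd l), by rw [pow_succ, h, mon_mul_mon, pow_succ]⟩
  obtain ⟨b, hb⟩ := IsPGroup.iff_card.1 hD
  rintro ⟨_, σ, hσ, d, hd, rfl⟩
  obtain ⟨a, ha⟩ := hT ⟨σ, hσ⟩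
  obtain ⟨d', hd', h⟩ := hpow2 σ d hd (2 ^ a)
  refine ⟨a + b, Subtype.ext ?_⟩
  have ha' : σ ^ 2 ^ a = 1 := congrArg Subtype.val ha
  rw [pow_add, pow_mul]
  change (mon σ d ^ 2 ^ a) ^ 2 ^ b = 1
  rw [h, ha', hpow, ← mon_one]
  congr 1
  ext1 l
  rw [← hb]
  exact congrArg Subtype.val (pow_card_eq_one' (x := (⟨d' l, hd' l⟩ : D)))

/-- Sylow's theorem for roots: if a root `y` of `K` is supported on a set `D` of coordinates which
are roots of `K`, then some element of `K` acting on the coordinates in `D` only moves `y` to a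
coordinate line. -/
lemma IsRoot.exists_smul_eq_stdVec {K : Subgroup (UnitMat ι F)} {y : UnitVec ι F}
    (hy : IsRoot K y) {D : Set ι} (hyD : ∀ l ∉ D, y l = 0)
    (hD : ∀ m ∈ D, IsRoot K (stdVec F m)) :
    ∃ k ∈ K, (∀ l ∉ D, k • stdVec F l = stdVec F l) ∧
      ∃ m ∈ D, ∃ u, k • y = (stdVec F m).rsmul u := by
  classical
  let KD : Subgroup (UnitMat ι F) :=
    { carrier := {k | k ∈ K ∧ ∀ l ∉ D, k • stdVec F l = stdVec F l}
      one_mem' := ⟨K.one_mem, fun l _ => one_smul _ _⟩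
      mul_mem' := fun {a b} ha hb => ⟨K.mul_mem ha.1 hb.1, fun l hl => by
        rw [mul_smul, hb.2 l hl, ha.2 l hl]⟩
      inv_mem' := fun {a} ha => ⟨K.inv_mem ha.1, fun l hl => by
        rw [inv_smul_eq_iff, ha.2 l hl]⟩ }
  have hfix : ∀ (w : UnitVec ι F) (a : UnitQuat F) (l : ι), w l = 0 →
      rootHom w a • stdVec F l = stdVec F l := by
    intro w a l hl
    ext1 p
    rw [smul_stdVec_apply, rootHom_apply, hl, star_zero, mul_zero, add_zero, stdVec_apply,
      Matrix.one_apply]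
  have hmemD : ∀ w : UnitVec ι F, IsRoot K w → (∀ l ∉ D, w l = 0) → IsRoot KD w :=
    fun w hw hw' a ha => ⟨hw a ha, fun l hl => hfix w a l (hw' l hl)⟩
  let R0 : Subgroup (UnitMat ι F) := KD ⊓ monGroup ⊥ (quatGroup F)
  have hR0 : IsPGroup 2 R0 :=
    (isPGroup_monGroup (IsPGroup.of_bot) isPGroup_quatGroup).to_le inf_le_right
  have hroot0 : ∀ m ∈ D, IsRoot R0 (stdVec F m) := by
    intro m hm a ha
    refine ⟨hmemD _ (hD m hm) ?_ a ha, stdVec_isRoot_monGroup ⊥ le_rfl m a ha⟩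
    intro l hl
    rw [stdVec_apply, if_neg]
    rintro rfl
    exact hl hm
  obtain ⟨P, hRP, hP⟩ := exists_isMaxTwo_ge hR0 (inf_le_left : R0 ≤ KD)
  have hPm : P ≤ monGroup ⊤ ⊤ := hP.isPGroup.le_monGroup fun l => by
    by_cases hl : l ∈ D
    · exact Or.inl ((hroot0 l hl).mono hRP)
    · exact Or.inr fun k hk => (hP.le hk).2 l hl
  obtain ⟨k, hk, hkP⟩ := hP.exists_conj (R := (quatGroup F).map (rootHom y))
    (isPGroup_quatGroup.map _) (by
      rintro _ ⟨a, ha, rfl⟩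
      exact hmemD y hy hyD a ha)
  have hky : IsRoot P (k • y) := fun a ha => by
    rw [← conj_rootHom]
    exact hkP _ ⟨a, ha, rfl⟩
  obtain ⟨m, u, hmu⟩ := (hky.mono hPm).eq_stdVec
  refine ⟨k, hk.1, hk.2, m, ?_, u, hmu⟩
  by_contra hm
  have h1 : y = (stdVec F m).rsmul u := by
    rw [← inv_smul_smul k y, ← inv_smul_smul k ((stdVec F m).rsmul u), UnitVec.smul_rsmul k,
      hk.2 m hm, ← hmu]
  have h2 := hyD m hm
  rw [h1, UnitVec.rsmul_apply, stdVec_apply, if_pos rfl, one_mul] at h2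
  have h3 := UnitQuat.coe_inv_mul u
  rw [h2, mul_zero] at h3
  exact zero_ne_one h3

/-- The monomial matrices over Sylow `2`-subgroups form a Sylow `2`-subgroup. -/
lemma isMaxTwo_monGroup {T : Subgroup (Equiv.Perm ι)} {D : Subgroup (UnitQuat F)}
    (hT : IsMaxTwo T ⊤) (hD : IsMaxTwo D ⊤) (hQD : quatGroup F ≤ D) :
    IsMaxTwo (monGroup T D) ⊤ := by
  refine ⟨le_top, isPGroup_monGroup hT.isPGroup hD.isPGroup, fun R hR _ hR2 => ?_⟩
  have hRm : R ≤ monGroup ⊤ ⊤ :=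
    hR2.le_monGroup fun l => Or.inl ((stdVec_isRoot_monGroup T hQD l).mono hR)
  let PR : Subgroup (Equiv.Perm ι) :=
    { carrier := {σ | ∃ d, mon σ d ∈ R}
      one_mem' := ⟨1, by rw [mon_one]; exact R.one_mem⟩
      mul_mem' := fun {σ τ} ⟨d, hd⟩ ⟨d', hd'⟩ => ⟨_, by
        rw [← mon_mul_mon]; exact R.mul_mem hd hd'⟩
      inv_mem' := fun {σ} ⟨d, hd⟩ => ⟨_, by rw [← mon_inv]; exact R.inv_mem hd⟩ }
  have hpw : ∀ (σ : Equiv.Perm ι) (d : ι → UnitQuat F) (n : ℕ),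
      ∃ d' : ι → UnitQuat F, mon σ d ^ n = mon (σ ^ n) d' := by
    intro σ d n
    induction n with
    | zero => exact ⟨1, by rw [pow_zero, pow_zero, mon_one]⟩
    | succ n ih =>
      obtain ⟨d', h⟩ := ih
      exact ⟨_, by rw [pow_succ, h, mon_mul_mon, pow_succ]⟩
  have hPR : IsPGroup 2 PR := by
    rintro ⟨σ, d, hd⟩
    obtain ⟨n, hn⟩ := hR2 ⟨_, hd⟩
    have hn' : mon σ d ^ 2 ^ n = 1 := congrArg Subtype.val hn
    obtain ⟨d', hd'⟩ := hpw σ d (2 ^ n)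
    rw [hd', ← mon_one] at hn'
    exact ⟨n, Subtype.ext (mon_inj hn').1⟩
  have hTR : PR ≤ T := hT.max _ (fun σ hσ => ⟨1, hR (mon_mem_monGroup.2 ⟨hσ, fun _ => D.one_mem⟩)⟩)
    le_top hPR
  have hdiag : ∀ l : ι, ∀ d : ι → UnitQuat F, mon 1 d ∈ R → d l ∈ D := by
    intro l
    let DR : Subgroup (UnitQuat F) :=
      { carrier := {u | ∃ d : ι → UnitQuat F, mon 1 d ∈ R ∧ d l = u}
        one_mem' := ⟨1, by rw [mon_one]; exact R.one_mem, rfl⟩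
        mul_mem' := by
          rintro _ _ ⟨d, hd, rfl⟩ ⟨d', hd', rfl⟩
          exact ⟨d * d', by simpa [mon_mul_mon] using! R.mul_mem hd hd', rfl⟩
        inv_mem' := by
          rintro _ ⟨d, hd, rfl⟩
          exact ⟨d⁻¹, by simpa [mon_inv] using! R.inv_mem hd, rfl⟩ }
    have hDR : IsPGroup 2 DR := by
      rintro ⟨_, d, hd, rfl⟩
      obtain ⟨n, hn⟩ := hR2 ⟨_, hd⟩
      have hn' : mon 1 d ^ 2 ^ n = 1 := congrArg Subtype.val hn
      have hpow : ∀ n : ℕ, mon 1 d ^ n = mon 1 (fun l => d l ^ n) := by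
        intro n
        induction n with
        | zero => rw [pow_zero, ← mon_one]; simp only [pow_zero]; rfl
        | succ n ih => rw [pow_succ, ih, mon_mul_mon]; simp [pow_succ]
      rw [hpow, ← mon_one] at hn'
      exact ⟨n, Subtype.ext (congrFun (mon_inj hn').2 l)⟩
    have := hD.max DR (fun u hu => ⟨Pi.mulSingle l u, hR (by
      rw [mon_mem_monGroup]
      refine ⟨T.one_mem, fun m => ?_⟩
      by_cases h : m = l
      · subst h; simpa using hu
      · simp [h, D.one_mem]), by simp⟩) le_top hDR
    exact fun d hd => this ⟨d, hd, rfl⟩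
  intro r hr
  obtain ⟨σ, d, rfl⟩ := mem_monGroup_top.1 (hRm hr)
  have hσ : σ ∈ T := hTR ⟨d, hr⟩
  refine mon_mem_monGroup.2 ⟨hσ, fun l => hdiag l d ?_⟩
  have h1 : mon σ (1 : ι → UnitQuat F) ∈ R := hR (mon_mem_monGroup.2 ⟨hσ, fun _ => D.one_mem⟩)
  have h2 := R.mul_mem (R.inv_mem h1) hr
  rw [mon_inv, mon_mul_mon] at h2
  simpa using! h2

/-- Elements normalizing a monomial group are monomial, with entries normalizing. -/
lemma eq_mon_of_normalizing {T : Subgroup (Equiv.Perm ι)} {D : Subgroup (UnitQuat F)}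
    (hNT : ∀ σ : Equiv.Perm ι, (∀ τ ∈ T, σ * τ * σ⁻¹ ∈ T) → σ ∈ T) (hQD : quatGroup F ≤ D)
    {g : UnitMat ι F} (hg : ∀ x ∈ monGroup T D, g * x * g⁻¹ ∈ monGroup T D) :
    ∃ σ ∈ T, ∃ d : ι → UnitQuat F, (∀ l, ∀ a ∈ D, d l * a * (d l)⁻¹ ∈ D) ∧ g = mon σ d := by
  have h1 : g ∈ monGroup (⊤ : Subgroup (Equiv.Perm ι)) (⊤ : Subgroup (UnitQuat F)) :=
    mem_monGroup_of_stdVec fun l =>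
      (((stdVec_isRoot_monGroup T hQD l).smul_of_normalizing hg).mono (N := monGroup ⊤ ⊤)
        (fun _ ⟨σ, _, d, _, h⟩ => ⟨σ, trivial, d, fun _ => trivial, h⟩)).eq_stdVec
  obtain ⟨σ, d, rfl⟩ := mem_monGroup_top.1 h1
  have hconj : ∀ τ c, mon τ c ∈ monGroup T D → σ * τ * σ⁻¹ ∈ T ∧
      ∀ l, d (τ (σ⁻¹ l)) * c (σ⁻¹ l) * (d (σ⁻¹ l))⁻¹ ∈ D := by
    intro τ c h
    have h2 := hg _ h
    rw [mon_inv, mon_mul_mon, mon_mul_mon, mon_mem_monGroup] at h2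
    exact h2
  refine ⟨σ, hNT σ fun τ hτ => (hconj τ 1 (mon_mem_monGroup.2 ⟨hτ, fun _ => D.one_mem⟩)).1, d,
    fun l a ha => ?_, rfl⟩
  have h3 := (hconj 1 (fun _ => a) (mon_mem_monGroup.2 ⟨T.one_mem, fun _ => ha⟩)).2 (σ l)
  simpa using h3

end Monomial

section CommutatorSign

open Quaternion Matrix

variable {F : Type*} [Field F] [NeZero (2 : F)] [Finite F]

lemma IsPGroup.re_eq_zero_or (hns : ¬ IsSquare (2 : F)) {P : Subgroup (UnitQuat F)}
    (hP : IsPGroup 2 P) {p : UnitQuat F} (hp : p ∈ P) : (p : ℍ[F]).re = 0 ∨ p ∈ signGroup F := by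
  obtain ⟨x, -, hx⟩ := (isMaxTwo_quatGroup hns).exists_conj hP le_top
  have h1 : IsQ8 ((x * p * x⁻¹ : UnitQuat F) : ℍ[F]) := hx p hp
  by_cases hs : x * p * x⁻¹ ∈ signGroup F
  · right
    have h3 := (inferInstance : (signGroup F).Normal).conj_mem _ hs x⁻¹
    simpa [mul_assoc] using h3
  · left
    rw [mem_signGroup] at hs
    push Not at hs
    have h2 : (((x * p * x⁻¹ : UnitQuat F) : ℍ[F])).re = 0 := by
      rcases h1 with h | h | h | h | h | h | h | h
      · exact absurd h hs.1
      · exact absurd h hs.2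
      all_goals rw [h]; simp
    rwa [← conjQ_coe, conjQ_re] at h2

lemma mul_eq_mul_inv_of_anticomm {y p : UnitQuat F} (hy : (y : ℍ[F]) * qi = qi * (y : ℍ[F]))
    (hp : (p : ℍ[F]) * qi = -(qi * (p : ℍ[F]))) : y * p = p * y⁻¹ := by
  obtain ⟨h1, h2⟩ := coords_of_comm_qi hy
  obtain ⟨h3, h4⟩ := coords_of_anticomm_qi hp
  apply Subtype.ext
  change (y : ℍ[F]) * (p : ℍ[F]) = (p : ℍ[F]) * star (y : ℍ[F])
  ext <;> simp [h1, h2, h3, h4] <;> ring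

lemma mul_self_mem_signGroup (hns : ¬ IsSquare (2 : F)) {P : Subgroup (UnitQuat F)}
    (hP : IsPGroup 2 P) {y : UnitQuat F} (hy : (y : ℍ[F]) * qi = qi * (y : ℍ[F]))
    (hyP : y * y ∈ P) : y * y ∈ signGroup F := by
  refine (hP.re_eq_zero_or hns hyP).resolve_left fun h => hns ?_
  obtain ⟨h1, h2⟩ := coords_of_comm_qi hy
  have hn := mem_unitQuat.1 y.2
  rw [Submonoid.coe_mul] at h
  simp [h1, h2] at h hn
  refine ⟨2 * (y : ℍ[F]).re, ?_⟩
  linear_combination -2 * hn - 2 * h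

/-- If `2` is not a square, an element normalizing a `2`-group containing `i` and fixing `i` up to
sign acts trivially on it modulo signs. -/
lemma IsPGroup.commutator_mem_signGroup (hns : ¬ IsSquare (2 : F)) {P : Subgroup (UnitQuat F)}
    (hP : IsPGroup 2 P) (hI : unitI F ∈ P) {x : UnitQuat F} (hx : ∀ p ∈ P, x * p * x⁻¹ ∈ P)
    (hxI : (x : ℍ[F]) * qi = qi * (x : ℍ[F]) ∨ (x : ℍ[F]) * qi = -(qi * (x : ℍ[F])))
    {p : UnitQuat F} (hp : p ∈ P) : x * p * x⁻¹ * p⁻¹ ∈ signGroup F := by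
  have hcomm : x * p * x⁻¹ * p⁻¹ ∈ P := P.mul_mem (hx p hp) (P.inv_mem hp)
  rcases hP.comm_up_to_sign hns hp hI with h | h <;> rw [coe_unitI] at h
  · rcases hP.re_eq_zero_or hns hp with h0 | h0
    · obtain ⟨h1, h2⟩ := coords_of_comm_qi h
      have hpx : (x : ℍ[F]) * (p : ℍ[F]) = (p : ℍ[F]) * (x : ℍ[F]) ∨
          (x : ℍ[F]) * (p : ℍ[F]) = -((p : ℍ[F]) * (x : ℍ[F])) := by
        have h3 : (p : ℍ[F]) = (p : ℍ[F]).imI • qi := by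
          ext <;> simp [h0, h1, h2]
        rw [h3]
        simp only [mul_smul_comm, smul_mul_assoc]
        rcases hxI with h | h <;> rw [h]
        · exact Or.inl rfl
        · exact Or.inr (smul_neg _ _)
      rcases hpx with h3 | h3
      · have : x * p = p * x := Subtype.ext h3
        rw [this, mul_inv_cancel_right, mul_inv_cancel]; exact one_mem _
      · right
        have h4 : ((x * p * x⁻¹ * p⁻¹ : UnitQuat F) : ℍ[F]) =
          ((x : ℍ[F]) * (p : ℍ[F])) * ((x⁻¹ * p⁻¹ : UnitQuat F) : ℍ[F]) := by
            rw [mul_assoc (x * p)]; rfl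
        rw [h4, h3, neg_mul]
        congr 1
        change ((p * x * (x⁻¹ * p⁻¹) : UnitQuat F) : ℍ[F]) = 1
        rw [show p * x * (x⁻¹ * p⁻¹) = 1 by group]; rfl
    · rw [signGroup_comm h0, mul_inv_cancel_right, mul_inv_cancel]; exact one_mem _
  · rcases hxI with hxI | hxI
    · have h1 := mul_eq_mul_inv_of_anticomm hxI h
      have h2 : x * p * x⁻¹ * p⁻¹ = x * x := by
        have h3 : x = p * x⁻¹ * p⁻¹ := by rw [← h1, mul_inv_cancel_right]
        rw [mul_assoc x p, mul_assoc x, ← h3]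
      rw [h2] at hcomm ⊢
      exact mul_self_mem_signGroup hns hP hxI hcomm
    · have hpinv : star (p : ℍ[F]) * qi = -(qi * star (p : ℍ[F])) := by
        obtain ⟨h1, h2⟩ := coords_of_anticomm_qi h
        ext <;> simp [h1, h2]
      have hy : ((x * p⁻¹ : UnitQuat F) : ℍ[F]) * qi = qi * ((x * p⁻¹ : UnitQuat F) : ℍ[F]) := by
        change (x : ℍ[F]) * star (p : ℍ[F]) * qi = qi * ((x : ℍ[F]) * star (p : ℍ[F]))
        rw [mul_assoc, hpinv, mul_neg, ← mul_assoc, hxI, neg_mul, neg_neg, mul_assoc]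
      have h1 := mul_eq_mul_inv_of_anticomm hy h
      obtain ⟨y, hyx⟩ : ∃ y, y = x * p⁻¹ := ⟨_, rfl⟩
      rw [← hyx] at h1 hy
      have hx' : x = y * p := by rw [hyx, inv_mul_cancel_right]
      have h2 : x * p * x⁻¹ * p⁻¹ = y * y := by
        have h3 : y = p * y⁻¹ * p⁻¹ := by rw [← h1, mul_inv_cancel_right]
        calc x * p * x⁻¹ * p⁻¹ = y * (p * y⁻¹ * p⁻¹) := by rw [hx']; group
          _ = y * y := by rw [← h3]
      rw [h2] at hcomm ⊢
      exact mul_self_mem_signGroup hns hP hy hcomm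

end CommutatorSign

section Rank2

open Quaternion Matrix

variable {F : Type*} [Field F]

/-- The standard embedding of the quaternions into `2 × 2` matrices. -/
def psi (u : ℍ[F]) : Matrix (Fin 2) (Fin 2) ℍ[F] :=
  !![qmk u.re u.imI 0 0, qmk u.imJ u.imK 0 0; qmk (-u.imJ) u.imK 0 0, qmk u.re (-u.imI) 0 0]

lemma psi_mul (u v : ℍ[F]) : psi (u * v) = psi u * psi v := by
  ext1 p q
  rw [Matrix.mul_apply, Fin.sum_univ_two]
  fin_cases p <;> fin_cases q <;> ext <;> simp [psi] <;> ring

lemma psi_one : psi (1 : ℍ[F]) = 1 := by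
  ext1 p q
  fin_cases p <;> fin_cases q <;> ext <;> simp [psi]

lemma psi_star (u : ℍ[F]) : psi (star u) = star (psi u) := by
  ext1 p q
  rw [Matrix.star_apply]
  fin_cases p <;> fin_cases q <;> ext <;> simp [psi]

/-- The embedding `psi` on norm-one quaternions. -/
def psiU (F : Type*) [Field F] : UnitQuat F →* UnitMat (Fin 2) F where
  toFun u := ⟨psi (u : ℍ[F]), by
    have h := Unitary.mem_iff.1 u.2
    rw [Unitary.mem_iff, ← psi_star, ← psi_mul, ← psi_mul, h.1, h.2, psi_one]
    exact ⟨rfl, rfl⟩⟩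
  map_one' := Subtype.ext psi_one
  map_mul' u v := Subtype.ext (psi_mul _ _)

/-- The scalar matrix `i`. -/
def scalarI (F : Type*) [Field F] : UnitMat (Fin 2) F := mon 1 (fun _ => unitI F)

lemma scalarI_comm_psiU (u : UnitQuat F) : Commute (scalarI F) (psiU F u) := by
  apply Subtype.ext
  ext1 p q
  change ((scalarI F).1 * psi (u : ℍ[F])) p q = (psi (u : ℍ[F]) * (scalarI F).1) p q
  rw [Matrix.mul_apply, Fin.sum_univ_two, Matrix.mul_apply, Fin.sum_univ_two]
  simp only [scalarI, coe_mon]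
  fin_cases p <;> fin_cases q <;> ext <;> simp [psi]

/-- The reflection in a unit vector. -/
def reflVec {ι : Type*} [Fintype ι] [DecidableEq ι] (w : UnitVec ι F) : UnitMat ι F := rootHom w (-1)

lemma reflVec_apply {ι : Type*} [Fintype ι] [DecidableEq ι] (w : UnitVec ι F) (p q : ι) :
    (reflVec w).1 p q = (1 : Matrix ι ι ℍ[F]) p q - (2 : F) • (w p * star (w q)) := by
  rw [reflVec, rootHom_apply]
  have : (((-1 : UnitQuat F) : ℍ[F]) - 1) = -((2 : F) : ℍ[F]) := by
    rw [show ((-1 : UnitQuat F) : ℍ[F]) = -1 from rfl]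
    ext <;> simp
    norm_num
  rw [this, mul_neg, neg_mul, ← sub_eq_add_neg, ← Quaternion.coe_commutes, mul_assoc,
    Quaternion.coe_mul_eq_smul]

lemma neg_one_mem_quatGroup : (-1 : UnitQuat F) ∈ quatGroup F := isQ8_neg_one

lemma IsRoot.reflVec_mem {ι : Type*} [Fintype ι] [DecidableEq ι] {K : Subgroup (UnitMat ι F)}
    {w : UnitVec ι F} (h : IsRoot K w) : reflVec w ∈ K := h _ neg_one_mem_quatGroup

/-- The quaternions whose image under `psi` lies in `K` up to a power of the scalar `i`. -/
def psiGroup (K : Subgroup (UnitMat (Fin 2) F)) : Subgroup (UnitQuat F) where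
  carrier := {u | ∃ e : ℤ, scalarI F ^ e * psiU F u ∈ K}
  one_mem' := ⟨0, by simp [K.one_mem]⟩
  mul_mem' := by
    rintro u v ⟨e, he⟩ ⟨f, hf⟩
    refine ⟨e + f, ?_⟩
    have := K.mul_mem he hf
    have hc := ((scalarI_comm_psiU u).zpow_left f).eq
    rwa [mul_assoc, ← mul_assoc (psiU F u), ← hc, mul_assoc (scalarI F ^ f), ← mul_assoc, ← _root_.zpow_add,
      ← map_mul] at this
  inv_mem' := by
    rintro u ⟨e, he⟩
    refine ⟨-e, ?_⟩
    have := K.inv_mem he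
    have hc := ((scalarI_comm_psiU u⁻¹).zpow_left (-e)).eq
    rwa [_root_.mul_inv_rev, ← _root_.zpow_neg, ← map_inv, ← hc] at this

/-- The quaternion units corresponding to reflections in roots of `K`. -/
def IsReflUnit (K : Subgroup (UnitMat (Fin 2) F)) (p : UnitQuat F) : Prop :=
  ∃ w, IsRoot K w ∧ (psiU F p = scalarI F * reflVec w ∨ psiU F p = (scalarI F)⁻¹ * reflVec w)

lemma IsReflUnit.mem_psiGroup {K : Subgroup (UnitMat (Fin 2) F)} {p : UnitQuat F}
    (h : IsReflUnit K p) : p ∈ psiGroup K := by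
  obtain ⟨w, hw, h | h⟩ := h
  · exact ⟨-1, by rw [h, _root_.zpow_neg_one, inv_mul_cancel_left]; exact hw.reflVec_mem⟩
  · exact ⟨1, by rw [h, _root_.zpow_one, mul_inv_cancel_left]; exact hw.reflVec_mem⟩

lemma IsReflUnit.conj {K : Subgroup (UnitMat (Fin 2) F)} {p u : UnitQuat F}
    (h : IsReflUnit K p) (hu : u ∈ psiGroup K) : IsReflUnit K (u * p * u⁻¹) := by
  obtain ⟨w, hw, h⟩ := h
  obtain ⟨e, he⟩ := hu
  refine ⟨_, hw.smul he, ?_⟩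
  obtain ⟨k, hk⟩ : ∃ k, k = scalarI F ^ e * psiU F u := ⟨_, rfl⟩
  have hkc : Commute (scalarI F) k := by
    rw [hk]; exact ((Commute.refl _).zpow_right e).mul_right (scalarI_comm_psiU u)
  have h1 : psiU F (u * p * u⁻¹) = k * psiU F p * k⁻¹ := by
    have hc := ((scalarI_comm_psiU (u * p * u⁻¹)).zpow_left e).eq
    rw [hk, _root_.mul_inv_rev, ← map_inv]
    calc psiU F (u * p * u⁻¹) = psiU F (u * p * u⁻¹) * scalarI F ^ e * (scalarI F ^ e)⁻¹ := by group
      _ = scalarI F ^ e * psiU F (u * p * u⁻¹) * (scalarI F ^ e)⁻¹ := by rw [hc]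
      _ = _ := by simp only [map_mul, mul_assoc]
  have h2 : reflVec (k • w) = k * reflVec w * k⁻¹ := (conj_rootHom _ _ _).symm
  rw [← hk, h1, h2]
  rcases h with h | h <;> rw [h]
  · left; rw [← mul_assoc k, ← hkc.eq]; group
  · right; rw [← mul_assoc k, ← hkc.inv_left.eq]; group

lemma normSq_coord_of_isReflUnit [NeZero (2 : F)] {w : UnitVec (Fin 2) F} {p : UnitQuat F}
    (h : psiU F p = scalarI F * reflVec w ∨ psiU F p = (scalarI F)⁻¹ * reflVec w) :
    (p : ℍ[F]).re = 0 ∧ ((p : ℍ[F]).imI = 1 - 2 * normSq (w 0) ∨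
      (p : ℍ[F]).imI = -(1 - 2 * normSq (w 0))) := by
  have hr : (reflVec w).1 0 0 = ((1 - 2 * normSq (w 0) : F) : ℍ[F]) := by
    rw [reflVec_apply, normSq_mul_star]; simp [← Quaternion.coe_mul_eq_smul]
  have key : ∀ (d : UnitQuat F), psiU F p = mon 1 (fun _ => d) * reflVec w →
      psi (p : ℍ[F]) 0 0 = (d : ℍ[F]) * ((1 - 2 * normSq (w 0) : F) : ℍ[F]) := by
    intro d hd
    have := congrArg (fun A : UnitMat (Fin 2) F => A.1 0 0) hd
    change psi (p : ℍ[F]) 0 0 = ((mon (1 : Equiv.Perm (Fin 2)) (fun _ => d)).1 * (reflVec w).1) 0 0 at this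
    rw [this, Matrix.mul_apply, Fin.sum_univ_two, hr, coe_mon, coe_mon]
    simp
  rcases h with h | h
  · have h1 := key _ h
    have e1 := congrArg QuaternionAlgebra.re h1
    have e2 := congrArg QuaternionAlgebra.imI h1
    simp [psi] at e1 e2
    exact ⟨e1, Or.inl e2⟩
  · have h1 := key (unitI F)⁻¹ (by rw [h, scalarI, mon_inv]; rfl)
    have e0 : (((unitI F)⁻¹ : UnitQuat F) : ℍ[F]) = -qi := star_qi
    rw [e0] at h1
    have e1 := congrArg QuaternionAlgebra.re h1
    have e2 := congrArg QuaternionAlgebra.imI h1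
    simp [psi] at e1 e2
    exact ⟨e1, Or.inr (by rw [e2]; ring)⟩

/-- The reflection unit attached to a root whose coordinate ratio lies in `F[i]`. -/
lemma IsRoot.exists_isReflUnit {K : Subgroup (UnitMat (Fin 2) F)} {y : UnitVec (Fin 2) F}
    (hy : IsRoot K y) {a b : F} (hs : y 0 * star (y 1) = qmk a b 0 0) :
    ∃ p : UnitQuat F, IsReflUnit K p ∧
      (p : ℍ[F]) = qmk 0 (1 - 2 * normSq (y 0)) (2 * b) (-2 * a) := by
  have hsum : normSq (y 1) = 1 - (normSq (y 0) : F) := by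
    have := y.sum_normSq
    rw [Fin.sum_univ_two] at this
    linear_combination this
  have hab : a ^ 2 + b ^ 2 = normSq (y 0) * (1 - normSq (y 0)) := by
    have := congrArg (fun x : ℍ[F] => (normSq x : F)) hs
    simp only [map_mul, normSq_star, hsum] at this
    rw [this, Quaternion.normSq_def']
    simp only [qmk_re,qmk_imI,qmk_imJ,qmk_imK]; ring
  have hs' : y 1 * star (y 0) = qmk a (-b) 0 0 := by
    have := congrArg star hs
    rw [star_mul, star_star] at this
    rw [this]; ext <;> simp
  have hp : qmk 0 (1 - 2 * normSq (y 0)) (2 * b) (-2 * a) ∈ UnitQuat F := by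
    rw [mem_unitQuat]; simp
    linear_combination 4 * hab
  refine ⟨⟨_, hp⟩, ⟨y, hy, Or.inl ?_⟩, rfl⟩
  apply Subtype.ext
  ext1 p q
  change psi (qmk 0 (1 - 2 * normSq (y 0)) (2 * b) (-2 * a)) p q = ((scalarI F).1 * (reflVec y).1) p q
  rw [Matrix.mul_apply, Fin.sum_univ_two]
  simp only [scalarI, coe_mon, reflVec_apply, Matrix.one_apply]
  have h00 := normSq_mul_star (y 0)
  have h11 := normSq_mul_star (y 1)
  rw [hsum] at h11
  fin_cases p <;> fin_cases q <;> simp only [Fin.isValue, Fin.zero_eta, Fin.mk_one] <;>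
    simp only [h00, h11, hs, hs'] <;> ext <;> simp [psi] <;> ring

variable [NeZero (2 : F)] [Finite F]

/-- In rank two, if `2` is not a square, a root in general position forces a root with balanced
coordinates. -/
lemma exists_balanced_root_rank_two (hns : ¬ IsSquare (2 : F)) {K : Subgroup (UnitMat (Fin 2) F)}
    (h0 : IsRoot K (stdVec F 0)) {y : UnitVec (Fin 2) F} (hy : IsRoot K y) {a b : F}
    (hs : y 0 * star (y 1) = qmk a b 0 0) (hc0 : (normSq (y 0) : F) ≠ 0)
    (hc1 : (normSq (y 0) : F) ≠ 1) : ∃ w, IsRoot K w ∧ 2 * (normSq (w 0) : F) = 1 := by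
  have h2 := NeZero.ne (2 : F)
  by_contra hno
  have hanti : ∀ p, IsReflUnit K p → (p : ℍ[F]) * qi ≠ -(qi * (p : ℍ[F])) := by
    rintro p ⟨w, hw, h⟩ hpi
    refine hno ⟨w, hw, ?_⟩
    have h1 := (coords_of_anticomm_qi hpi).2
    rcases (normSq_coord_of_isReflUnit h).2 with h3 | h3 <;> rw [h1] at h3
    · linear_combination h3
    · linear_combination -h3
  obtain ⟨p1, hp1, hp1c⟩ := h0.exists_isReflUnit (a := 0) (b := 0) (by
    simp [stdVec_apply]; ext <;> simp)
  have hI : p1 = (unitI F)⁻¹ := by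
    apply Subtype.ext
    rw [hp1c]
    change _ = star (qi : ℍ[F])
    ext <;> simp [stdVec_apply]
    norm_num
  have hIN : unitI F ∈ psiGroup K := by
    have := (psiGroup K).inv_mem hp1.mem_psiGroup
    rwa [hI, inv_inv] at this
  obtain ⟨P, hPI, hP⟩ := exists_isMaxTwo_ge (R := Subgroup.zpowers (unitI F)) (N := psiGroup K)
    (isPGroup_quatGroup.to_le (by rw [Subgroup.zpowers_le]; exact unitI_mem))
    (by rw [Subgroup.zpowers_le]; exact hIN)
  rw [Subgroup.zpowers_le] at hPI
  have hPfix : ∀ p ∈ P, IsReflUnit K p → (p : ℍ[F]) = qi ∨ (p : ℍ[F]) = -qi := by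
    intro p hp hpr
    have h1 := (hP.isPGroup.comm_up_to_sign hns hp hPI).resolve_right (hanti p hpr)
    obtain ⟨h3, h4⟩ := coords_of_comm_qi h1
    have h5 : (p : ℍ[F]).re = 0 := by
      obtain ⟨w, _, h⟩ := hpr
      exact (normSq_coord_of_isReflUnit h).1
    have hn := mem_unitQuat.1 p.2
    rw [h3, h4, h5] at hn
    have hn' : (p : ℍ[F]).imI ^ 2 = 1 := by linear_combination hn
    rcases sq_eq_one_iff.1 hn' with h6 | h6
    · left; ext <;> simp [*]
    · right; ext <;> simp [*]
  have hIr : IsReflUnit K (unitI F)⁻¹ := hI ▸ hp1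
  have hZ := hP.conjQ_constraint (fun x hx hxP p hp => by
    refine hP.isPGroup.commutator_mem_signGroup hns hPI hxP ?_ hp
    have h3 := hPfix _ (hxP _ (P.inv_mem hPI)) (hIr.conj hx)
    rw [← conjQ_coe] at h3
    have h4 : (((unitI F)⁻¹ : UnitQuat F) : ℍ[F]) = -qi := star_qi
    rw [h4, map_neg] at h3
    have h5 : (x : ℍ[F]) * qi = conjQ x qi * (x : ℍ[F]) := by
      rw [conjQ_apply, mul_assoc]
      have : star (x : ℍ[F]) * (x : ℍ[F]) = 1 := UnitQuat.coe_inv_mul x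
      rw [this, mul_one]
    rw [h5]
    rcases h3 with h3 | h3
    · right; rw [neg_eq_iff_eq_neg.1 h3, neg_mul]
    · left; rw [neg_inj.1 h3]) hPI (by simp)
  have hconj : ∀ p, IsReflUnit K p → ∃ x ∈ psiGroup K, (p : ℍ[F]) = conjQ x qi ∨ (p : ℍ[F]) = - conjQ x qi := by
    intro p hp
    obtain ⟨x, hx, hxP⟩ := hP.exists_conj (R := Subgroup.zpowers p) (by
      have hre : (p : ℍ[F]).re = 0 := by
        obtain ⟨w, _, h⟩ := hp
        exact (normSq_coord_of_isReflUnit h).1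
      rintro ⟨_, n, rfl⟩
      refine ⟨2, Subtype.ext ?_⟩
      change (p ^ n) ^ 4 = 1
      have h4 : p ^ 4 = 1 := by
        have h5 : p * p = -1 := Subtype.ext (sq_coe_eq_neg_one hre)
        calc p ^ 4 = (p * p) * (p * p) := by rw [← pow_two, ← pow_two, ← pow_mul]
          _ = 1 := by rw [h5]; simp
      rw [← _root_.zpow_natCast, ← _root_.zpow_mul, mul_comm, _root_.zpow_mul, _root_.zpow_natCast, h4, _root_.one_zpow])
      (by rw [Subgroup.zpowers_le]; exact hp.mem_psiGroup)
    refine ⟨x⁻¹, (psiGroup K).inv_mem hx, ?_⟩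
    have h3 := hPfix _ (hxP p (Subgroup.mem_zpowers p)) (hp.conj hx)
    rw [← conjQ_coe] at h3
    have h4 : (p : ℍ[F]) = conjQ x⁻¹ (conjQ x p) := by simp
    rcases h3 with h3 | h3 <;> rw [h3] at h4
    · exact Or.inl h4
    · right; rw [h4, map_neg]
  obtain ⟨p2, hp2, hp2c⟩ := hy.exists_isReflUnit hs
  have hsum : normSq (y 1) = 1 - (normSq (y 0) : F) := by
    have := y.sum_normSq
    rw [Fin.sum_univ_two] at this
    linear_combination this
  have hab : a ^ 2 + b ^ 2 = normSq (y 0) * (1 - normSq (y 0)) := by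
    have := congrArg (fun x : ℍ[F] => (normSq x : F)) hs
    simp only [map_mul, normSq_star, hsum] at this
    rw [this, Quaternion.normSq_def']
    simp only [qmk_re,qmk_imI,qmk_imJ,qmk_imK]; ring
  have hab0 : a ^ 2 + b ^ 2 ≠ 0 := by
    rw [hab]; exact mul_ne_zero hc0 (sub_ne_zero.2 hc1.symm)
  have e0 : ∀ p, (rootHom (stdVec F (0 : Fin 2)) (unitI F) • y) p = if p = 0 then qi * y 0 else y p := by
    intro p
    rw [rootHom_smul_apply, stdVec_apply]
    have : star (stdVec F (0 : Fin 2)).val ⬝ᵥ y.val = y 0 := by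
      simp [dotProduct, stdVec_apply]
    rw [this]
    by_cases hp : p = 0
    · subst hp; simp [sub_mul]
    · simp [hp]
  have hnI : normSq (qi : ℍ[F]) = (1 : F) := by rw [Quaternion.normSq_def']; simp
  obtain ⟨p3, hp3, hp3c⟩ := (hy.smul (h0 _ unitI_mem)).exists_isReflUnit (a := -b) (b := a) (by
    rw [e0, e0]; simp only [if_true, Fin.isValue, one_ne_zero, if_false]
    rw [mul_assoc, hs]; ext <;> simp)
  rw [e0, if_pos rfl, map_mul, hnI, one_mul] at hp3c
  obtain ⟨-, n, hn0, hnre, hn | hn⟩ := hZ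
  · have horth : ∀ p, IsReflUnit K p → ((p : ℍ[F]) * n).re = 0 := by
      intro p hp
      obtain ⟨x, hx, h | h⟩ := hconj p hp <;> rw [h]
      · exact hn x hx
      · rw [neg_mul, Quaternion.re_neg, neg_eq_zero]; exact hn x hx
    have o1 := horth _ hIr
    have o2 := horth _ hp2
    have o3 := horth _ hp3
    rw [show (((unitI F)⁻¹ : UnitQuat F) : ℍ[F]) = -qi from star_qi] at o1
    rw [hp2c] at o2
    rw [hp3c] at o3
    simp [hnre] at o1 o2 o3
    rw [o1] at o2 o3
    apply hn0
    have hJ : n.imJ = 0 := by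
      have : 2 * (a ^ 2 + b ^ 2) * n.imJ = 0 := by linear_combination -b * o2 - a * o3
      simpa [h2, hab0] using this
    have hK : n.imK = 0 := by
      have : 2 * (a ^ 2 + b ^ 2) * n.imK = 0 := by linear_combination a * o2 - b * o3
      simpa [h2, hab0] using this
    ext <;> simp [*]
  · have hcol : ∀ p, IsReflUnit K p → ∃ c : F, (p : ℍ[F]) = c • n := by
      intro p hp
      obtain ⟨x, hx, h | h⟩ := hconj p hp <;> obtain ⟨c, hc⟩ := hn x hx <;> rw [coe_unitI] at hc <;>
        rw [h, hc]
      · exact ⟨c, rfl⟩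
      · exact ⟨-c, (neg_smul c n).symm⟩
    obtain ⟨c1, hc1'⟩ := hcol _ hIr
    obtain ⟨c2, hc2⟩ := hcol _ hp2
    rw [show (((unitI F)⁻¹ : UnitQuat F) : ℍ[F]) = -qi from star_qi] at hc1'
    rw [hp2c] at hc2
    have e1 := congrArg QuaternionAlgebra.imI hc1'
    have e2 := congrArg QuaternionAlgebra.imJ hc1'
    have e3 := congrArg QuaternionAlgebra.imK hc1'
    have e4 := congrArg QuaternionAlgebra.imJ hc2
    have e5 := congrArg QuaternionAlgebra.imK hc2
    simp only [Quaternion.imI_neg, Quaternion.imJ_neg, Quaternion.imK_neg, Quaternion.imI_smul,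
      Quaternion.imJ_smul, Quaternion.imK_smul, qi_imI, qi_imJ, qi_imK, qmk_imJ, qmk_imK,
      smul_eq_mul, neg_zero] at e1 e2 e3 e4 e5
    have hc10 : c1 ≠ 0 := by
      rintro rfl
      simp at e1
    have hJ : n.imJ = 0 := by simpa [hc10] using e2.symm
    have hK : n.imK = 0 := by simpa [hc10] using e3.symm
    rw [hJ, mul_zero] at e4
    rw [hK, mul_zero] at e5
    have hb : b = 0 := by simpa [h2] using e4
    have ha : a = 0 := by simpa [h2] using e5
    apply hab0
    rw [ha, hb]; ring

end Rank2

section PairMat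

open Quaternion Matrix

variable {F : Type*} [Field F] {ι κ : Type*} [Fintype ι] [DecidableEq ι] [Fintype κ] [DecidableEq κ]

lemma mul_eq_zero_iff_of_normSq {u : ℍ[F]} (hu : (normSq u : F) ≠ 0) (x : ℍ[F]) :
    x * u = 0 ↔ x = 0 := by
  refine ⟨fun h => ?_, fun h => by rw [h, zero_mul]⟩
  have h1 : x * u * star u = 0 := by rw [h, zero_mul]
  rw [mul_assoc, normSq_mul_star, ← Quaternion.coe_commutes, Quaternion.coe_mul_eq_smul] at h1
  exact (smul_eq_zero.1 h1).resolve_left hu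

lemma star_mul_mul_star_mul (h s : ℍ[F]) :
    star h * s * (star s * h) = ((normSq h * normSq s : F) : ℍ[F]) := by
  rw [mul_assoc, ← mul_assoc s, normSq_mul_star, ← mul_assoc, ← Quaternion.coe_commutes, mul_assoc,
    Quaternion.star_mul_self, mul_comm, ← Quaternion.coe_mul]

/-- A vector whose coordinate norms add up to one is a unit vector. -/
def UnitVec.ofNormSq (v : ι → ℍ[F]) (hv : ∑ p, (normSq (v p) : F) = 1) : UnitVec ι F :=
  ⟨v, by
    simp only [dotProduct, Pi.star_apply, Quaternion.star_mul_self]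
    rw [← Quaternion.coe_one, ← hv]
    exact (map_sum (algebraMap F ℍ[F]) _ _).symm⟩

/-- The matrix with two given orthogonal columns. -/
def pairMat (u v : UnitVec ι F) : Matrix ι (Fin 2) ℍ[F] := Matrix.of fun p => ![u p, v p]

lemma pairMat_unitary {u v : UnitVec ι F} (h : star u.val ⬝ᵥ v.val = 0) :
    (pairMat u v)ᴴ * pairMat u v = 1 := by
  have h' : star v.val ⬝ᵥ u.val = 0 := by
    have := congrArg star h
    rw [← star_dotProduct_star, star_star, star_zero] at this
    rw [← this]
  ext1 a b
  rw [Matrix.mul_apply]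
  fin_cases a <;> fin_cases b
  · exact u.2
  · exact h
  · exact h'
  · exact v.2

lemma embVec_pairMat {u v : UnitVec ι F} (h : star u.val ⬝ᵥ v.val = 0) (w : UnitVec (Fin 2) F) (p : ι) :
    (w.embVec (pairMat u v) (pairMat_unitary h)) p = u p * w 0 + v p * w 1 := by
  change (pairMat u v *ᵥ w.val) p = _
  rw [Matrix.mulVec, dotProduct, Fin.sum_univ_two]
  rfl

lemma isRoot_comap_emb (M : Matrix ι κ ℍ[F]) (hM : Mᴴ * M = 1) {K : Subgroup (UnitMat ι F)}
    {w : UnitVec κ F} : IsRoot (K.comap (emb M hM)) w ↔ IsRoot K (w.embVec M hM) := by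
  simp only [IsRoot, Subgroup.mem_comap, emb_rootHom]

lemma star_stdVec_dotProduct (l : ι) (v : ι → ℍ[F]) : star (stdVec F l).val ⬝ᵥ v = v l := by
  simp [dotProduct, stdVec_apply, Pi.star_apply, apply_ite]

lemma reflVec_smul_stdVec (w : UnitVec ι F) (l p : ι) :
    (reflVec w • stdVec F l) p = (if p = l then 1 else 0) - (2 : F) • (w p * star (w l)) := by
  rw [smul_stdVec_apply, reflVec_apply, Matrix.one_apply]

variable [NeZero (2 : F)] [Finite F]

/-- If `2` is not a square, a root with a coordinate in general position forces a root with that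
coordinate balanced. -/
lemma exists_balanced_root (hns : ¬ IsSquare (2 : F)) {K : Subgroup (UnitMat ι F)} {l : ι}
    (h0 : IsRoot K (stdVec F l)) {y : UnitVec ι F} (hy : IsRoot K y)
    (hc0 : (normSq (y l) : F) ≠ 0) (hc1 : (normSq (y l) : F) ≠ 1) :
    ∃ w, IsRoot K w ∧ 2 * (normSq (w l) : F) = 1 ∧ ∀ p ≠ l, (w p = 0 ↔ y p = 0) := by
  obtain ⟨c, hc⟩ : ∃ c, c = (normSq (y l) : F) := ⟨_, rfl⟩
  rw [← hc] at hc0 hc1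
  have hd0 : 1 - c ≠ 0 := sub_ne_zero.2 hc1.symm
  obtain ⟨a, b, hab⟩ : ∃ a b : F, a ^ 2 + b ^ 2 = c * (1 - c) := by
    have := Fintype.ofFinite F
    obtain ⟨a, b, h⟩ := FiniteField.exists_root_sum_quadratic
      (f := (Polynomial.X ^ 2 : Polynomial F)) (g := Polynomial.X ^ 2 - Polynomial.C (c * (1 - c)))
      (Polynomial.degree_X_pow 2) (Polynomial.degree_X_pow_sub_C (by decide) _)
      (FiniteField.odd_card_of_char_ne_two (fun h => NeZero.ne (2 : F) (by
        have : CharP F 2 := ringChar.of_eq h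
        exact CharTwo.two_eq_zero)))
    refine ⟨a, b, ?_⟩
    rw [← sub_eq_zero]
    simpa [add_sub_assoc] using h
  obtain ⟨s, hs⟩ : ∃ s : ℍ[F], s = qmk a b 0 0 := ⟨_, rfl⟩
  have hns' : (normSq s : F) = c * (1 - c) := by
    rw [hs, Quaternion.normSq_def', ← hab]; simp
  obtain ⟨h, hh⟩ : ∃ h, h = y l := ⟨_, rfl⟩
  have hu : (normSq (star h * s) : F) = c * (c * (1 - c)) := by
    rw [map_mul, Quaternion.normSq_star, hns', hh, ← hc]
  have hu0 : (normSq (star h * s) : F) ≠ 0 := by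
    rw [hu]; exact mul_ne_zero hc0 (mul_ne_zero hc0 hd0)
  let x : UnitVec ι F := UnitVec.ofNormSq
    (fun p => if p = l then 0 else (c * (1 - c))⁻¹ • (y p * (star h * s))) (by
      have h1 : ∀ p, (normSq (if p = l then 0 else (c * (1 - c))⁻¹ • (y p * (star h * s))) : F) =
          (1 - c)⁻¹ * (normSq (y p) - if p = l then c else 0) := by
        intro p
        split_ifs with hp
        · rw [hp, ← hc]; simp
        · rw [Quaternion.normSq_smul, map_mul, hu]
          field_simp
          simp
      rw [Finset.sum_congr rfl fun p _ => h1 p, ← Finset.mul_sum, Finset.sum_sub_distrib,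
        y.sum_normSq, Finset.sum_ite_eq']
      simp [hd0])
  have hx : ∀ p, x p = if p = l then 0 else (c * (1 - c))⁻¹ • (y p * (star h * s)) := fun p => rfl
  have horth : star (stdVec F l).val ⬝ᵥ x.val = 0 := by
    rw [star_stdVec_dotProduct, hx, if_pos rfl]
  let z : UnitVec (Fin 2) F := UnitVec.ofNormSq ![h, c⁻¹ • (star s * h)] (by
    rw [Fin.sum_univ_two]
    simp only [Matrix.cons_val_zero, Matrix.cons_val_one]
    rw [Quaternion.normSq_smul, map_mul, Quaternion.normSq_star, hns', hh, ← hc]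
    field_simp
    ring)
  have hz0 : z 0 = h := rfl
  have hz1 : z 1 = c⁻¹ • (star s * h) := rfl
  have hzy : z.embVec _ (pairMat_unitary horth) = y := by
    ext1 p
    rw [embVec_pairMat horth, hz0, hz1, stdVec_apply, hx]
    split_ifs with hp
    · rw [hp, hh]; simp
    · rw [zero_mul, zero_add, smul_mul_smul_comm, mul_assoc, star_mul_mul_star_mul, hns', hh, ← hc,
        ← Quaternion.coe_commutes, Quaternion.coe_mul_eq_smul, smul_smul]
      have : (c * (1 - c))⁻¹ * c⁻¹ * (c * (c * (1 - c))) = 1 := by field_simp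
      rw [this, one_smul]
  have he : (stdVec F (0 : Fin 2)).embVec _ (pairMat_unitary horth) = stdVec F l := by
    ext1 p
    rw [embVec_pairMat horth]; simp [stdVec_apply]
  obtain ⟨w, hw, hwn⟩ := exists_balanced_root_rank_two hns
    (K := K.comap (emb _ (pairMat_unitary horth))) (y := z) (a := a) (b := b)
    (by rw [isRoot_comap_emb, he]; exact h0) (by rw [isRoot_comap_emb, hzy]; exact hy)
    (by
      rw [hz0, hz1]
      rw [Quaternion.star_smul, star_mul, star_star, mul_smul_comm, ← mul_assoc, normSq_mul_star, hh,
        ← hc, Quaternion.coe_mul_eq_smul, smul_smul, inv_mul_cancel₀ hc0, one_smul, hs])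
    (by rw [hz0, hh, ← hc]; exact hc0) (by rw [hz0, hh, ← hc]; exact hc1)
  have hw1 : (normSq (w 1) : F) ≠ 0 := by
    intro h1
    have := w.sum_normSq
    rw [Fin.sum_univ_two, h1, add_zero] at this
    rw [this] at hwn
    have h3 : (1 : F) = 0 := by linear_combination hwn
    exact one_ne_zero h3
  refine ⟨_, (isRoot_comap_emb _ _).1 hw, ?_, fun p hp => ?_⟩
  · rw [embVec_pairMat horth, hx, if_pos rfl, stdVec_apply, if_pos rfl, one_mul, zero_mul, add_zero, hwn]
  · rw [embVec_pairMat horth, hx, if_neg hp, stdVec_apply, if_neg hp, zero_mul, zero_add,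
      mul_eq_zero_iff_of_normSq hw1, smul_eq_zero, mul_eq_zero_iff_of_normSq hu0,
      or_iff_right (inv_ne_zero (mul_ne_zero hc0 hd0))]

end PairMat

section Linked

open Quaternion Matrix

variable {F : Type*} [Field F] {ι : Type*} [Fintype ι] [DecidableEq ι]

/-- Two indices are linked by `K` if `K` has a balanced root supported on them. -/
def Linked (K : Subgroup (UnitMat ι F)) (l m : ι) : Prop :=
  l ≠ m ∧ ∃ z, IsRoot K z ∧ (∀ p, p ≠ l → p ≠ m → z p = 0) ∧ 2 * (normSq (z l) : F) = 1 ∧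
    2 * (normSq (z m) : F) = 1

lemma Linked.symm {K : Subgroup (UnitMat ι F)} {l m : ι} (h : Linked K l m) : Linked K m l := by
  obtain ⟨h1, z, hz, h2, h3, h4⟩ := h
  exact ⟨h1.symm, z, hz, fun p hp hp' => h2 p hp' hp, h4, h3⟩

lemma reflVec_smul_apply (w v : UnitVec ι F) (p : ι) :
    (reflVec w • v) p = v p - (2 : F) • (w p * (star w.val ⬝ᵥ v.val)) := by
  rw [reflVec, rootHom_smul_apply]
  have : (((-1 : UnitQuat F) : ℍ[F]) - 1) = -((2 : F) : ℍ[F]) := by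
    rw [show ((-1 : UnitQuat F) : ℍ[F]) = -1 from rfl]
    ext <;> simp
    norm_num
  rw [this, mul_neg, neg_mul, ← sub_eq_add_neg, ← Quaternion.coe_commutes, mul_assoc,
    Quaternion.coe_mul_eq_smul]

lemma normSq_two_smul (x y : ℍ[F]) (hx : 2 * (normSq x : F) = 1) :
    (normSq ((2 : F) • (x * y)) : F) = 2 * normSq y := by
  rw [Quaternion.normSq_smul, map_mul]
  linear_combination (2 * normSq y) * hx

lemma sub_two_smul_eq_zero {x : ℍ[F]} (hx : 2 * (normSq x : F) = 1) (y : ℍ[F]) :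
    y - (2 : F) • (x * (star x * y)) = 0 := by
  rw [← mul_assoc, normSq_mul_star, Quaternion.coe_mul_eq_smul, smul_smul, hx, one_smul, sub_self]

lemma Linked.trans {K : Subgroup (UnitMat ι F)} {l m n : ι} (h : Linked K l m) (h' : Linked K m n)
    (hln : l ≠ n) : Linked K l n := by
  obtain ⟨hlm, z, hz, hz0, hzl, hzm⟩ := h
  obtain ⟨hmn, z', hz', hz'0, hz'm, hz'n⟩ := h'
  have hdot : star z.val ⬝ᵥ z'.val = star (z m) * z' m := by
    rw [dotProduct, Finset.sum_eq_single m]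
    · rfl
    · intro p _ hp
      by_cases hpn : p = n
      · rw [Pi.star_apply, hz0 p (by rw [hpn]; exact hln.symm) hp, star_zero, zero_mul]
      · rw [hz'0 p hp hpn, mul_zero]
    · simp
  refine ⟨hln, _, hz'.smul hz.reflVec_mem, fun p hpl hpn => ?_, ?_, ?_⟩
  · rw [reflVec_smul_apply, hdot]
    by_cases hpm : p = m
    · rw [hpm]; exact sub_two_smul_eq_zero hzm _
    · rw [hz'0 p hpm hpn, hz0 p hpl hpm, zero_mul, smul_zero, sub_zero]
  · rw [reflVec_smul_apply, hdot, hz'0 l hlm hln, zero_sub, Quaternion.normSq_neg,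
      normSq_two_smul _ _ hzl, map_mul, Quaternion.normSq_star]
    linear_combination 2 * normSq (z' m) * hzm + hz'm
  · rw [reflVec_smul_apply, hdot, hz0 n hln.symm hmn.symm, zero_mul, smul_zero, sub_zero, hz'n]

/-- All indices in the support of `y` are linked. -/
def SuppLinked (K : Subgroup (UnitMat ι F)) (y : UnitVec ι F) : Prop :=
  ∀ l m, y l ≠ 0 → y m ≠ 0 → l ≠ m → Linked K l m

lemma normSq_unit (u : UnitQuat F) : (normSq (u : ℍ[F]) : F) = 1 := by
  rw [Quaternion.normSq_def', mem_unitQuat.1 u.2]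

variable [NeZero (2 : F)] [Finite F]

lemma suppLinked_of_normSq (hns : ¬ IsSquare (2 : F)) {K : Subgroup (UnitMat ι F)}
    (hK : ∀ l : ι, IsRoot K (stdVec F l)) {n : ℕ}
    (IH : ∀ y, IsRoot K y → {p | y p ≠ 0}.ncard < n → SuppLinked K y)
    {y : UnitVec ι F} (hy : IsRoot K y) (hn : {p | y p ≠ 0}.ncard ≤ n) {l : ι}
    (hc0 : (normSq (y l) : F) ≠ 0) (hc1 : (normSq (y l) : F) ≠ 1) : SuppLinked K y := by
  have h2 := NeZero.ne (2 : F)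
  obtain ⟨w, hw, hwl, hwy⟩ := exists_balanced_root hns (hK l) hy hc0 hc1
  have hyl : y l ≠ 0 := fun h => hc0 (by rw [h, map_zero])
  have hwl0 : (normSq (w l) : F) ≠ 0 := fun h => by simp [h] at hwl
  obtain ⟨x, hx⟩ : ∃ x, x = reflVec w • stdVec F l := ⟨_, rfl⟩
  have hxr : IsRoot K x := hx ▸ (hK l).smul hw.reflVec_mem
  have hxl : x l = 0 := by
    have := sub_two_smul_eq_zero hwl 1
    rw [mul_one] at this
    rw [hx, reflVec_smul_stdVec, if_pos rfl]
    exact this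
  have hxp : ∀ p ≠ l, x p = -((2 : F) • (w p * star (w l))) := fun p hp => by
    rw [hx, reflVec_smul_stdVec, if_neg hp, zero_sub]
  have hxy : ∀ p ≠ l, (x p = 0 ↔ y p = 0) := fun p hp => by
    rw [hxp p hp, neg_eq_zero, smul_eq_zero, or_iff_right h2, mul_eq_zero_iff_of_normSq
      (by rwa [Quaternion.normSq_star]), hwy p hp]
  have hwx : ∀ p, w p = stdVec F l p * w l - x p * w l := fun p => by
    rw [stdVec_apply]
    by_cases hp : p = l
    · rw [if_pos hp, hp, hxl]; simp
    · rw [if_neg hp, hxp p hp, zero_mul, zero_sub, neg_mul, neg_neg, smul_mul_assoc, mul_assoc,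
        Quaternion.star_mul_self, ← Quaternion.coe_commutes, Quaternion.coe_mul_eq_smul, smul_smul,
        hwl, one_smul]
  have hxL : SuppLinked K x := by
    refine IH x hxr (lt_of_lt_of_le (Set.ncard_lt_ncard ?_) hn)
    refine ⟨fun p hp => ?_, fun h => h hyl hxl⟩
    have hpl : p ≠ l := by rintro rfl; exact hp hxl
    exact fun h => hp ((hxy p hpl).2 h)
  obtain ⟨k, hk, hkD, m, hm, u, hkm⟩ := hxr.exists_smul_eq_stdVec (D := {p | x p ≠ 0})
    (fun p hp => by simpa using hp) (fun m _ => hK m)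
  have hml : m ≠ l := by rintro rfl; exact hm hxl
  have hkw : ∀ p, (k • w) p = stdVec F l p * w l - (stdVec F m).rsmul u p * w l := fun p => by
    rw [← hkm]
    nth_rewrite 1 [← hkD l (by simpa using hxl)]
    simp only [UnitVec.coe_smul, Matrix.mulVec, dotProduct]
    rw [Finset.sum_mul, Finset.sum_mul, ← Finset.sum_sub_distrib]
    exact Finset.sum_congr rfl fun q _ => by rw [hwx q, mul_sub, mul_assoc, mul_assoc]
  have hlm : Linked K l m := by
    refine ⟨hml.symm, _, hw.smul hk, fun p hpl hpm => ?_, ?_, ?_⟩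
    · rw [hkw, UnitVec.rsmul_apply, stdVec_apply, stdVec_apply, if_neg hpl, if_neg hpm]; simp
    · rw [hkw, UnitVec.rsmul_apply, stdVec_apply, stdVec_apply, if_pos rfl, if_neg hml.symm]
      simpa using hwl
    · rw [hkw, UnitVec.rsmul_apply, stdVec_apply, stdVec_apply, if_neg hml, if_pos rfl, one_mul,
        zero_mul, zero_sub, Quaternion.normSq_neg, map_mul, normSq_unit, one_mul, hwl]
  have hl : ∀ p, y p ≠ 0 → p ≠ l → Linked K l p := by
    intro p hp hpl
    by_cases hpm : p = m
    · rw [hpm]; exact hlm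
    · exact hlm.trans (hxL m p hm (fun h => hp ((hxy p hpl).1 h)) (Ne.symm hpm)) hpl.symm
  intro p q hp hq hpq
  by_cases h1 : p = l
  · rw [h1]; exact hl q hq (h1 ▸ hpq.symm)
  by_cases h3 : q = l
  · rw [h3]; exact (hl p hp h1).symm
  exact hxL p q (fun h => hp ((hxy p h1).1 h)) (fun h => hq ((hxy q h3).1 h)) hpq

end Linked

section Support

open Quaternion Matrix

variable {F : Type*} [Field F] {ι : Type*} [Fintype ι] [DecidableEq ι]

lemma star_mul_mul_re (y : ℍ[F]) {q : ℍ[F]} (hq : q.re = 0) : (star y * q * y).re = 0 := by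
  simp [hq]; ring

lemma exists_star_mul_mul_ne_zero [NeZero (2 : F)] {y : ℍ[F]} (hy : y ≠ 0) :
    ∃ q : ℍ[F], (q = qi ∨ q = qj ∨ q = qk) ∧ star y * q * y ≠ 0 := by
  have h2 := NeZero.ne (2 : F)
  by_contra! h
  have hi := h qi (by simp)
  have hj := h qj (by simp)
  have hk := h qk (by simp)
  have i1 := congrArg QuaternionAlgebra.imI hi
  have i2 := congrArg QuaternionAlgebra.imJ hi
  have i3 := congrArg QuaternionAlgebra.imK hi
  have j1 := congrArg QuaternionAlgebra.imI hj
  have j2 := congrArg QuaternionAlgebra.imJ hj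
  have j3 := congrArg QuaternionAlgebra.imK hj
  have k1 := congrArg QuaternionAlgebra.imI hk
  have k2 := congrArg QuaternionAlgebra.imJ hk
  have k3 := congrArg QuaternionAlgebra.imK hk
  simp at i1 i2 i3 j1 j2 j3 k1 k2 k3
  have e1 : y.re ^ 2 = y.imI ^ 2 := mul_left_cancel₀ h2 (by linear_combination j2 + k3)
  have e2 : y.re ^ 2 = y.imJ ^ 2 := mul_left_cancel₀ h2 (by linear_combination i1 + k3)
  have e3 : y.re ^ 2 = y.imK ^ 2 := mul_left_cancel₀ h2 (by linear_combination i1 + j2)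
  have e4 : y.re * y.imI = 0 :=
    (mul_eq_zero.1 (show (4 : F) * (y.re * y.imI) = 0 by linear_combination k2 - j3)).resolve_left (by
      rw [show (4 : F) = 2 * 2 by norm_num]; exact mul_ne_zero h2 h2)
  have hr : y.re = 0 := by
    rcases mul_eq_zero.1 e4 with h | h
    · exact h
    · rw [h] at e1; simpa using e1
  rw [hr] at e1 e2 e3
  apply hy
  ext
  · exact hr
  · simpa using e1.symm
  · simpa using e2.symm
  · simpa using e3.symm

lemma exists_re_ne_zero {y β : ℍ[F]} (hy : (normSq y : F) = 1) (hβ : β ≠ 0) (hβ0 : β.re = 0) :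
    ∃ q : ℍ[F], (q = qi ∨ q = qj ∨ q = qk) ∧ (star y * q * y * β).re ≠ 0 := by
  by_contra! h
  have hre : ∀ q : ℍ[F], (star y * q * y * β).re = (q * (y * β * star y)).re := by
    intro q; simp; ring
  have hi := h qi (by simp)
  have hj := h qj (by simp)
  have hk := h qk (by simp)
  rw [hre] at hi hj hk
  have h0 : (y * β * star y).re = 0 := by simp [hβ0]; ring
  obtain ⟨z, hz⟩ : ∃ z, z = y * β * star y := ⟨_, rfl⟩
  rw [← hz] at hi hj hk h0
  simp at hi hj hk
  have hz0 : z = 0 := by ext <;> assumption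
  apply hβ
  have : star y * z * y = β := by
    rw [hz]
    have h1 : star y * y = 1 := by rw [Quaternion.star_mul_self, hy, Quaternion.coe_one]
    rw [mul_assoc y, ← mul_assoc, h1, one_mul, mul_assoc, h1, mul_one]
  rw [← this, hz0]; simp

lemma normSq_aux {α β : ℍ[F]} {c : F} (hα0 : α.re = 0) (hβ0 : β.re = 0)
    (hα : (normSq α : F) = 1) (hβ : (normSq β : F) = c ^ 2) :
    (normSq (1 - (2 : F) • (α * (((-c : F) : ℍ[F]) - α - β))) : F) =
      1 - 4 * (α * β).re + 8 * c ^ 2 := by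
  rw [Quaternion.normSq_def'] at hα hβ ⊢
  simp [hα0, hβ0] at hα hβ ⊢
  linear_combination (4 * c ^ 2 + 4 * (β.imI ^ 2 + β.imJ ^ 2 + β.imK ^ 2) +
    4 * (α.imI ^ 2 + α.imJ ^ 2 + α.imK ^ 2) +
    8 * (α.imI * β.imI + α.imJ * β.imJ + α.imK * β.imK)) * hα + 4 * hβ

variable [NeZero (2 : F)]

lemma exists_sign_choice (hns : ¬ IsSquare (2 : F)) {c t : F} (hc : c = 0 ∨ c = 1) (ht : t ≠ 0) :
    (1 + 4 * t + 8 * c ^ 2 ≠ 0 ∧ 1 + 4 * t + 8 * c ^ 2 ≠ 1) ∨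
      (1 - 4 * t + 8 * c ^ 2 ≠ 0 ∧ 1 - 4 * t + 8 * c ^ 2 ≠ 1) := by
  have h2 := NeZero.ne (2 : F)
  have h17 : (17 : F) ≠ 0 := fun h => hns ⟨6, by linear_combination (-2) * h⟩
  have h2t : 2 * t ≠ 0 := mul_ne_zero h2 ht
  have h4t : 4 * t ≠ 0 := by
    rw [show (4 : F) * t = 2 * (2 * t) by ring]; exact mul_ne_zero h2 h2t
  have h8t : 8 * t ≠ 0 := by
    rw [show (8 : F) * t = 2 * (4 * t) by ring]; exact mul_ne_zero h2 h4t
  by_contra! h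
  obtain ⟨h, h'⟩ := h
  rcases hc with rfl | rfl
  · by_cases e : 1 + 4 * t + 8 * (0 : F) ^ 2 = 0
    · by_cases e' : 1 - 4 * t + 8 * (0 : F) ^ 2 = 0
      · exact h8t (by linear_combination e - e')
      · exact h4t (by linear_combination - h' e')
    · exact h4t (by linear_combination h e)
  · by_cases e : 1 + 4 * t + 8 * (1 : F) ^ 2 = 0
    · by_cases e' : 1 - 4 * t + 8 * (1 : F) ^ 2 = 0
      · exact h8t (by linear_combination e - e')
      · exact h17 (by linear_combination e + h' e')
    · by_cases e' : 1 - 4 * t + 8 * (1 : F) ^ 2 = 0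
      · exact h17 (by linear_combination e' + h e)
      · exact h8t (by linear_combination h e - h' e')

lemma normSq_eq_one_of_basis {q : ℍ[F]} (h : q = qi ∨ q = qj ∨ q = qk) : (normSq q : F) = 1 := by
  rw [Quaternion.normSq_def']
  rcases h with rfl | rfl | rfl <;> simp

lemma re_eq_zero_of_basis {q : ℍ[F]} (h : q = qi ∨ q = qj ∨ q = qk) : q.re = 0 := by
  rcases h with rfl | rfl | rfl <;> simp

lemma isQ8_of_basis {q : ℍ[F]} (h : q = qi ∨ q = qj ∨ q = qk) : IsQ8 q := by
  rcases h with rfl | rfl | rfl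
  · exact isQ8_qi
  · exact isQ8_qj
  · exact isQ8_qk

/-- The action of two coordinate root elements on a unit vector, reflected. -/
lemma reflVec_twist_apply {y : UnitVec ι F} {a b : ι} (hab : a ≠ b) {q r : UnitQuat F}
    (hq : (q : ℍ[F]).re = 0) (hr : (r : ℍ[F]).re = 0) (p : ι) :
    (reflVec (rootHom (stdVec F a) q • rootHom (stdVec F b) r • y) • y) p =
      y p - (2 : F) • ((if p = a then (q : ℍ[F]) * y a else if p = b then (r : ℍ[F]) * y b else y p) *
        (((1 - normSq (y a) - normSq (y b) : F) : ℍ[F]) - star (y a) * q * y a -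
          star (y b) * r * y b)) := by
  have e0 : ∀ (v : UnitVec ι F) (l : ι) (s : UnitQuat F) (p : ι),
      (rootHom (stdVec F l) s • v) p = if p = l then (s : ℍ[F]) * v l else v p := by
    intro v l s p
    rw [rootHom_smul_apply, star_stdVec_dotProduct, stdVec_apply]
    split_ifs with hp
    · rw [hp]; noncomm_ring
    · simp
  have e1 : ∀ p, (rootHom (stdVec F a) q • rootHom (stdVec F b) r • y) p =
      if p = a then (q : ℍ[F]) * y a else if p = b then (r : ℍ[F]) * y b else y p := by
    intro p
    rw [e0, e0, if_neg hab]
    split_ifs <;> simp_all [e0]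
  have hstar : ∀ s : ℍ[F], s.re = 0 → star s = -s := by
    intro s hs; ext <;> simp [hs]
  rw [reflVec_smul_apply, e1]
  congr 3
  have e2 : ∀ p, star ((rootHom (stdVec F a) q • rootHom (stdVec F b) r • y) p) * y p =
      ((normSq (y p) : F) : ℍ[F]) + (if p = a then -((normSq (y a) : F) : ℍ[F]) - star (y a) * q * y a else 0)
        + (if p = b then -((normSq (y b) : F) : ℍ[F]) - star (y b) * r * y b else 0) := by
    intro p
    rw [e1]
    by_cases hpa : p = a
    · rw [if_pos hpa, if_pos hpa, if_neg (by rw [hpa]; exact hab), star_mul, hstar _ hq, hpa]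
      noncomm_ring
    · rw [if_neg hpa, if_neg hpa]
      by_cases hpb : p = b
      · rw [if_pos hpb, if_pos hpb, star_mul, hstar _ hr, hpb]
        noncomm_ring
      · rw [if_neg hpb, if_neg hpb, Quaternion.star_mul_self, add_zero, add_zero]
  have e3 : ∑ p, ((normSq (y p) : F) : ℍ[F]) = 1 := by
    rw [← Quaternion.coe_one, ← y.sum_normSq]
    exact (map_sum (algebraMap F ℍ[F]) _ _).symm
  change ∑ p, star ((rootHom (stdVec F a) q • rootHom (stdVec F b) r • y) p) * y p = _
  rw [Finset.sum_congr rfl fun p _ => e2 p, Finset.sum_add_distrib, Finset.sum_add_distrib, e3]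
  simp only [Finset.sum_ite_eq', Finset.mem_univ, if_true]
  rw [Quaternion.coe_sub, Quaternion.coe_sub, Quaternion.coe_one]
  abel

variable [Finite F]

/-- If `2` is not a square, all indices in the support of a root are linked. -/
theorem IsRoot.suppLinked (hns : ¬ IsSquare (2 : F)) {K : Subgroup (UnitMat ι F)}
    (hK : ∀ l : ι, IsRoot K (stdVec F l)) {y : UnitVec ι F} (hy : IsRoot K y) : SuppLinked K y := by
  obtain ⟨n, hn⟩ : ∃ n, {p | y p ≠ 0}.ncard = n := ⟨_, rfl⟩
  induction n using Nat.strong_induction_on generalizing y with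
  | _ n IH =>
  have IH' : ∀ y, IsRoot K y → {p | y p ≠ 0}.ncard < n → SuppLinked K y :=
    fun y hy h => IH _ h hy rfl
  by_contra hno
  have hdeg : ∀ l, (normSq (y l) : F) = 0 ∨ (normSq (y l) : F) = 1 := by
    intro l
    by_contra! h
    exact hno (suppLinked_of_normSq hns hK IH' hy hn.le h.1 h.2)
  obtain ⟨a, ha⟩ : ∃ a, (normSq (y a) : F) = 1 := by
    by_contra! h
    have := y.sum_normSq
    rw [Finset.sum_eq_zero fun p _ => (hdeg p).resolve_right (h p)] at this
    exact zero_ne_one this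
  have hya : y a ≠ 0 := fun h => by rw [h, map_zero] at ha; exact zero_ne_one ha
  obtain ⟨b, hyb, hba, hnl⟩ : ∃ b, y b ≠ 0 ∧ b ≠ a ∧ ¬ Linked K a b := by
    by_contra! h
    apply hno
    intro l m hl hm hlm
    by_cases h1 : l = a
    · rw [h1]; exact h m hm (h1 ▸ hlm.symm)
    by_cases h2 : m = a
    · rw [h2]; exact (h l hl h1).symm
    exact (h l hl h1).symm.trans (h m hm h2) hlm
  obtain ⟨c, hc⟩ : ∃ c, c = (normSq (y b) : F) := ⟨_, rfl⟩
  have hc01 : c = 0 ∨ c = 1 := hc ▸ hdeg b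
  obtain ⟨r, hr, hr0⟩ := exists_star_mul_mul_ne_zero hyb
  obtain ⟨β, hβ⟩ : ∃ β, β = star (y b) * r * y b := ⟨_, rfl⟩
  rw [← hβ] at hr0
  have hβ0 : β.re = 0 := by rw [hβ]; exact star_mul_mul_re _ (re_eq_zero_of_basis hr)
  have hβn : (normSq β : F) = c ^ 2 := by
    rw [hβ, map_mul, map_mul, Quaternion.normSq_star, normSq_eq_one_of_basis hr, hc]; ring
  obtain ⟨q, hq, ht⟩ := exists_re_ne_zero ha hr0 hβ0
  obtain ⟨q', hq'8, hq'0, hq'n, hc'⟩ : ∃ q' : ℍ[F], IsQ8 q' ∧ q'.re = 0 ∧ (normSq q' : F) = 1 ∧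
      (1 - 4 * (star (y a) * q' * y a * β).re + 8 * c ^ 2 ≠ 0 ∧
        1 - 4 * (star (y a) * q' * y a * β).re + 8 * c ^ 2 ≠ 1) := by
    rcases exists_sign_choice hns hc01 ht with h | h
    · refine ⟨-q, (isQ8_of_basis hq).neg, by simp [re_eq_zero_of_basis hq], by
        rw [Quaternion.normSq_neg, normSq_eq_one_of_basis hq], ?_⟩
      simp only [mul_neg, neg_mul, Quaternion.re_neg, sub_neg_eq_add]
      exact h
    · exact ⟨q, isQ8_of_basis hq, re_eq_zero_of_basis hq, normSq_eq_one_of_basis hq, h⟩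
  obtain ⟨α, hα⟩ : ∃ α, α = star (y a) * q' * y a := ⟨_, rfl⟩
  have hα0 : α.re = 0 := by rw [hα]; exact star_mul_mul_re _ hq'0
  have hαn : (normSq α : F) = 1 := by
    rw [hα, map_mul, map_mul, Quaternion.normSq_star, hq'n, ha]; ring
  let Q : UnitQuat F := ⟨q', hq'8.mem_unitQuat⟩
  let R : UnitQuat F := ⟨r, (isQ8_of_basis hr).mem_unitQuat⟩
  obtain ⟨z, hz⟩ : ∃ z, z = reflVec (rootHom (stdVec F a) Q • rootHom (stdVec F b) R • y) • y :=
    ⟨_, rfl⟩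
  have hzr : IsRoot K z := by
    rw [hz]
    exact hy.smul ((hy.smul (hK b R (isQ8_of_basis hr))).smul (hK a Q hq'8)).reflVec_mem
  have hzp : ∀ p, z p = y p - (2 : F) • ((if p = a then q' * y a else if p = b then r * y b else y p) *
      (((-c : F) : ℍ[F]) - α - β)) := by
    intro p
    rw [hz, reflVec_twist_apply hba.symm (q := Q) (r := R) hq'0 (re_eq_zero_of_basis hr), ha, ← hc, hα, hβ]
    simp only [sub_self, zero_sub]
    rfl
  have hza : (normSq (z a) : F) = 1 - 4 * (α * β).re + 8 * c ^ 2 := by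
    rw [← normSq_aux hα0 hβ0 hαn hβn]
    have h1 : star (y a) * z a = 1 - (2 : F) • (α * (((-c : F) : ℍ[F]) - α - β)) := by
      rw [hzp, if_pos rfl, mul_sub, Quaternion.star_mul_self, ha, Quaternion.coe_one, mul_smul_comm,
        ← mul_assoc, ← mul_assoc, ← hα]
    rw [← h1, map_mul, Quaternion.normSq_star, ha, one_mul]
  rw [hα] at hza
  have hzb : z b ≠ 0 := by
    intro h
    have h1 : r * r = -1 := by rcases hr with rfl | rfl | rfl <;> ext <;> simp
    rw [hzp, if_neg hba, if_pos rfl] at h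
    have h3 : star (y b) * (r * (y b - (2 : F) • (r * y b * (((-c : F) : ℍ[F]) - α - β)))) =
        β + (2 : F) • ((c : ℍ[F]) * (((-c : F) : ℍ[F]) - α - β)) := by
      rw [mul_sub, mul_sub, ← mul_assoc, ← hβ, mul_smul_comm, mul_smul_comm, mul_assoc r, ← mul_assoc r r,
        h1, neg_one_mul, mul_neg, smul_neg, sub_neg_eq_add, ← mul_assoc, Quaternion.star_mul_self, hc]
    rw [h, mul_zero, mul_zero] at h3
    have h4 := congrArg QuaternionAlgebra.re h3
    simp [hα0, hβ0] at h4
    have hc0 : c = 0 := h4.resolve_left (NeZero.ne (2 : F))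
    rw [hc0] at h3
    simp at h3
    exact hr0 h3.symm
  have hza0 : z a ≠ 0 := fun h => hc'.1 (by rw [← hza, h, map_zero])
  have hsub : {p | z p ≠ 0}.ncard ≤ n := by
    rw [← hn]
    refine Set.ncard_le_ncard fun p hp hp0 => hp ?_
    have h1 : p ≠ a := fun h => hya (h ▸ hp0)
    have h3 : p ≠ b := fun h => hyb (h ▸ hp0)
    rw [hzp, if_neg h1, if_neg h3, hp0]; simp
  exact hnl (suppLinked_of_normSq hns hK IH' hzr hsub (hza ▸ hc'.1) (hza ▸ hc'.2) a b hza0 hzb hba.symm)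

end Support

section RankTwoCode

open Quaternion Matrix

lemma IsMaxTwo.le_of_normalized {G : Type*} [Group G] [Finite G] {Q L R : Subgroup G}
    (hQ : IsMaxTwo Q ⊤) (hQL : Q ≤ L) (hR : IsPGroup 2 R)
    (hRL : ∀ x ∈ R, ∀ y ∈ L, x * y * x⁻¹ ∈ L) : R ≤ L := by
  obtain ⟨y, hy, h⟩ := (hQ.mono (le_sup_of_le_right hQL : Q ≤ R ⊔ L) le_top).exists_conj hR le_sup_left
  have hn : R ⊔ L ≤ Subgroup.normalizer (L : Set G) := by
    refine sup_le (fun x hx => ?_) Subgroup.le_normalizer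
    rw [Subgroup.mem_normalizer_iff]
    intro z
    refine ⟨hRL x hx z, fun hz => ?_⟩
    have := hRL x⁻¹ (inv_mem hx) _ hz
    simpa [mul_assoc] using this
  intro r hr
  exact (Subgroup.mem_normalizer_iff.1 (hn hy) r).2 (hQL (h r hr))

variable {F : Type*} [Field F]

lemma mem_unitQuat_iff_normSq {a : ℍ[F]} : a ∈ UnitQuat F ↔ (normSq a : F) = 1 := by
  rw [Quaternion.normSq_def', mem_unitQuat]

/-- Conjugation by a quaternion of norm `1/2`. -/
def twist (s : ℍ[F]) (hs : 2 * (normSq s : F) = 1) : UnitQuat F →* UnitQuat F where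
  toFun a := ⟨(2 : F) • (star s * (a : ℍ[F]) * s), by
    rw [mem_unitQuat_iff_normSq, Quaternion.normSq_smul, map_mul, map_mul, Quaternion.normSq_star,
      mem_unitQuat_iff_normSq.1 a.2]
    linear_combination (2 * normSq s + 1) * hs⟩
  map_one' := by
    apply Subtype.ext
    change (2 : F) • (star s * 1 * s) = 1
    rw [mul_one, Quaternion.star_mul_self, ← Quaternion.coe_smul, smul_eq_mul, hs, Quaternion.coe_one]
  map_mul' a b := by
    apply Subtype.ext
    change (2 : F) • (star s * ((a : ℍ[F]) * (b : ℍ[F])) * s) =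
      ((2 : F) • (star s * (a : ℍ[F]) * s)) * ((2 : F) • (star s * (b : ℍ[F]) * s))
    rw [smul_mul_smul_comm, show star s * (a : ℍ[F]) * s * (star s * (b : ℍ[F]) * s) =
      star s * (a : ℍ[F]) * (s * star s) * ((b : ℍ[F]) * s) by simp only [mul_assoc],
      normSq_mul_star, ← Quaternion.coe_commutes, Quaternion.coe_mul_eq_smul, smul_mul_assoc, smul_smul,
      show (2 : F) * 2 * normSq s = 2 by linear_combination 2 * hs]
    simp only [mul_assoc]

lemma coe_twist (s : ℍ[F]) (hs : 2 * (normSq s : F) = 1) (a : UnitQuat F) :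
    ((twist s hs a : UnitQuat F) : ℍ[F]) = (2 : F) • (star s * (a : ℍ[F]) * s) := rfl

lemma mul_twist (s : ℍ[F]) (hs : 2 * (normSq s : F) = 1) (a : UnitQuat F) :
    s * ((twist s hs a : UnitQuat F) : ℍ[F]) = (a : ℍ[F]) * s := by
  rw [coe_twist, mul_smul_comm, mul_assoc, ← mul_assoc s, normSq_mul_star, Quaternion.coe_mul_eq_smul,
    smul_smul, hs, one_smul]

/-- The matrix of the root element of `(1, -1)`, which is not normalized. -/
def halfMat (a : ℍ[F]) : Matrix (Fin 2) (Fin 2) ℍ[F] :=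
  !![(1/2 : F) • (1 + a), (1/2 : F) • (1 - a); (1/2 : F) • (1 - a), (1/2 : F) • (1 + a)]

lemma halfMat_identity [NeZero (2 : F)] : halfMat qi * !![qk, 0; 0, 1] * halfMat qj =
    !![-(qk * qw * star qk), 0; 0, (-qw : ℍ[F])] := by
  have h2 := NeZero.ne (2 : F)
  ext1 p q
  rw [Matrix.mul_apply, Fin.sum_univ_two, Matrix.mul_apply, Fin.sum_univ_two, Matrix.mul_apply,
    Fin.sum_univ_two]
  fin_cases p <;> fin_cases q <;> ext <;> simp [halfMat] <;> field_simp <;> ring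

lemma rootHom_twist [NeZero (2 : F)] {z : UnitVec (Fin 2) F} (hs : 2 * (normSq (z 0) : F) = 1)
    {q : UnitQuat F} (hq : z 1 = -((q : ℍ[F]) * z 0)) (a : UnitQuat F) :
    (rootHom z (twist (z 0) hs a)).1 =
      (mon (1 : Equiv.Perm (Fin 2)) ![1, q]).1 * halfMat (a : ℍ[F]) *
        (mon (1 : Equiv.Perm (Fin 2)) ![1, q])⁻¹.1 := by
  have h2 := NeZero.ne (2 : F)
  have key : z 0 * (((twist (z 0) hs a : UnitQuat F) : ℍ[F]) - 1) * star (z 0) =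
      (1/2 : F) • ((a : ℍ[F]) - 1) := by
    rw [mul_sub, mul_twist, mul_one, ← sub_one_mul, mul_assoc, normSq_mul_star, ← Quaternion.coe_commutes,
      Quaternion.coe_mul_eq_smul]
    congr 1
    field_simp
    linear_combination hs
  have hqq : (q : ℍ[F]) * star (q : ℍ[F]) = 1 := (Unitary.mem_iff.1 q.2).2
  have hh : (1/2 : F) • ((1 : ℍ[F]) + (a : ℍ[F])) = 1 + (1/2 : F) • ((a : ℍ[F]) - 1) := by
    ext <;> (simp; try field_simp; try ring)
  have hh' : (1/2 : F) • ((1 : ℍ[F]) - (a : ℍ[F])) = -((1/2 : F) • ((a : ℍ[F]) - 1)) := by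
    rw [← smul_neg, neg_sub]
  ext1 x y
  rw [Matrix.mul_apply, Fin.sum_univ_two, Matrix.mul_apply, Fin.sum_univ_two, Matrix.mul_apply,
    Fin.sum_univ_two, rootHom_apply]
  simp only [mon_inv, coe_mon, halfMat, hh, hh']
  generalize (1/2 : F) • ((a : ℍ[F]) - 1) = X at key
  have hinv : ((q⁻¹ : UnitQuat F) : ℍ[F]) = star (q : ℍ[F]) := rfl
  fin_cases x <;> fin_cases y <;> simp [hq, key, hinv]
  · rw [← key]; simp only [mul_assoc]
  · rw [← key]; simp only [mul_assoc]
  · rw [mul_add, mul_one, add_mul, hqq, ← key]; simp only [mul_assoc]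

lemma mon_one_mem {ι : Type*} [Fintype ι] [DecidableEq ι] {K : Subgroup (UnitMat ι F)}
    {d : ι → UnitQuat F} (h : ∀ l : ι, rootHom (stdVec F l) (d l) ∈ K) : mon 1 d ∈ K := by
  have key : ∀ s : Finset ι, mon 1 (fun l => if l ∈ s then d l else 1) ∈ K := by
    intro s
    induction s using Finset.induction_on with
    | empty => simpa using! (mon_one (F := F) (ι := ι)).symm ▸ K.one_mem
    | insert a s ha ih =>
      have := K.mul_mem (h a) ih
      rw [rootHom_stdVec, mon_mul_mon, mul_one] at this
      convert this using 2
      funext l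
      by_cases hl : l = a
      · subst hl; simp [ha]
      · simp [hl]
  simpa using key Finset.univ

variable [NeZero (2 : F)] [Finite F]

lemma omega_mem_of_rank_two (hns : ¬ IsSquare (2 : F)) {K : Subgroup (UnitMat (Fin 2) F)}
    (hK : ∀ l : Fin 2, IsRoot K (stdVec F l)) {z : UnitVec (Fin 2) F} (hz : IsRoot K z)
    (hs : 2 * (normSq (z 0) : F) = 1) :
    mon (1 : Equiv.Perm (Fin 2)) (fun _ => omega F) ∈ K := by
  have hs1 : 2 * (normSq (z 1) : F) = 1 := by
    have := z.sum_normSq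
    rw [Fin.sum_univ_two] at this
    linear_combination 2 * this - hs
  obtain ⟨q₀, hq₀⟩ : ∃ q₀ : UnitQuat F, (q₀ : ℍ[F]) = -((2 : F) • (z 1 * star (z 0))) :=
    ⟨⟨_, by
      rw [mem_unitQuat_iff_normSq, Quaternion.normSq_neg, normSq_two_smul _ _ hs1,
        Quaternion.normSq_star, hs]⟩, rfl⟩
  have hz1 : z 1 = -((q₀ : ℍ[F]) * z 0) := by
    rw [hq₀, neg_mul, neg_neg, smul_mul_assoc, mul_assoc, Quaternion.star_mul_self,
      ← Quaternion.coe_commutes, Quaternion.coe_mul_eq_smul, smul_smul, hs, one_smul]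
  have hroot : IsRoot K ((stdVec F (1 : Fin 2)).rsmul q₀) := by
    have h1 := (hK 0).smul hz.reflVec_mem
    convert h1 using 1
    ext1 p
    rw [reflVec_smul_stdVec, UnitVec.rsmul_apply, stdVec_apply]
    fin_cases p
    · simp only [Fin.zero_eta, Fin.isValue, if_true, normSq_mul_star, ← Quaternion.coe_smul, smul_eq_mul, hs]
      simp
    · simp [hq₀]
  have hpq : IsPGroup 2 ((quatGroup F).map (MulAut.conj q₀).toMonoidHom) := isPGroup_quatGroup.map _
  obtain ⟨b, hb, hbQ⟩ := ((isMaxTwo_quatGroup hns).mono (hK 1 : quatGroup F ≤ localGroup K (stdVec F (1 : Fin 2)))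
    le_top).exists_conj (N := localGroup K (stdVec F (1 : Fin 2))) hpq (by
      rintro _ ⟨a, ha, rfl⟩
      have := hroot a ha
      rw [rootHom_rsmul] at this
      exact this)
  obtain ⟨q, hq⟩ : ∃ q, q = b * q₀ := ⟨_, rfl⟩
  have hqQ : ∀ a ∈ quatGroup F, q * a * q⁻¹ ∈ quatGroup F := by
    intro a ha
    have := hbQ _ (Subgroup.mem_map_of_mem _ ha)
    convert this using 1
    simp [hq, mul_assoc]
  obtain ⟨y, hy⟩ : ∃ y, y = rootHom (stdVec F (1 : Fin 2)) b • z := ⟨_, rfl⟩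
  have hyK : IsRoot K y := hy ▸ hz.smul hb
  have hy0 : y 0 = z 0 := by
    rw [hy, rootHom_smul_apply, stdVec_apply]; simp
  have hy1 : y 1 = -((q : ℍ[F]) * y 0) := by
    rw [hy0, hy, rootHom_smul_apply, stdVec_apply, star_stdVec_dotProduct, hq]
    simp only [if_true, one_mul, sub_mul, add_sub_cancel]
    rw [hz1, Submonoid.coe_mul]
    simp [mul_assoc]
  have hsy : 2 * (normSq (y 0) : F) = 1 := by rw [hy0, hs]
  have htw : (quatGroup F).map (twist (y 0) hsy) ≤ localGroup K y := by
    refine (isMaxTwo_quatGroup hns).le_of_normalized hyK (isPGroup_quatGroup.map _) ?_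
    rintro _ ⟨x, hx, rfl⟩ u hu
    have hk : mon (1 : Equiv.Perm (Fin 2)) ![x, q * x * q⁻¹] ∈ K := by
      apply mon_one_mem
      intro l
      fin_cases l
      · exact hK 0 _ hx
      · exact hK 1 _ (hqQ x hx)
    have hky : mon (1 : Equiv.Perm (Fin 2)) ![x, q * x * q⁻¹] • y = y.rsmul (twist (y 0) hsy x) := by
      ext1 p
      rw [UnitVec.coe_smul, mulVec, dotProduct, Fin.sum_univ_two, coe_mon, coe_mon, UnitVec.rsmul_apply]
      have h1 := mul_twist (y 0) hsy x
      fin_cases p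
      · simp [h1]
      · simp only [Fin.mk_one, Equiv.Perm.one_apply, Fin.isValue, one_ne_zero, if_false, if_true,
          zero_mul, zero_add, Matrix.cons_val_one, hy1, neg_mul, mul_neg, mul_assoc, h1]
        have h2 : ((q⁻¹ : UnitQuat F) : ℍ[F]) * ((q : ℍ[F]) * y 0) = y 0 := by
          rw [← mul_assoc, UnitQuat.coe_inv_mul, one_mul]
        simp [mul_assoc, h2]
    rw [mem_localGroup, ← rootHom_rsmul, ← hky, ← conj_rootHom]
    exact K.mul_mem (K.mul_mem hk hu) (K.inv_mem hk)
  have hi : rootHom y (twist (y 0) hsy ⟨qi, isQ8_qi.mem_unitQuat⟩) ∈ K :=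
    htw (Subgroup.mem_map_of_mem _ isQ8_qi)
  have hj : rootHom y (twist (y 0) hsy ⟨qj, isQ8_qj.mem_unitQuat⟩) ∈ K :=
    htw (Subgroup.mem_map_of_mem _ isQ8_qj)
  obtain ⟨κ, hκ⟩ : ∃ κ : UnitQuat F, κ = ⟨qk, isQ8_qk.mem_unitQuat⟩ := ⟨_, rfl⟩
  have hκQ : κ ∈ quatGroup F := by rw [hκ]; exact isQ8_qk
  have hprod := K.mul_mem (K.mul_mem hi (hK 0 κ hκQ)) hj
  have hcl : IsCls (omega F) 1 := wpow_one (F := F) ▸ isCls_wpow 1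
  have hclκ := isCls_zero.2 hκQ
  have hneg := isCls_zero.2 (neg_one_mem_quatGroup (F := F))
  obtain ⟨c₁, hc₁⟩ : ∃ c₁ : UnitQuat F, c₁ = -1 * (κ * omega F * κ⁻¹) := ⟨_, rfl⟩
  obtain ⟨c₂, hc₂⟩ : ∃ c₂ : UnitQuat F, c₂ = q * (-1 * omega F) * q⁻¹ := ⟨_, rfl⟩
  have hcl1 : IsCls c₁ 1 := by
    have := hneg.mul ((hclκ.mul hcl).mul hclκ.inv)
    rw [hc₁]; simpa using this
  have hcl2 : IsCls c₂ 1 := by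
    obtain ⟨e, he⟩ := exists_isCls hns hqQ
    have := (he.mul (hneg.mul hcl)).mul he.inv
    rw [hc₂]; simpa using this
  have heq : rootHom y (twist (y 0) hsy ⟨qi, isQ8_qi.mem_unitQuat⟩) * rootHom (stdVec F 0) κ *
      rootHom y (twist (y 0) hsy ⟨qj, isQ8_qj.mem_unitQuat⟩) =
      mon (1 : Equiv.Perm (Fin 2)) ![c₁, c₂] := by
    have hM : rootHom (stdVec F (0 : Fin 2)) κ = mon (1 : Equiv.Perm (Fin 2)) ![1, q] *
        mon (1 : Equiv.Perm (Fin 2)) ![κ, 1] * (mon (1 : Equiv.Perm (Fin 2)) ![1, q])⁻¹ := by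
      rw [rootHom_stdVec, mon_inv, mon_mul_mon, mon_mul_mon]
      congr 1
      funext p
      fin_cases p <;> simp
    have hR : mon (1 : Equiv.Perm (Fin 2)) ![c₁, c₂] = mon (1 : Equiv.Perm (Fin 2)) ![1, q] *
        mon (1 : Equiv.Perm (Fin 2)) ![c₁, -1 * omega F] * (mon (1 : Equiv.Perm (Fin 2)) ![1, q])⁻¹ := by
      rw [mon_inv, mon_mul_mon, mon_mul_mon]
      congr 1
      funext p
      fin_cases p <;> simp [hc₂]
    apply Subtype.ext
    have e1 := rootHom_twist hsy hy1 ⟨qi, isQ8_qi.mem_unitQuat⟩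
    have e2 := rootHom_twist hsy hy1 ⟨qj, isQ8_qj.mem_unitQuat⟩
    rw [hM, hR]
    obtain ⟨A, hA⟩ : ∃ A, A = mon (1 : Equiv.Perm (Fin 2)) ![1, q] := ⟨_, rfl⟩
    rw [← hA] at e1 e2 ⊢
    change (rootHom y _).1 * (A.1 * _ * (A⁻¹).1) * (rootHom y _).1 = A.1 * _ * (A⁻¹).1
    rw [e1, e2]
    have hAA : (A⁻¹).1 * A.1 = 1 := UnitMat.coe_inv_mul A
    have e3 : (mon (1 : Equiv.Perm (Fin 2)) ![κ, 1]).1 = !![qk, 0; 0, 1] := by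
      ext1 p r
      rw [coe_mon]
      fin_cases p <;> fin_cases r <;> simp [hκ]
    have e4 : (mon (1 : Equiv.Perm (Fin 2)) ![c₁, -1 * omega F]).1 =
        !![-(qk * qw * star qk), 0; 0, (-qw : ℍ[F])] := by
      ext1 p r
      rw [coe_mon]
      have v₁ : (c₁ : ℍ[F]) = -(qk * qw * star qk) := by
        rw [hc₁, hκ]
        change -1 * (qk * qw * star qk) = _
        rw [neg_one_mul]
      have v₂ : ((-1 * omega F : UnitQuat F) : ℍ[F]) = -qw := neg_one_mul qw
      rw [← v₁, ← v₂]
      generalize -1 * omega F = c₃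
      fin_cases p <;> fin_cases r <;> simp
    rw [e3, e4, ← halfMat_identity]
    have assoc : ∀ X Y Z : Matrix (Fin 2) (Fin 2) ℍ[F],
        A.1 * X * (A⁻¹).1 * (A.1 * Y * (A⁻¹).1) * (A.1 * Z * (A⁻¹).1) = A.1 * (X * Y * Z) * (A⁻¹).1 := by
      intro X Y Z
      calc _ = A.1 * X * ((A⁻¹).1 * A.1) * Y * ((A⁻¹).1 * A.1) * Z * (A⁻¹).1 := by
            simp only [mul_assoc]
        _ = _ := by rw [hAA]; simp only [mul_one, mul_assoc]
    exact assoc _ _ _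
  rw [heq] at hprod
  have hd : mon (1 : Equiv.Perm (Fin 2)) ![c₁⁻¹ * omega F, c₂⁻¹ * omega F] ∈ K := by
    apply mon_one_mem
    intro l
    fin_cases l
    · refine hK 0 _ (isCls_zero.1 ?_)
      simpa using hcl1.inv.mul hcl
    · refine hK 1 _ (isCls_zero.1 ?_)
      simpa using hcl2.inv.mul hcl
  have := K.mul_mem hprod hd
  rw [mon_mul_mon, mul_one] at this
  convert this using 2
  funext p
  fin_cases p <;> simp

end RankTwoCode

section Code

open Quaternion Matrix

variable {F : Type*} [Field F] {ι : Type*} [Fintype ι] [DecidableEq ι] [NeZero (2 : F)]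

/-- The diagonal matrix with entries the powers of `ω` prescribed by `f`. -/
def diagOmega (F : Type*) [Field F] [NeZero (2 : F)] (f : ι → ZMod 3) : UnitMat ι F :=
  mon 1 (fun l => wpow (f l))

lemma diagOmega_add (f g : ι → ZMod 3) : diagOmega F (f + g) = diagOmega F f * diagOmega F g := by
  unfold diagOmega
  rw [mon_mul_mon, mul_one]
  congr 1
  funext l
  simp [wpow_add]

@[simp] lemma diagOmega_zero : diagOmega F (0 : ι → ZMod 3) = 1 := by
  unfold diagOmega
  rw [← mon_one]
  congr 1

lemma diagOmega_neg (f : ι → ZMod 3) : diagOmega F (-f) = (diagOmega F f)⁻¹ := by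
  rw [eq_inv_iff_mul_eq_one, ← diagOmega_add]; simp

lemma diagOmega_single (l : ι) (e : ZMod 3) :
    diagOmega F (Pi.single l e) = rootHom (stdVec F l) (wpow e) := by
  rw [rootHom_stdVec, diagOmega]
  congr 1
  funext m
  by_cases h : m = l
  · subst h; simp
  · simp [h]

/-- The exponent vectors of the diagonal matrices over `⟨ω⟩` lying in `K`. -/
def code (K : Subgroup (UnitMat ι F)) : Submodule (ZMod 3) (ι → ZMod 3) :=
  AddSubgroup.toZModSubmodule 3
    { carrier := {f | diagOmega F f ∈ K}
      zero_mem' := by simp [K.one_mem]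
      add_mem' := fun hf hg => by
        rw [Set.mem_ofPred_eq, diagOmega_add]; exact K.mul_mem hf hg
      neg_mem' := fun hf => by
        rw [Set.mem_ofPred_eq, diagOmega_neg]; exact K.inv_mem hf }

lemma mem_code {K : Subgroup (UnitMat ι F)} {f : ι → ZMod 3} : f ∈ code K ↔ diagOmega F f ∈ K :=
  Iff.rfl

lemma single_mem_code {K : Subgroup (UnitMat ι F)} {l : ι} :
    Pi.single l 1 ∈ code K ↔ omega F ∈ localGroup K (stdVec F l) := by
  rw [mem_code, diagOmega_single, wpow_one]; rfl

variable [Finite F]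

lemma Linked.mem_code (hns : ¬ IsSquare (2 : F)) {K : Subgroup (UnitMat ι F)}
    (hK : ∀ l : ι, IsRoot K (stdVec F l)) {l m : ι} (h : Linked K l m) :
    Pi.single l 1 + Pi.single m 1 ∈ code K := by
  obtain ⟨hlm, z, hz, hz0, hzl, hzm⟩ := h
  have h2 := NeZero.ne (2 : F)
  have horth : star (stdVec F l).val ⬝ᵥ (stdVec F m).val = 0 := by
    rw [star_stdVec_dotProduct, stdVec_apply, if_neg hlm]
  have he0 : (stdVec F (0 : Fin 2)).embVec _ (pairMat_unitary horth) = stdVec F l := by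
    ext1 p
    rw [embVec_pairMat horth]; simp [stdVec_apply]
  have he1 : (stdVec F (1 : Fin 2)).embVec _ (pairMat_unitary horth) = stdVec F m := by
    ext1 p
    rw [embVec_pairMat horth]; simp [stdVec_apply]
  have hrest : ∑ p : Fin 2, (normSq (![z l, z m] p) : F) = 1 := by
    rw [Fin.sum_univ_two]
    have : (2 : F) * (normSq (z l) + normSq (z m)) = 2 * 1 := by linear_combination hzl + hzm
    exact mul_left_cancel₀ h2 this
  obtain ⟨y, hy⟩ : ∃ y : UnitVec (Fin 2) F, y = UnitVec.ofNormSq ![z l, z m] hrest := ⟨_, rfl⟩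
  have hy0 : y 0 = z l := by rw [hy]; rfl
  have hy1 : y 1 = z m := by rw [hy]; rfl
  have hyz : y.embVec _ (pairMat_unitary horth) = z := by
    ext1 p
    rw [embVec_pairMat horth, hy0, hy1, stdVec_apply, stdVec_apply]
    by_cases hl : p = l
    · subst hl; simp [hlm]
    · by_cases hm : p = m
      · subst hm; simp [hl]
      · simp [hl, hm, hz0 p hl hm]
  have key := omega_mem_of_rank_two hns (K := K.comap (emb _ (pairMat_unitary horth)))
    (Fin.forall_fin_two.2 ⟨by rw [isRoot_comap_emb, he0]; exact hK l,
      by rw [isRoot_comap_emb, he1]; exact hK m⟩) ((isRoot_comap_emb _ _).2 (by rw [hyz]; exact hz)) (by rw [hy0, hzl])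
  have hsplit : mon (1 : Equiv.Perm (Fin 2)) (fun _ => omega F) =
      rootHom (stdVec F (0 : Fin 2)) (omega F) * rootHom (stdVec F (1 : Fin 2)) (omega F) := by
    rw [rootHom_stdVec, rootHom_stdVec, mon_mul_mon, mul_one]
    congr 1
    funext p
    fin_cases p <;> simp
  rw [hsplit, Subgroup.mem_comap, map_mul, emb_rootHom, emb_rootHom, he0, he1] at key
  rw [_root_.mem_code, diagOmega_add, diagOmega_single, diagOmega_single, wpow_one]
  exact key

lemma Linked.single_mem_code (hns : ¬ IsSquare (2 : F)) {K : Subgroup (UnitMat ι F)}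
    (hK : ∀ l : ι, IsRoot K (stdVec F l)) {l m n : ι} (h : Linked K l m) (h' : Linked K l n)
    (hmn : m ≠ n) : Pi.single l 1 ∈ code K := by
  have h1 := h.mem_code hns hK
  have h2 := h'.mem_code hns hK
  have h3 := (h.symm.trans h' hmn).mem_code hns hK
  have h4 := (code K).sub_mem ((code K).add_mem h1 h2) h3
  have h5 := (code K).smul_mem 2 h4
  convert h5 using 1
  have : (2 : ZMod 3) * 2 = 1 := by decide
  funext p
  simp only [Pi.smul_apply, Pi.sub_apply, Pi.add_apply, smul_eq_mul]
  linear_combination (-(Pi.single l 1 : ι → ZMod 3) p) * this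

end Code

section Fibration

variable {ι κ : Type*} [Finite ι] [Finite κ]

lemma exists_perm_lift {K : Type*} (p : ι → K) (τ : Equiv.Perm K)
    (h : ∀ k, Nat.card {i // p i = k} = Nat.card {i // p i = τ k}) :
    ∃ σ : Equiv.Perm ι, ∀ i, p (σ i) = τ (p i) := by
  have e : ∀ k, Nonempty ({i // p i = k} ≃ {i // p i = τ k}) := fun k => Finite.card_eq.1 (h k)
  obtain ⟨E⟩ : Nonempty (∀ k, {i // p i = k} ≃ {i // p i = τ k}) := ⟨fun k => (e k).some⟩
  have hinj : Function.Injective fun i => (E (p i) ⟨i, rfl⟩ : ι) := by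
    intro i j hij
    simp only at hij
    have hpi := (E (p i) ⟨i, rfl⟩).2
    have hpj := (E (p j) ⟨j, rfl⟩).2
    rw [hij, hpj] at hpi
    have hp : p j = p i := τ.injective hpi
    have : ∀ k (hk : p j = k), (E (p j) ⟨j, rfl⟩ : ι) = E k ⟨j, hk⟩ := by rintro k rfl; rfl
    rw [this _ hp] at hij
    have := (E (p i)).injective (Subtype.ext hij)
    exact congrArg Subtype.val this
  refine ⟨Equiv.ofBijective _ (Finite.injective_iff_bijective.1 hinj), fun i => ?_⟩
  exact (E (p i) ⟨i, rfl⟩).2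

/-- Pairs of permutations compatible with a partially defined map. -/
def fibrePairs (p : ι → Option κ) : Subgroup (Equiv.Perm ι × Equiv.Perm κ) where
  carrier := {x | ∀ i, p (x.1 i) = (p i).map x.2}
  one_mem' := fun i => by simp
  mul_mem' := fun {x y} hx hy i => by
    simp only [Prod.fst_mul, Prod.snd_mul, Equiv.Perm.coe_mul, Function.comp_apply]
    rw [hx, hy, Option.map_map]
  inv_mem' := fun {x} hx i => by
    have := hx (x.1⁻¹ i)
    rw [show x.1 (x.1⁻¹ i) = i from x.1.apply_symm_apply i] at this
    rw [this, Option.map_map, Prod.fst_inv, Prod.snd_inv]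
    have h : (⇑x.2⁻¹ ∘ ⇑x.2) = id := by funext k; simp
    rw [h, Option.map_id]; rfl

/-- The permutations of the base induced by a group of permutations. -/
def inducedPerms (p : ι → Option κ) (X : Subgroup (Equiv.Perm ι)) : Subgroup (Equiv.Perm κ) :=
  (X.comap ((MonoidHom.fst _ _).comp (fibrePairs p).subtype)).map
    ((MonoidHom.snd _ _).comp (fibrePairs p).subtype)

lemma mem_inducedPerms {p : ι → Option κ} {X : Subgroup (Equiv.Perm ι)} {τ : Equiv.Perm κ} :
    τ ∈ inducedPerms p X ↔ ∃ σ ∈ X, ∀ i, p (σ i) = (p i).map τ := by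
  constructor
  · rintro ⟨⟨⟨σ, τ'⟩, h⟩, hσ, rfl⟩
    exact ⟨σ, hσ, h⟩
  · rintro ⟨σ, hσ, h⟩
    exact ⟨⟨⟨σ, τ⟩, h⟩, hσ, rfl⟩

lemma odd_index_inducedPerms {p : ι → Option κ} {X : Subgroup (Equiv.Perm ι)} {m : ℕ}
    (hp : ∀ k, Nat.card {i // p i = some k} = m) (hX : Odd X.index)
    (h : ∀ σ ∈ X, ∃ τ : Equiv.Perm κ, ∀ i, p (σ i) = (p i).map τ) :
    Odd (inducedPerms p X).index := by
  have hsurj : Function.Surjective ((MonoidHom.snd (Equiv.Perm ι) (Equiv.Perm κ)).comp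
      (fibrePairs p).subtype) := by
    intro τ
    obtain ⟨σ, hσ⟩ := exists_perm_lift p (Equiv.optionCongr τ) (by
      rintro (_ | k)
      · rfl
      · rw [hp, Equiv.optionCongr_apply, Option.map_some, hp])
    exact ⟨⟨⟨σ, τ⟩, hσ⟩, rfl⟩
  refine Odd.of_dvd_nat ?_ (Subgroup.index_map_dvd _ hsurj)
  rw [Subgroup.index_comap]
  refine Odd.of_dvd_nat hX (Subgroup.relIndex_dvd_index_of_le ?_)
  intro σ hσ
  obtain ⟨τ, hτ⟩ := h σ hσ
  exact ⟨⟨⟨σ, τ⟩, hτ⟩, rfl⟩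

lemma isPGroup_inducedPerms {p : ι → Option κ} {X : Subgroup (Equiv.Perm ι)}
    (hp : ∀ k, ∃ i, p i = some k) (hX : IsPGroup 2 X) : IsPGroup 2 (inducedPerms p X) := by
  rintro ⟨τ, hτ⟩
  obtain ⟨σ, hσ, h⟩ := mem_inducedPerms.1 hτ
  obtain ⟨n, hn⟩ := hX ⟨σ, hσ⟩
  refine ⟨n, Subtype.ext ?_⟩
  have h1 : (⟨σ, τ⟩ : Equiv.Perm ι × Equiv.Perm κ) ^ 2 ^ n ∈ fibrePairs p :=
    (fibrePairs p).pow_mem (show (⟨σ, τ⟩ : Equiv.Perm ι × Equiv.Perm κ) ∈ fibrePairs p from h) _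
  have hn' : σ ^ 2 ^ n = 1 := congrArg Subtype.val hn
  apply Equiv.ext
  intro k
  obtain ⟨i, hi⟩ := hp k
  have h2 := h1 i
  simp only [Prod.pow_mk, hn', Equiv.Perm.one_apply, hi, Option.map_some, Option.some.injEq] at h2
  exact h2.symm

lemma exists_induced_perm {p : ι → Option κ} (hp : ∀ k, ∃ i, p i = some k) {σ : Equiv.Perm ι}
    (h : ∀ i j, p (σ i) = p (σ j) ↔ p i = p j) (h0 : ∀ i, p (σ i) = none ↔ p i = none) :
    ∃ τ : Equiv.Perm κ, ∀ i, p (σ i) = (p i).map τ := by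
  choose s hs using hp
  have : ∀ k, ∃ k', p (σ (s k)) = some k' := fun k => by
    rw [← Option.ne_none_iff_exists', Ne, h0, hs]; simp
  choose f hf using this
  have hinj : Function.Injective f := by
    intro k k' hk
    have : p (σ (s k)) = p (σ (s k')) := by rw [hf, hf, hk]
    rw [h, hs, hs] at this
    exact Option.some.inj this
  refine ⟨Equiv.ofBijective f (Finite.injective_iff_bijective.1 hinj), fun i => ?_⟩
  rcases hi : p i with _ | k
  · simpa [h0] using hi
  · rw [← hs, ← h] at hi
    rw [hi, hf]; rfl

end Fibration

section SelfNormalizing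

variable {ι : Type*} [Finite ι] [DecidableEq ι]

/-- The permutations agreeing at each point with the identity or with a given involution. -/
def involutionGroup (π : Equiv.Perm ι) (hπ : ∀ i, π (π i) = i) : Subgroup (Equiv.Perm ι) where
  carrier := {τ | ∀ i, τ i = i ∨ τ i = π i}
  one_mem' := fun i => Or.inl rfl
  mul_mem' := fun {x y} hx hy i => by
    rw [Equiv.Perm.mul_apply]
    rcases hy i with h | h <;> rw [h]
    · exact hx i
    · rcases hx (π i) with h | h <;> simp [h, hπ]
  inv_mem' := fun {x} hx i => by
    rcases hx (x⁻¹ i) with h | h <;> rw [show x (x⁻¹ i) = i from x.apply_symm_apply i] at h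
    · exact Or.inl h.symm
    · right
      rw [← hπ (x⁻¹ i), ← h]

lemma isPGroup_involutionGroup (π : Equiv.Perm ι) (hπ : ∀ i, π (π i) = i) :
    IsPGroup 2 (involutionGroup π hπ) := by
  rintro ⟨τ, hτ⟩
  refine ⟨1, Subtype.ext (Equiv.ext fun i => ?_)⟩
  change (τ ^ 2 ^ 1) i = i
  rw [pow_one, pow_two, Equiv.Perm.mul_apply]
  rcases hτ i with h | h
  · rw [h, h]
  · rw [h]
    rcases hτ (π i) with h' | h'
    · rw [← h] at h'
      rw [← h, h']
      exact τ.injective h'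
    · rw [h', hπ]

lemma exists_involutionGroup_le {X : Subgroup (Equiv.Perm ι)} (hX : Odd X.index) :
    ∃ (π : Equiv.Perm ι) (hπ : ∀ i, π (π i) = i), (∀ i j, π i = i → π j = j → i = j) ∧
      involutionGroup π hπ ≤ X := by
  have e := Finite.equivFin ι
  obtain ⟨π₀, h₀⟩ : ∃ π₀ : Equiv.Perm ι, ∀ i, π₀ i = e.symm (Fin.rev (e i)) :=
    ⟨(e.trans Fin.revPerm).trans e.symm, fun i => rfl⟩
  have hinv : ∀ i, π₀ (π₀ i) = i := fun i => by simp [h₀]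
  obtain ⟨P, hVP, hP⟩ := exists_isMaxTwo_ge (isPGroup_involutionGroup π₀ hinv) le_top
  obtain ⟨x, hx⟩ := hP.exists_conj_of_odd_index hX
  refine ⟨x * π₀ * x⁻¹, fun i => by simp [hinv], fun i j hi hj => ?_, fun τ hτ => ?_⟩
  · have key : ∀ i, (x * π₀ * x⁻¹) i = i → Fin.rev (e (x⁻¹ i)) = e (x⁻¹ i) := by
      intro i hi
      rw [Equiv.Perm.mul_apply, Equiv.Perm.mul_apply, ← Equiv.Perm.eq_inv_iff_eq, h₀,
        Equiv.symm_apply_eq] at hi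
      exact hi
    have h1 := congrArg Fin.val (key i hi)
    have h2 := congrArg Fin.val (key j hj)
    rw [Fin.val_rev] at h1 h2
    apply x⁻¹.injective
    apply e.injective
    apply Fin.ext
    omega
  · have := hx (x⁻¹ * τ * x) (hVP fun i => ?_)
    · simpa [mul_assoc] using this
    · rcases hτ (x i) with h | h
      · left; simp [h]
      · right; simp [h]

lemma swap_mem_involutionGroup (π : Equiv.Perm ι) (hπ : ∀ i, π (π i) = i) (i : ι) :
    Equiv.swap i (π i) ∈ involutionGroup π hπ := fun j => by
  rw [Equiv.swap_apply_def]
  split_ifs with h1 h2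
  · right; rw [h1]
  · right; rw [h2, hπ]
  · left; rfl

lemma IsPGroup.not_swap_mem {T : Subgroup (Equiv.Perm ι)} (hT : IsPGroup 2 T) {i j k : ι}
    (hij : i ≠ j) (hik : i ≠ k) (hjk : j ≠ k) (h1 : Equiv.swap i j ∈ T) :
    Equiv.swap i k ∉ T := fun h2 => by
  have : Fintype ι := Fintype.ofFinite ι
  have h3 : Equiv.Perm.IsThreeCycle (Equiv.swap i j * Equiv.swap i k) :=
    Equiv.Perm.isThreeCycle_swap_mul_swap_same hij hik hjk
  obtain ⟨n, hn⟩ := hT ⟨_, T.mul_mem h1 h2⟩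
  have hn' : (Equiv.swap i j * Equiv.swap i k) ^ 2 ^ n = 1 := congrArg Subtype.val hn
  have h4 := orderOf_dvd_of_pow_eq_one hn'
  rw [h3.orderOf] at h4
  have := Nat.Prime.dvd_of_dvd_pow Nat.prime_three h4
  omega

lemma IsPGroup.eq_of_swap_mem {T : Subgroup (Equiv.Perm ι)} (hT : IsPGroup 2 T)
    {π : Equiv.Perm ι} {hπ : ∀ i, π (π i) = i} (hfix : ∀ i j, π i = i → π j = j → i = j)
    (hV : involutionGroup π hπ ≤ T) {i j : ι} (h : Equiv.swap i j ∈ T) : j = i ∨ j = π i := by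
  by_contra! hne
  obtain ⟨hji, hjπ⟩ := hne
  by_cases hi : π i = i
  · have hj : π j ≠ j := fun hj => hji (hfix j i hj hi)
    have hπji : π j ≠ i := fun h => by
      apply hji
      rw [← hπ j, h, hi]
    refine hT.not_swap_mem hji hj.symm hπji.symm (by rwa [Equiv.swap_comm]) (hV ?_)
    exact swap_mem_involutionGroup π hπ j
  · exact hT.not_swap_mem hji.symm (Ne.symm hi) hjπ h (hV (swap_mem_involutionGroup π hπ i))

lemma apply_comm_of_normalizing {T : Subgroup (Equiv.Perm ι)} (hT : IsPGroup 2 T)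
    {π : Equiv.Perm ι} {hπ : ∀ i, π (π i) = i} (hfix : ∀ i j, π i = i → π j = j → i = j)
    (hV : involutionGroup π hπ ≤ T) {σ : Equiv.Perm ι} (hσ : ∀ τ ∈ T, σ * τ * σ⁻¹ ∈ T)
    (i : ι) : σ (π i) = π (σ i) := by
  have key : ∀ i, σ (π i) = σ i ∨ σ (π i) = π (σ i) := by
    intro i
    have := hσ _ (hV (swap_mem_involutionGroup π hπ i))
    rw [Equiv.swap_apply_apply σ i (π i) |>.symm] at this
    exact hT.eq_of_swap_mem hfix hV this
  rcases key i with h | h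
  · have hi : π i = i := σ.injective h
    rw [hi]
    by_contra hne
    obtain ⟨j, hj⟩ := σ.surjective (π (σ i))
    have hji : j ≠ i := by rintro rfl; exact hne hj
    have hj' : π j ≠ j := fun h' => hji (hfix _ _ h' hi)
    rcases key j with h1 | h1
    · exact hj' (σ.injective h1)
    · rw [hj, hπ] at h1
      have := σ.injective h1
      rw [← hπ j, this, hi] at hji
      exact hji rfl
  · exact h

end SelfNormalizing

section Pairs

variable {ι : Type*} [Finite ι] [DecidableEq ι]

/-- The two-element orbits of an involution. -/
abbrev PairOf (π : Equiv.Perm ι) := {s : Set ι // ∃ i, π i ≠ i ∧ s = {i, π i}}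

/-- The two-element orbit containing a point, if there is one. -/
def toPair (π : Equiv.Perm ι) (i : ι) : Option (PairOf π) :=
  if h : π i ≠ i then some ⟨{i, π i}, i, h, rfl⟩ else none

lemma toPair_eq_none {π : Equiv.Perm ι} {i : ι} : toPair π i = none ↔ π i = i := by
  unfold toPair
  split_ifs with h <;> simp_all

lemma toPair_eq_some {π : Equiv.Perm ι} (hπ : ∀ i, π (π i) = i) {i : ι} {k : PairOf π} :
    toPair π i = some k ↔ i ∈ k.1 := by
  obtain ⟨s, j, hj, rfl⟩ := k
  unfold toPair
  constructor
  · intro h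
    split_ifs at h with hi
    have := congrArg Subtype.val (Option.some.inj h)
    simp only at this ⊢
    rw [← this]
    exact Set.mem_insert _ _
  · rintro (rfl | rfl)
    · rw [dif_pos hj]
    · rw [dif_pos (by rw [hπ]; exact hj.symm)]
      simp only [hπ, Set.pair_comm]

lemma toPair_eq_toPair {π : Equiv.Perm ι} (hπ : ∀ i, π (π i) = i) {i j : ι} (hi : π i ≠ i) :
    toPair π j = toPair π i ↔ j = i ∨ j = π i := by
  have : toPair π i = some ⟨{i, π i}, i, hi, rfl⟩ := dif_pos hi
  rw [this, toPair_eq_some hπ]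
  rfl

lemma card_toPair_fibre {π : Equiv.Perm ι} (hπ : ∀ i, π (π i) = i) (k : PairOf π) :
    Nat.card {i // toPair π i = some k} = 2 := by
  simp_rw [toPair_eq_some hπ]
  obtain ⟨s, j, hj, rfl⟩ := k
  exact Set.ncard_pair hj.symm

lemma exists_toPair_eq {π : Equiv.Perm ι} (k : PairOf π) :
    ∃ i, toPair π i = some k := by
  obtain ⟨s, j, hj, rfl⟩ := k
  exact ⟨j, dif_pos hj⟩

lemma card_pairOf_lt {π : Equiv.Perm ι} (hπ : ∀ i, π (π i) = i) {i₀ : ι} (h₀ : π i₀ ≠ i₀) :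
    Nat.card (PairOf π) < Nat.card ι := by
  choose s hs using exists_toPair_eq (π := π)
  have hinj : Function.Injective s := fun k k' h => by
    have := hs k
    rw [h, hs] at this
    exact (Option.some.inj this).symm
  let k₀ : PairOf π := ⟨{i₀, π i₀}, i₀, h₀, rfl⟩
  by_contra! hle
  have hbij := (Nat.bijective_iff_injective_and_card s).2
    ⟨hinj, le_antisymm (Nat.card_le_card_of_injective s hinj) hle⟩
  have hne : π (s k₀) ≠ s k₀ := fun h => by
    have := toPair_eq_none.2 h
    rw [hs] at this
    cases this
  obtain ⟨k, hk⟩ := hbij.2 (π (s k₀))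
  have h1 := (toPair_eq_toPair hπ hne).2 (Or.inr hk)
  rw [hs, hs] at h1
  rw [Option.some.inj h1] at hk
  exact hne hk.symm

lemma exists_perm_pairOf {π : Equiv.Perm ι} (hπ : ∀ i, π (π i) = i) {σ : Equiv.Perm ι}
    (h : ∀ i, σ (π i) = π (σ i)) :
    ∃ τ : Equiv.Perm (PairOf π), ∀ i, toPair π (σ i) = (toPair π i).map τ := by
  have h0 : ∀ i, toPair π (σ i) = none ↔ toPair π i = none := fun i => by
    rw [toPair_eq_none, toPair_eq_none, ← h, σ.apply_eq_iff_eq]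
  refine exists_induced_perm exists_toPair_eq (fun i j => ?_) h0
  by_cases hj : π j = j
  · rw [toPair_eq_none.2 hj, (h0 j).2 (toPair_eq_none.2 hj), h0]
  · rw [toPair_eq_toPair hπ hj, toPair_eq_toPair hπ (by rwa [← h, Ne, σ.apply_eq_iff_eq]),
      ← h, σ.apply_eq_iff_eq, σ.apply_eq_iff_eq]

end Pairs

/-- A Sylow `2`-subgroup of a symmetric group is self-normalizing. -/
theorem IsPGroup.mem_of_normalizing_perm {ι : Type*} [Finite ι] {T : Subgroup (Equiv.Perm ι)}
    (hT : IsPGroup 2 T) (hi : Odd T.index) {σ : Equiv.Perm ι} (hσ : ∀ τ ∈ T, σ * τ * σ⁻¹ ∈ T) :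
    σ ∈ T := by
  classical
  induction hn : Nat.card ι using Nat.strong_induction_on generalizing ι with
  | _ n ih =>
  obtain ⟨π, hπ, hfix, hV⟩ := exists_involutionGroup_le hi
  by_cases hex : ∃ i₀, π i₀ ≠ i₀
  swap
  · push Not at hex
    have : σ = 1 := Equiv.ext fun i => hfix _ _ (hex _) (hex _)
    rw [this]; exact T.one_mem
  obtain ⟨i₀, hi₀⟩ := hex
  have hcomm : ∀ σ : Equiv.Perm ι, (∀ τ ∈ T, σ * τ * σ⁻¹ ∈ T) → ∀ i, σ (π i) = π (σ i) :=
    fun σ hσ => apply_comm_of_normalizing hT hfix hV hσ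
  have hcommT : ∀ σ ∈ T, ∀ i, σ (π i) = π (σ i) := fun σ h => hcomm σ fun τ hτ =>
    T.mul_mem (T.mul_mem h hτ) (T.inv_mem h)
  obtain ⟨τ, hτ⟩ := exists_perm_pairOf hπ (hcomm σ hσ)
  have hinv : ∀ (σ : Equiv.Perm ι) (τ : Equiv.Perm (PairOf π)),
      (∀ i, toPair π (σ i) = (toPair π i).map τ) →
      ∀ i, toPair π (σ⁻¹ i) = (toPair π i).map ⇑τ⁻¹ := fun σ τ h =>
    (fibrePairs (toPair π)).inv_mem (x := ⟨σ, τ⟩) h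
  have hmem : τ ∈ inducedPerms (toPair π) T := by
    refine ih _ (hn ▸ card_pairOf_lt hπ hi₀)
      (isPGroup_inducedPerms exists_toPair_eq hT)
      (odd_index_inducedPerms (card_toPair_fibre hπ) hi
        fun σ h => exists_perm_pairOf hπ (hcommT σ h)) ?_ rfl
    intro τ' hτ'
    obtain ⟨σ', hσ', h'⟩ := mem_inducedPerms.1 hτ'
    refine mem_inducedPerms.2 ⟨_, hσ σ' hσ', fun i => ?_⟩
    rw [Equiv.Perm.mul_apply, Equiv.Perm.mul_apply, hτ, h', hinv _ _ hτ, Option.map_map,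
      Option.map_map]
    rfl
  obtain ⟨σ₁, hσ₁, h₁⟩ := mem_inducedPerms.1 hmem
  have hlast : σ * σ₁⁻¹ ∈ involutionGroup π hπ := by
    intro i
    have h2 : toPair π ((σ * σ₁⁻¹) i) = toPair π i := by
      rw [Equiv.Perm.mul_apply, hτ, hinv _ _ h₁, Option.map_map]
      have : (⇑τ ∘ ⇑τ⁻¹) = id := by funext k; simp
      rw [this, Option.map_id]; rfl
    by_cases hi' : π i = i
    · left
      rw [toPair_eq_none.2 hi', toPair_eq_none] at h2
      exact hfix _ _ h2 hi'
    · exact (toPair_eq_toPair hπ hi').1 h2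
  have := T.mul_mem (hV hlast) hσ₁
  rwa [inv_mul_cancel_right] at this

section Movers

variable {ι : Type*} [Finite ι] [DecidableEq ι]

lemma card_subtype_comp {κ : Type*} [Finite κ] {q : ι → κ} {m : ℕ}
    (hq : ∀ k, Nat.card {i // q i = k} = m) (P : κ → Prop) :
    Nat.card {i // P (q i)} = Nat.card {k // P k} * m := by
  have := Fintype.ofFinite {k // P k}
  rw [← Nat.card_congr (Equiv.sigmaSubtypeFiberEquivSubtype q (p := fun i => P (q i)) (q := P)
    fun i => Iff.rfl), Nat.card_sigma]
  simp [hq, Nat.card_eq_fintype_card]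

lemma swap_apply_mul (σ : Equiv.Perm ι) (i j : ι) :
    Equiv.swap (σ i) (σ j) = σ * Equiv.swap i j * σ⁻¹ := Equiv.swap_apply_apply σ i j

/-- The relation of being exchanged by a transposition in a permutation group. -/
def swapSetoid (X : Subgroup (Equiv.Perm ι)) : Setoid ι where
  r i j := Equiv.swap i j ∈ X
  iseqv := by
    refine ⟨fun i => ?_, fun {i j} h => ?_, fun {i j k} h h' => SubmonoidClass.swap_mem_trans X h h'⟩
    · rw [Equiv.swap_self]; exact X.one_mem
    · rwa [Equiv.swap_comm]

end Movers

/-- A transitive group of permutations of odd index moves a number of points out of a given proper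
subset which is prime to three, as soon as the size of the subset is. -/
theorem exists_card_movers {ι : Type*} [Finite ι] {X : Subgroup (Equiv.Perm ι)}
    (hX : Odd X.index) (ht : ∀ i j, ∃ σ ∈ X, σ i = j) {A : Set ι} (hA : ¬ 3 ∣ Nat.card A)
    (hA' : A ≠ Set.univ) : ∃ σ ∈ X, ¬ 3 ∣ Nat.card {i // i ∈ A ∧ σ i ∉ A} := by
  classical
  induction hn : Nat.card ι using Nat.strong_induction_on generalizing ι with
  | _ n ih =>
  have hne : A.Nonempty := by
    rw [Set.nonempty_iff_ne_empty]
    rintro rfl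
    simp at hA
  obtain ⟨a, ha⟩ := hne
  obtain ⟨b, hb⟩ := (Set.ne_univ_iff_exists_notMem A).1 hA'
  by_cases hmeet : ∃ i ∈ A, ∃ j ∉ A, Equiv.swap i j ∈ X
  · obtain ⟨i, hi, j, hj, h⟩ := hmeet
    refine ⟨_, h, ?_⟩
    have : Nat.card {k // k ∈ A ∧ Equiv.swap i j k ∉ A} = 1 := by
      rw [Nat.card_eq_one_iff_unique]
      refine ⟨⟨fun ⟨k, hk, hk'⟩ ⟨l, hl, hl'⟩ => ?_⟩, ⟨⟨i, hi, by rwa [Equiv.swap_apply_left]⟩⟩⟩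
      have key : ∀ k, k ∈ A → Equiv.swap i j k ∉ A → k = i := fun k hk hk' => by
        by_contra hki
        have hkj : k ≠ j := by rintro rfl; exact hj hk
        rw [Equiv.swap_apply_of_ne_of_ne hki hkj] at hk'
        exact hk' hk
      exact Subtype.ext ((key k hk hk').trans (key l hl hl').symm)
    rw [this]; norm_num
  push Not at hmeet
  let s := swapSetoid X
  let q : ι → Quotient s := Quotient.mk s
  have hqeq : ∀ i j, q i = q j ↔ Equiv.swap i j ∈ X := fun i j => Quotient.eq (r := s)
  have hqσ : ∀ σ ∈ X, ∀ i j, q (σ i) = q (σ j) ↔ q i = q j := fun σ hσ i j => by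
    rw [hqeq, hqeq, swap_apply_mul]
    constructor
    · intro h
      have := X.mul_mem (X.mul_mem (X.inv_mem hσ) h) hσ
      simpa [mul_assoc] using this
    · exact fun h => X.mul_mem (X.mul_mem hσ h) (X.inv_mem hσ)
  have hfib : ∀ k, Nat.card {i // q i = k} = Nat.card {i // q i = q a} := by
    intro k
    obtain ⟨c, rfl⟩ := Quotient.exists_rep k
    obtain ⟨σ, hσ, rfl⟩ := ht a c
    refine (Nat.card_congr (σ.subtypeEquiv fun i => ?_)).symm
    exact (hqσ σ hσ i a).symm
  set m := Nat.card {i // q i = q a} with hm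
  have hAq : ∀ i j, q i = q j → (i ∈ A ↔ j ∈ A) := fun i j h => by
    rw [hqeq] at h
    constructor
    · intro hi; by_contra hj; exact hmeet i hi j hj h
    · intro hj; by_contra hi; exact hmeet j hj i hi (by rwa [Equiv.swap_comm])
  let A' : Set (Quotient s) := {k | ∃ i ∈ A, q i = k}
  have hmemA' : ∀ i, q i ∈ A' ↔ i ∈ A := fun i =>
    ⟨fun ⟨j, hj, h⟩ => (hAq j i h).1 hj, fun h => ⟨i, h, rfl⟩⟩
  have hcard : ∀ P : Quotient s → Prop,
      Nat.card {i // P (q i)} = Nat.card {k // P k} * m := card_subtype_comp hfib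
  have hlt : Nat.card (Quotient s) < n := by
    obtain ⟨π, hπ, hfix, hV⟩ := exists_involutionGroup_le hX
    obtain ⟨i, hi⟩ : ∃ i, π i ≠ i := by
      by_contra! h
      exact hb (hfix a b (h a) (h b) ▸ ha)
    have hqi : q i = q (π i) := (hqeq _ _).2 (hV (swap_mem_involutionGroup π hπ i))
    rw [← hn]
    by_contra! hle
    have hbij := (Nat.bijective_iff_surjective_and_card q).2
      ⟨Quotient.mk_surjective, le_antisymm hle (Nat.card_le_card_of_surjective q Quotient.mk_surjective)⟩
    exact hi (hbij.1 hqi).symm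
  have hfib' : ∀ k, Nat.card {i // (fun i => some (q i)) i = some k} = m := fun k => by
    simp only [Option.some.injEq]
    exact hfib k
  have hind : ∀ σ ∈ X, ∃ τ : Equiv.Perm (Quotient s), ∀ i, some (q (σ i)) = (some (q i)).map τ :=
    fun σ hσ => exists_induced_perm (p := fun i => some (q i))
      (fun k => (Quotient.exists_rep k).imp fun i h => congrArg some h)
      (fun i j => by simpa using hqσ σ hσ i j) (fun i => by simp)
  obtain ⟨τ, hτ, h⟩ := ih _ hlt (odd_index_inducedPerms (p := fun i => some (q i)) hfib' hX hind)
    (fun k l => by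
      obtain ⟨i, rfl⟩ := Quotient.exists_rep k
      obtain ⟨j, rfl⟩ := Quotient.exists_rep l
      obtain ⟨σ, hσ, rfl⟩ := ht i j
      obtain ⟨τ, hτ⟩ := hind σ hσ
      exact ⟨τ, mem_inducedPerms.2 ⟨σ, hσ, hτ⟩, (Option.some.inj (hτ i)).symm⟩)
    (A := A') (fun h => hA (by
      have := hcard (· ∈ A')
      simp only [hmemA'] at this
      rw [show Nat.card A = Nat.card {i // i ∈ A} from rfl, this]
      exact Dvd.dvd.mul_right h m))
    (fun h => hb ((hmemA' b).1 (h ▸ Set.mem_univ _))) rfl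
  obtain ⟨σ, hσ, h'⟩ := mem_inducedPerms.1 hτ
  refine ⟨σ, hσ, fun h3 => ?_⟩
  have h1 := hcard (fun k => k ∈ A' ∧ τ k ∉ A')
  have h2 : ∀ i, (q i ∈ A' ∧ τ (q i) ∉ A') ↔ (i ∈ A ∧ σ i ∉ A) := fun i => by
    rw [← show q (σ i) = τ (q i) from Option.some.inj (h' i), hmemA', hmemA']
  simp only [h2] at h1
  rw [h1, Nat.prime_three.dvd_mul] at h3
  refine h3.elim h fun h3 => hA ?_
  have := hcard (· ∈ A')
  simp only [hmemA'] at this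
  rw [show Nat.card A = Nat.card {i // i ∈ A} from rfl, this]
  exact Dvd.dvd.mul_left h3 _

lemma odd_choose_iff_mod (n k : ℕ) :
    Odd (n.choose k) ↔ Odd ((n % 2).choose (k % 2) * (n / 2).choose (k / 2)) := by
  have : Fact (Nat.Prime 2) := ⟨Nat.prime_two⟩
  have h := Choose.choose_modEq_choose_mod_mul_choose_div_nat (p := 2) (n := n) (k := k)
  rw [Nat.odd_iff, Nat.odd_iff, h]

lemma odd_choose_two_mul (n k : ℕ) : Odd ((2 * n).choose (2 * k)) ↔ Odd (n.choose k) := by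
  rw [odd_choose_iff_mod]; simp

lemma odd_choose_two_mul_add_one (n k : ℕ) :
    Odd ((2 * n + 1).choose (2 * k)) ↔ Odd (n.choose k) := by
  rw [odd_choose_iff_mod, show (2 * n + 1) / 2 = n by omega]; simp

lemma odd_choose_two_mul_add_one_add_one (n k : ℕ) :
    Odd ((2 * n + 1).choose (2 * k + 1)) ↔ Odd (n.choose k) := by
  rw [odd_choose_iff_mod, show (2 * n + 1) / 2 = n by omega, show (2 * k + 1) / 2 = k by omega,
    show (2 * n + 1) % 2 = 1 by omega, show (2 * k + 1) % 2 = 1 by omega]; simp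

lemma odd_choose_two_pow {a b : ℕ} (h : a < b) : Odd ((2 ^ a + 2 ^ b).choose (2 ^ a)) := by
  induction a generalizing b with
  | zero =>
    obtain ⟨b, rfl⟩ := Nat.exists_eq_add_one.2 h
    rw [pow_zero, Nat.choose_one_right, pow_succ]
    exact ⟨2 ^ b, by ring⟩
  | succ a ih =>
    obtain ⟨b, rfl⟩ := Nat.exists_eq_add_one.2 (Nat.zero_lt_of_lt h)
    rw [show 2 ^ (a + 1) + 2 ^ (b + 1) = 2 * (2 ^ a + 2 ^ b) by ring,
      show 2 ^ (a + 1) = 2 * 2 ^ a by ring, odd_choose_two_mul]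
    exact ih (by omega)

section SetStab

variable {ι : Type*} [Finite ι]

/-- The permutations preserving a given set. -/
def setStab (A : Set ι) : Subgroup (Equiv.Perm ι) where
  carrier := {σ | ∀ i, σ i ∈ A ↔ i ∈ A}
  one_mem' := fun i => Iff.rfl
  mul_mem' := fun {x y} hx hy i => by rw [Equiv.Perm.mul_apply, hx, hy]
  inv_mem' := fun {x} hx i => by
    rw [← hx (x⁻¹ i), show x (x⁻¹ i) = i from x.apply_symm_apply i]

open scoped Pointwise in
lemma index_setStab (A : Set ι) :
    (setStab A).index = (Nat.card ι).choose (Nat.card A) := by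
  classical
  have := Fintype.ofFinite ι
  let s : Set.powersetCard ι (Nat.card A) := ⟨A.toFinset, by
    rw [Set.powersetCard.mem_iff, Set.toFinset_card, Nat.card_eq_fintype_card]⟩
  have := Set.powersetCard.isPretransitive (α := ι) (n := Nat.card A)
  have h1 := MulAction.index_stabilizer_of_transitive (Equiv.Perm ι) s
  rw [Set.powersetCard.card] at h1
  rw [← h1]
  congr 1
  ext σ
  rw [Set.powersetCard.stabilizer_coe]
  have hs : SetLike.coe s = A := Set.coe_toFinset A
  rw [hs, MulAction.mem_stabilizer_iff]
  constructor
  · intro h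
    ext i
    rw [Set.mem_smul_set]
    constructor
    · rintro ⟨j, hj, rfl⟩; exact (h j).2 hj
    · intro hi
      exact ⟨σ⁻¹ i, (h _).1 (by rwa [show σ (σ⁻¹ i) = i from σ.apply_symm_apply i]),
        σ.apply_symm_apply i⟩
  · intro h i
    conv_lhs => rw [← h]
    exact Set.smul_mem_smul_set_iff

lemma swap_mem_setStab [DecidableEq ι] {A : Set ι} {i j : ι} (h : i ∈ A ↔ j ∈ A) :
    Equiv.swap i j ∈ setStab A := fun k => by
  rw [Equiv.swap_apply_def]
  split_ifs with h1 h2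
  · rw [h1, h]
  · rw [h2, h]
  · rfl

lemma relIndex_stabilizer (Y : Subgroup (Equiv.Perm ι)) (i : ι) :
    (MulAction.stabilizer (Equiv.Perm ι) i).relIndex Y = Nat.card (MulAction.orbit Y i) := by
  rw [Nat.card_coe_set_eq, ← MulAction.index_stabilizer]
  rfl

/-- A subgroup of odd index has the same orbits of two-power length. -/
lemma exists_apply_eq_of_odd_relIndex {T Y : Subgroup (Equiv.Perm ι)} (hTY : T ≤ Y)
    (hodd : Odd (T.relIndex Y)) {i j : ι} {c : ℕ} (hc : Nat.card (MulAction.orbit Y i) = 2 ^ c)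
    (hj : ∃ σ ∈ Y, σ i = j) : ∃ σ ∈ T, σ i = j := by
  let S := MulAction.stabilizer (Equiv.Perm ι) i
  have h1 : (T ⊓ S).relIndex T * T.relIndex Y = (T ⊓ S).relIndex Y :=
    Subgroup.relIndex_mul_relIndex _ _ _ inf_le_left hTY
  have h2 : (T ⊓ S).relIndex (Y ⊓ S) * (Y ⊓ S).relIndex Y = (T ⊓ S).relIndex Y :=
    Subgroup.relIndex_mul_relIndex _ _ _ (inf_le_inf_right _ hTY) inf_le_left
  rw [Subgroup.inf_relIndex_left, relIndex_stabilizer] at h1 h2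
  have hdvd : 2 ^ c ∣ Nat.card (MulAction.orbit T i) := by
    refine Nat.Coprime.dvd_of_dvd_mul_right (Nat.Coprime.pow_left c ?_)
      (n := T.relIndex Y) ?_
    · exact Nat.coprime_two_left.2 hodd
    · rw [h1, ← h2, hc]; exact dvd_mul_left _ _
  have hsub : MulAction.orbit T i ⊆ MulAction.orbit Y i := by
    rintro _ ⟨σ, rfl⟩
    exact ⟨⟨σ.1, hTY σ.2⟩, rfl⟩
  have : Nonempty (MulAction.orbit T i) := ⟨⟨i, MulAction.mem_orbit_self i⟩⟩
  have heq := Set.eq_of_subset_of_ncard_le hsub (by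
    rw [← Nat.card_coe_set_eq, hc, ← Nat.card_coe_set_eq]
    exact Nat.le_of_dvd Nat.card_pos hdvd) (Set.toFinite _)
  obtain ⟨σ, hσ, rfl⟩ := hj
  have : σ i ∈ MulAction.orbit T i := heq ▸ ⟨⟨σ, hσ⟩, rfl⟩
  obtain ⟨⟨τ, hτ⟩, h⟩ := this
  exact ⟨τ, hτ, h⟩

lemma orbit_setStab (A : Set ι) {i : ι} (hi : i ∈ A) : MulAction.orbit (setStab A) i = A := by
  classical
  ext j
  constructor
  · rintro ⟨⟨σ, hσ⟩, rfl⟩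
    exact (hσ i).2 hi
  · intro hj
    exact ⟨⟨Equiv.swap i j, swap_mem_setStab (iff_of_true hi hj)⟩, Equiv.swap_apply_left i j⟩

lemma setStab_compl (A : Set ι) : setStab Aᶜ = setStab A := by
  ext σ
  exact forall_congr' fun i => not_iff_not

lemma exists_apply_eq_of_setStab {T : Subgroup (Equiv.Perm ι)} (hT : Odd T.index) {A : Set ι}
    (hTA : T ≤ setStab A) {c : ℕ} (hc : Nat.card A = 2 ^ c) {i j : ι} (hi : i ∈ A) (hj : j ∈ A) :
    ∃ σ ∈ T, σ i = j := by
  refine exists_apply_eq_of_odd_relIndex hTA (hT.of_dvd_nat (Subgroup.relIndex_dvd_index_of_le hTA))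
    (c := c) (by rw [orbit_setStab A hi, hc]) ?_
  rw [← orbit_setStab A hi] at hj
  obtain ⟨⟨τ, hτ⟩, h⟩ := hj
  exact ⟨τ, hτ, h⟩

lemma exists_apply_eq_of_card_two_pow {T : Subgroup (Equiv.Perm ι)} (hT : Odd T.index) {c : ℕ}
    (hc : Nat.card ι = 2 ^ c) (i j : ι) : ∃ σ ∈ T, σ i = j :=
  exists_apply_eq_of_setStab hT (A := Set.univ) (fun _ _ _ => by simp) (by simpa using hc)
    (Set.mem_univ i) (Set.mem_univ j)

lemma exists_two_orbits {T : Subgroup (Equiv.Perm ι)} (hT : IsMaxTwo T ⊤) {a b : ℕ} (hab : a < b)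
    (hc : Nat.card ι = 2 ^ a + 2 ^ b) : ∃ O : Set ι, Nat.card O = 2 ^ a ∧
      Nat.card (Oᶜ : Set ι) = 2 ^ b ∧ T ≤ setStab O := by
  have := Fintype.ofFinite ι
  obtain ⟨O, -, hO⟩ := Set.exists_subset_card_eq (s := (Set.univ : Set ι)) (n := 2 ^ a) (by
    rw [Set.ncard_univ, hc]; exact Nat.le_add_right _ _)
  have hodd : Odd (setStab O).index := by
    rw [index_setStab, hc, Nat.card_coe_set_eq, hO]
    exact odd_choose_two_pow hab
  obtain ⟨x, hx⟩ := hT.exists_conj_of_odd_index hodd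
  have hcard : Nat.card (x ⁻¹' O : Set ι) = 2 ^ a := by
    rw [Nat.card_coe_set_eq, Set.ncard_preimage_of_injective_subset_range x.injective
      (by rw [x.range_eq_univ]; exact Set.subset_univ _), hO]
  refine ⟨x ⁻¹' O, hcard, ?_, fun τ hτ i => ?_⟩
  · have := Set.ncard_add_ncard_compl (x ⁻¹' O : Set ι)
    rw [Nat.card_coe_set_eq] at hcard ⊢
    omega
  · have := hx τ hτ (x i)
    simpa using this

end SetStab

section Free

open Quaternion Matrix

variable {F : Type*} [Field F] {ι : Type*} [Fintype ι] [DecidableEq ι]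

lemma inv_smul_apply_of_smul_stdVec {k : UnitMat ι F} {a m : ι} {u : UnitQuat F}
    (h : k • stdVec F a = (stdVec F m).rsmul u) (z : UnitVec ι F) :
    (k⁻¹ • z) a = star (u : ℍ[F]) * z m := by
  have hent : ∀ p, k.1 p a = if p = m then (u : ℍ[F]) else 0 := fun p => by
    rw [← smul_stdVec_apply, h, UnitVec.rsmul_apply, stdVec_apply]
    split_ifs <;> simp
  rw [UnitVec.coe_smul]
  change (k.1ᴴ *ᵥ z.val) a = _
  simp only [mulVec, dotProduct, conjTranspose_apply, hent]
  rw [Finset.sum_eq_single m]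
  · rw [if_pos rfl]
  · intro p _ hp; rw [if_neg hp, star_zero, zero_mul]
  · simp

lemma UnitVec.eq_rsmul_of_support {y : UnitVec ι F} {m : ι} (h : ∀ p, p ≠ m → y p = 0) :
    ∃ q, y = (stdVec F m).rsmul q := by
  have h1 := y.sum_normSq
  rw [Finset.sum_eq_single m (fun p _ hp => by rw [h p hp, map_zero]) (by simp)] at h1
  refine ⟨⟨y m, mem_unitQuat_iff_normSq.2 h1⟩, UnitVec.ext fun p => ?_⟩
  rw [UnitVec.rsmul_apply, stdVec_apply]
  split_ifs with hp
  · rw [hp, one_mul]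
  · rw [h p hp, zero_mul]

lemma inv_smul_stdVec {k : UnitMat ι F} {a m : ι} {u : UnitQuat F}
    (h : k • stdVec F a = (stdVec F m).rsmul u) :
    k⁻¹ • stdVec F m = (stdVec F a).rsmul u⁻¹ := by
  rw [inv_smul_eq_iff, UnitVec.smul_rsmul, h, UnitVec.rsmul_rsmul, mul_inv_cancel,
    UnitVec.rsmul_one]

variable [NeZero (2 : F)] [Finite F]

/-- An index is free if it is not linked and its local group does not contain `ω`. -/
def IsFree (K : Subgroup (UnitMat ι F)) (a : ι) : Prop :=
  omega F ∉ localGroup K (stdVec F a) ∧ ∀ m, ¬ Linked K a m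

lemma IsRoot.linked_of_normSq (hns : ¬ IsSquare (2 : F)) {K : Subgroup (UnitMat ι F)}
    (hK : ∀ l : ι, IsRoot K (stdVec F l)) {y : UnitVec ι F} (hy : IsRoot K y) {a : ι}
    (ha : 2 * (normSq (y a) : F) = 1) : ∃ m, Linked K a m := by
  have h2 := NeZero.ne (2 : F)
  have hya : y a ≠ 0 := by
    intro h; rw [h, map_zero, mul_zero] at ha; exact zero_ne_one ha
  by_contra! hno
  have h0 : ∀ p, p ≠ a → y p = 0 := fun p hp => by
    by_contra hyp
    exact hno p (hy.suppLinked hns hK a p hya hyp hp.symm)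
  obtain ⟨q, rfl⟩ := UnitVec.eq_rsmul_of_support h0
  rw [UnitVec.rsmul_apply, stdVec_apply, if_pos rfl, one_mul, normSq_unit] at ha
  have : (1 : F) = 0 := by linear_combination ha
  exact one_ne_zero this

lemma mem_conj_of_mem {K : Subgroup (UnitMat ι F)} {h : UnitMat ι F}
    (hnorm : ∀ x ∈ K, h⁻¹ * x * h ∈ K) {a b : ι} {q : UnitQuat F}
    (hq : h • stdVec F a = (stdVec F b).rsmul q) {u : UnitQuat F}
    (hu : u ∈ localGroup K (stdVec F b)) : q⁻¹ * u * q ∈ localGroup K (stdVec F a) := by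
  have h1 := hnorm _ hu
  have h2 := conj_rootHom h⁻¹ (stdVec F b) u
  rw [inv_inv, inv_smul_stdVec hq, rootHom_rsmul, inv_inv] at h2
  rw [h2] at h1
  exact h1

lemma omega_mem_of_normalizing (hns : ¬ IsSquare (2 : F)) {K : Subgroup (UnitMat ι F)}
    (hK : ∀ l : ι, IsRoot K (stdVec F l)) {h : UnitMat ι F}
    (hnorm : ∀ x ∈ K, h⁻¹ * x * h ∈ K) {a b : ι} {q : UnitQuat F}
    (hq : h • stdVec F a = (stdVec F b).rsmul q) (hb : omega F ∈ localGroup K (stdVec F b)) :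
    omega F ∈ localGroup K (stdVec F a) := by
  have hmax : IsMaxTwo (quatGroup F) (localGroup K (stdVec F a)) :=
    (isMaxTwo_quatGroup hns).mono (hK a) le_top
  have hQ : IsPGroup 2 ((quatGroup F).map (MulAut.conj q⁻¹).toMonoidHom) :=
    isPGroup_quatGroup.map _
  obtain ⟨x, hx, hxQ⟩ := hmax.exists_conj (N := localGroup K (stdVec F a)) hQ (by
    rintro _ ⟨u, hu, rfl⟩
    have := mem_conj_of_mem hnorm hq (hK b u hu)
    simpa using this)
  have hn : ∀ u ∈ quatGroup F, x * q⁻¹ * u * (x * q⁻¹)⁻¹ ∈ quatGroup F := fun u hu => by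
    have := hxQ _ ⟨u, hu, rfl⟩
    simpa [mul_assoc] using this
  obtain ⟨e, he⟩ := exists_isCls hns hn
  have h1 := (he.mul (isCls_wpow (1 : ZMod 3))).mul he.inv
  rw [wpow_one, show e + 1 + -e = 1 by ring] at h1
  have h2 : x * q⁻¹ * omega F * (x * q⁻¹)⁻¹ ∈ localGroup K (stdVec F a) := by
    have := mul_mem (mul_mem hx (mem_conj_of_mem hnorm hq hb)) (inv_mem hx)
    simpa [mul_assoc] using this
  have h3 := hK a _ h1
  rw [wpow_one] at h3
  have h4 := mul_mem h2 (inv_mem (show _ ∈ localGroup K (stdVec F a) from h3))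
  simpa [mul_assoc] using h4

/-- A normalizing element maps free coordinates to free coordinates. -/
lemma IsFree.exists_smul_eq (hns : ¬ IsSquare (2 : F)) {K : Subgroup (UnitMat ι F)}
    (hK : ∀ l : ι, IsRoot K (stdVec F l)) {h : UnitMat ι F} (hnorm : ∀ x ∈ K, h * x * h⁻¹ ∈ K)
    (hnorm' : ∀ x ∈ K, h⁻¹ * x * h ∈ K) {a : ι} (ha : IsFree K a) :
    ∃ b, IsFree K b ∧ ∃ q, h • stdVec F a = (stdVec F b).rsmul q := by
  have hy : IsRoot K (h • stdVec F a) := (hK a).smul_of_normalizing hnorm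
  obtain ⟨k, hk, -, m, hm, u, hu⟩ := hy.exists_smul_eq_stdVec
    (D := {p | (h • stdVec F a) p ≠ 0}) (fun l hl => by simpa using hl) fun m _ => hK m
  have key : ∀ (k : UnitMat ι F), k ∈ K → ∀ (m : ι) (u : UnitQuat F),
      k • h • stdVec F a = (stdVec F m).rsmul u → ∀ m', ¬ Linked K m m' := by
    rintro k hk m u hu m' ⟨-, z, hz, -, hzm, -⟩
    rw [smul_smul] at hu
    have hz' : IsRoot K ((k * h)⁻¹ • z) := by
      refine hz.smul_of_normalizing fun x hx => ?_
      have := hnorm' _ (K.mul_mem (K.mul_mem (K.inv_mem hk) hx) hk)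
      simpa [mul_assoc] using this
    obtain ⟨m'', hm''⟩ := hz'.linked_of_normSq hns hK (a := a) (by
      rw [inv_smul_apply_of_smul_stdVec hu, map_mul, Quaternion.normSq_star, normSq_unit, one_mul,
        hzm])
    exact ha.2 _ hm''
  have hsupp : ∀ p, p ≠ m → (h • stdVec F a) p = 0 := fun p hp => by
    by_contra hne
    exact key k hk m u hu p (hy.suppLinked hns hK m p hm hne hp.symm)
  obtain ⟨q, hq⟩ := UnitVec.eq_rsmul_of_support hsupp
  refine ⟨m, ⟨fun hω => ha.1 (omega_mem_of_normalizing hns hK hnorm' hq hω), ?_⟩, q, hq⟩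
  exact key 1 K.one_mem m q (by rw [one_smul, hq])

end Free

section Commutator

open Quaternion Matrix

variable {F : Type*} [Field F] {ι : Type*} [Fintype ι] [DecidableEq ι]

lemma mon_smul_apply (σ : Equiv.Perm ι) (d : ι → UnitQuat F) (v : UnitVec ι F) (p : ι) :
    ((mon σ d : UnitMat ι F) • v) (σ p) = (d p : ℍ[F]) * v p := by
  rw [UnitVec.coe_smul]
  simp only [mulVec, dotProduct, coe_mon]
  rw [Finset.sum_eq_single p, if_pos rfl]
  · rintro b - hb
    rw [if_neg (fun h => hb (σ.injective h).symm), zero_mul]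
  · exact fun h => absurd (Finset.mem_univ p) h

lemma mon_one_smul_apply (d : ι → UnitQuat F) (v : UnitVec ι F) (p : ι) :
    ((mon 1 d : UnitMat ι F) • v) p = (d p : ℍ[F]) * v p :=
  mon_smul_apply 1 d v p

variable [NeZero (2 : F)]

lemma diagOmega_smul_stdVec (e : ι → ZMod 3) (l : ι) :
    diagOmega F e • stdVec F l = (stdVec F l).rsmul (wpow (e l)) := by
  rw [diagOmega, mon_smul_stdVec]; rfl

lemma smul_stdVec_apply_eq_zero {k : UnitMat ι F} {a b l : ι} {u : UnitQuat F}
    (h : k⁻¹ • stdVec F b = (stdVec F a).rsmul u) (hl : l ≠ a) : (k • stdVec F l) b = 0 := by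
  have := inv_smul_apply_of_smul_stdVec h (stdVec F l)
  rw [inv_inv] at this
  rw [this, stdVec_apply, if_neg hl.symm, mul_zero]

variable [Finite F]

lemma mul_comm_diagOmega_mem (hns : ¬ IsSquare (2 : F)) {A B : Subgroup (UnitMat ι F)}
    {T : Subgroup (Equiv.Perm ι)} (hSB : monGroup T (quatGroup F) ≤ B) {Ω : Set ι}
    {e : ι → ZMod 3} (he0 : ∀ a ∉ Ω, e a = 0)
    (hA : ∀ h ∈ A, ∀ a ∈ Ω, ∃ b ∈ Ω, ∃ q, h • stdVec F a = (stdVec F b).rsmul q ∧ e b = e a)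
    (hBn : ∀ h ∈ A, ∀ x ∈ B, h * x * h⁻¹ ∈ B)
    (hM : ∀ a, e a ≠ 0 → localGroup B (stdVec F a) ≤ quatGroup F)
    {h : UnitMat ι F} (hh : h ∈ A) : h⁻¹ * (diagOmega F e)⁻¹ * h * diagOmega F e ∈ B := by
  have key : ∀ l : ι, ∃ d ∈ quatGroup F,
      (h⁻¹ * (diagOmega F e)⁻¹ * h * diagOmega F e) • stdVec F l = (stdVec F l).rsmul d := by
    intro l
    by_cases hl : l ∈ Ω
    · obtain ⟨b, hb, q, hq, hbe⟩ := hA h hh l hl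
      refine ⟨q⁻¹ * (wpow (-(e b)) * (q * wpow (e l))), ?_, ?_⟩
      · rw [hbe]
        by_cases h0 : e l = 0
        · simp [h0, wpow_zero, one_mem]
        · have hqn : ∀ a ∈ quatGroup F, q * a * q⁻¹ ∈ quatGroup F := by
            intro a ha
            apply hM b (by rwa [hbe])
            rw [mem_localGroup]
            have h1 := hBn h hh (rootHom (stdVec F l) a)
              (hSB (stdVec_isRoot_monGroup T le_rfl l a ha))
            rwa [conj_rootHom, hq, rootHom_rsmul] at h1
          obtain ⟨c, hc⟩ := exists_isCls hns hqn
          have := hc.inv.mul ((isCls_wpow (-(e l))).mul (hc.mul (isCls_wpow (e l))))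
          rw [show -c + (-(e l) + (c + e l)) = 0 by ring, isCls_zero] at this
          exact this
      · rw [mul_smul, mul_smul, mul_smul, diagOmega_smul_stdVec, UnitVec.smul_rsmul, hq,
          UnitVec.rsmul_rsmul, UnitVec.smul_rsmul, ← diagOmega_neg, diagOmega_smul_stdVec,
          UnitVec.rsmul_rsmul, UnitVec.smul_rsmul, inv_smul_stdVec hq, UnitVec.rsmul_rsmul]
        rfl
    · refine ⟨1, one_mem _, ?_⟩
      rw [mul_smul, mul_smul, mul_smul, diagOmega_smul_stdVec, he0 l hl, wpow_zero,
        UnitVec.rsmul_one]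
      have hfix : (diagOmega F e)⁻¹ • h • stdVec F l = h • stdVec F l := by
        ext1 p
        rw [← diagOmega_neg, diagOmega, mon_one_smul_apply, Pi.neg_apply]
        by_cases hp : p ∈ Ω
        · obtain ⟨a, ha, q, hq, -⟩ := hA h⁻¹ (A.inv_mem hh) p hp
          rw [smul_stdVec_apply_eq_zero hq (by rintro rfl; exact hl ha), mul_zero]
        · rw [he0 p hp, neg_zero, wpow_zero]
          exact one_mul _
      rw [hfix, inv_smul_smul]
  choose d hd hk using key
  have : h⁻¹ * (diagOmega F e)⁻¹ * h * diagOmega F e = mon 1 d :=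
    UnitMat.ext_stdVec fun l => by rw [hk, mon_smul_stdVec]; rfl
  rw [this]
  exact hSB (mon_mem_monGroup.2 ⟨T.one_mem, hd⟩)

/-- If conjugation by `ω^e` keeps `B` inside `N`, the local groups of `B` at the free indices in
the support of `e` are quaternion. -/
lemma localGroup_le_quatGroup (hns : ¬ IsSquare (2 : F)) {B N : Subgroup (UnitMat ι F)}
    (hB : ∀ l : ι, IsRoot B (stdVec F l)) (hBN : B ≤ N) {e : ι → ZMod 3}
    (he : ∀ x ∈ B, (diagOmega F e)⁻¹ * x * diagOmega F e ∈ N) {a : ι}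
    (ha : omega F ∉ localGroup N (stdVec F a)) (hea : e a ≠ 0) :
    localGroup B (stdVec F a) ≤ quatGroup F := by
  refine le_quatGroup_of_wpow_conj hns (hB a) (Subgroup.comap_mono hBN) ha
    (e := -(e a)) (neg_ne_zero.2 hea) fun x hx => ?_
  have h1 := he _ hx
  have h2 := conj_rootHom (diagOmega F e)⁻¹ (stdVec F a) x
  rw [inv_inv] at h2
  rw [h2, ← diagOmega_neg, diagOmega_smul_stdVec, rootHom_rsmul] at h1
  exact h1

end Commutator

section Reduction

open Quaternion Matrix

variable {F : Type*} [Field F] {ι : Type*} [Fintype ι] [DecidableEq ι]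

lemma mon_one_mem_of_monGroup_le {T : Subgroup (Equiv.Perm ι)} {D : Subgroup (UnitQuat F)}
    {K : Subgroup (UnitMat ι F)} (hSK : monGroup T D ≤ K) {τ : Equiv.Perm ι} (hτ : τ ∈ T) :
    (mon τ 1 : UnitMat ι F) ∈ K :=
  hSK (mon_mem_monGroup.2 ⟨hτ, fun _ => D.one_mem⟩)

lemma Linked.perm {T : Subgroup (Equiv.Perm ι)} {D : Subgroup (UnitQuat F)}
    {K : Subgroup (UnitMat ι F)} (hSK : monGroup T D ≤ K) {τ : Equiv.Perm ι} (hτ : τ ∈ T)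
    {a b : ι} (h : Linked K a b) : Linked K (τ a) (τ b) := by
  obtain ⟨hab, z, hz, hz0, hza, hzb⟩ := h
  have happ : ∀ p, ((mon τ 1 : UnitMat ι F) • z) (τ p) = z p := fun p => by
    rw [mon_smul_apply]; exact one_mul _
  refine ⟨fun h => hab (τ.injective h), (mon τ 1 : UnitMat ι F) • z,
    hz.smul (mon_one_mem_of_monGroup_le hSK hτ), fun p hp hp' => ?_, ?_, ?_⟩
  · obtain ⟨p, rfl⟩ := τ.surjective p
    rw [happ]
    exact hz0 p (fun h => hp (h ▸ rfl)) (fun h => hp' (h ▸ rfl))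
  · rw [happ, hza]
  · rw [happ, hzb]

variable [NeZero (2 : F)]

lemma single_mem_code_perm {T : Subgroup (Equiv.Perm ι)} {D : Subgroup (UnitQuat F)}
    {K : Subgroup (UnitMat ι F)} (hSK : monGroup T D ≤ K) {τ : Equiv.Perm ι} (hτ : τ ∈ T)
    {a : ι} (h : Pi.single a 1 ∈ code K) : Pi.single (τ a) 1 ∈ code K := by
  rw [single_mem_code, mem_localGroup] at h ⊢
  have hm := mon_one_mem_of_monGroup_le hSK hτ
  have h1 := K.mul_mem (K.mul_mem hm h) (K.inv_mem hm)
  rw [conj_rootHom, mon_smul_stdVec, Pi.one_apply, UnitVec.rsmul_one] at h1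
  exact h1

lemma single_mem_code_perm_iff {T : Subgroup (Equiv.Perm ι)} {D : Subgroup (UnitQuat F)}
    {K : Subgroup (UnitMat ι F)} (hSK : monGroup T D ≤ K) {τ : Equiv.Perm ι} (hτ : τ ∈ T)
    {a : ι} : Pi.single (τ a) 1 ∈ code K ↔ Pi.single a 1 ∈ code K := by
  refine ⟨fun h => ?_, single_mem_code_perm hSK hτ⟩
  have := single_mem_code_perm hSK (T.inv_mem hτ) h
  rwa [show τ⁻¹ (τ a) = a from τ.symm_apply_apply a] at this

lemma IsFree.perm {T : Subgroup (Equiv.Perm ι)} {D : Subgroup (UnitQuat F)}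
    {K : Subgroup (UnitMat ι F)} (hSK : monGroup T D ≤ K) {τ : Equiv.Perm ι} (hτ : τ ∈ T)
    {a : ι} (h : IsFree K a) : IsFree K (τ a) := by
  obtain ⟨h1, h2⟩ := h
  rw [← single_mem_code] at h1
  refine ⟨by rwa [← single_mem_code, single_mem_code_perm_iff hSK hτ], fun m hm => ?_⟩
  have := hm.perm hSK (T.inv_mem hτ)
  rw [show τ⁻¹ (τ a) = a from τ.symm_apply_apply a] at this
  exact h2 _ this

variable [Finite F]

/-- Linked indices outside the code lie in the same orbit of `T` when `T` has two orbits of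
different sizes. -/
lemma Linked.mem_iff (hns : ¬ IsSquare (2 : F)) {K : Subgroup (UnitMat ι F)}
    {T : Subgroup (Equiv.Perm ι)} (hSK : monGroup T (quatGroup F) ≤ K) {P : Set ι}
    (hTP : T ≤ setStab P) (ht : ∀ i ∈ Pᶜ, ∀ j ∈ Pᶜ, ∃ σ ∈ T, σ i = j)
    (hc : Nat.card P < Nat.card (Pᶜ : Set ι)) {a b : ι} (h : Linked K a b)
    (ha1 : Pi.single a 1 ∉ code K) (ha : a ∈ P) : b ∈ P := by
  by_contra hb
  have hK : ∀ l : ι, IsRoot K (stdVec F l) := fun l => (stdVec_isRoot_monGroup T le_rfl l).mono hSK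
  choose! τ hτ hτb using fun c (hc : c ∈ Pᶜ) => ht b hb c hc
  let φ : (Pᶜ : Set ι) → P := fun c => ⟨τ c a, (hTP (hτ c c.2) a).2 ha⟩
  refine hc.not_ge (Nat.card_le_card_of_injective φ fun c c' hcc => ?_)
  by_contra hne
  have h1 := h.perm hSK (hτ c c.2)
  have h2 := h.perm hSK (hτ c' c'.2)
  have hcc' : τ c a = τ c' a := congrArg Subtype.val hcc
  rw [hτb c c.2] at h1
  rw [hτb c' c'.2, ← hcc'] at h2
  exact ha1 ((single_mem_code_perm_iff hSK (hτ c c.2)).1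
    (h1.single_mem_code hns hK h2 fun h => hne (Subtype.ext h)))

open Classical in
/-- The restriction of a `T`-invariant exponent vector to the indices that are not free belongs
to the code. -/
lemma restrict_mem_code (hns : ¬ IsSquare (2 : F)) {K : Subgroup (UnitMat ι F)}
    {T : Subgroup (Equiv.Perm ι)} (hSK : monGroup T (quatGroup F) ≤ K) {O : Set ι}
    (hTO : T ≤ setStab O) (ht : ∀ i ∈ Oᶜ, ∀ j ∈ Oᶜ, ∃ σ ∈ T, σ i = j)
    (ht' : ∀ i ∈ O, ∀ j ∈ O, ∃ σ ∈ T, σ i = j)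
    (hc : Nat.card O < Nat.card (Oᶜ : Set ι)) {e : ι → ZMod 3}
    (he : ∀ τ ∈ T, ∀ i, e (τ i) = e i) :
    (fun a => if IsFree K a then 0 else e a) ∈ code K := by
  have hK : ∀ l : ι, IsRoot K (stdVec F l) := fun l => (stdVec_isRoot_monGroup T le_rfl l).mono hSK
  have hO : ∀ i ∈ O, ∀ j ∈ O, e i = e j := fun i hi j hj => by
    obtain ⟨τ, hτ, rfl⟩ := ht' i hi j hj
    exact (he τ hτ i).symm
  have hO' : ∀ i ∈ Oᶜ, ∀ j ∈ Oᶜ, e i = e j := fun i hi j hj => by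
    obtain ⟨τ, hτ, rfl⟩ := ht i hi j hj
    exact (he τ hτ i).symm
  have hpair : ∀ {a b}, Linked K a b → Pi.single a 1 ∉ code K → Pi.single b 1 ∉ code K := by
    intro a b h ha hb
    exact ha (by simpa using (code K).sub_mem (h.mem_code hns hK) hb)
  have heq : ∀ {a b}, Linked K a b → Pi.single a 1 ∉ code K → e b = e a := by
    intro a b h ha
    by_cases haO : a ∈ O
    · exact hO _ (h.mem_iff hns hSK hTO ht hc ha haO) _ haO
    · by_cases hbO : b ∈ O
      · exact absurd (h.symm.mem_iff hns hSK hTO ht hc (hpair h ha) hbO) haO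
      · exact hO' _ hbO _ haO
  let Z : Finset ι := Finset.univ.filter fun a => ¬ IsFree K a ∧ Pi.single a 1 ∉ code K
  have hex : ∀ a, a ∈ Z → ∃ b, Linked K a b := by
    intro a ha
    obtain ⟨h1, h2⟩ := (Finset.mem_filter.1 ha).2
    by_contra! hno
    exact h1 ⟨by rwa [← single_mem_code], hno⟩
  choose! p hp using hex
  have hZn : ∀ a ∈ Z, Pi.single a 1 ∉ code K := fun a ha => ((Finset.mem_filter.1 ha).2).2
  have hpZ : ∀ a ∈ Z, p a ∈ Z := fun a ha => Finset.mem_filter.2 ⟨Finset.mem_univ _,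
    fun hf => hf.2 _ (hp a ha).symm, hpair (hp a ha) (hZn a ha)⟩
  have hpp : ∀ a ∈ Z, p (p a) = a := fun a ha => by
    by_contra hne
    exact hpair (hp a ha) (hZn a ha)
      ((hp _ (hpZ a ha)).single_mem_code hns hK (hp a ha).symm hne)
  have hsum : ∑ a ∈ Z, e a • (Pi.single (p a) 1 : ι → ZMod 3) = ∑ a ∈ Z, e a • Pi.single a 1 := by
    refine Finset.sum_nbij' p p hpZ hpZ hpp hpp fun a ha => ?_
    rw [heq (hp a ha) (hZn a ha)]
  have hZ : ∑ a ∈ Z, e a • (Pi.single a 1 : ι → ZMod 3) ∈ code K := by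
    have h1 : ∑ a ∈ Z, e a • ((Pi.single a 1 : ι → ZMod 3) + Pi.single (p a) 1) ∈ code K :=
      (code K).sum_mem fun a ha => (code K).smul_mem _ ((hp a ha).mem_code hns hK)
    simp only [smul_add, Finset.sum_add_distrib] at h1
    rw [hsum] at h1
    have h2 := (code K).smul_mem 2 h1
    rwa [← two_smul (ZMod 3), smul_smul, show (2 : ZMod 3) * 2 = 1 by decide, one_smul] at h2
  have hY : ∑ a ∈ Finset.univ.filter (fun a => ¬ IsFree K a ∧ Pi.single a 1 ∈ code K),
      e a • (Pi.single a 1 : ι → ZMod 3) ∈ code K :=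
    (code K).sum_mem fun a ha => (code K).smul_mem _ (Finset.mem_filter.1 ha).2.2
  convert (code K).add_mem hZ hY using 1
  funext l
  simp only [Z, Finset.sum_filter, Pi.add_apply, Finset.sum_apply]
  rw [Finset.sum_eq_single l, Finset.sum_eq_single l]
  · by_cases h1 : IsFree K l <;> by_cases h2 : Pi.single l 1 ∈ code K <;> simp [h1, h2]
  · intro b _ hb
    split_ifs <;> simp [hb.symm]
  · simp
  · intro b _ hb
    split_ifs <;> simp [hb.symm]
  · simp

end Reduction

section Averaging

variable {ι : Type*} [Fintype ι] [DecidableEq ι]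

/-- Averaging `e - e ∘ σ` over `T` produces a vector of the submodule `C` whose addition makes `e`
constant. -/
lemma exists_mem_add_const {T : Subgroup (Equiv.Perm ι)} (hT2 : IsPGroup 2 T) {O : Set ι}
    (hTO : T ≤ setStab O) (ht : ∀ i ∈ Oᶜ, ∀ j ∈ Oᶜ, ∃ σ ∈ T, σ i = j)
    (ht' : ∀ i ∈ O, ∀ j ∈ O, ∃ σ ∈ T, σ i = j) (hO3 : ¬ 3 ∣ Nat.card O)
    (hO : Nat.card O ≡ Nat.card (Oᶜ : Set ι) [MOD 3]) {C : Submodule (ZMod 3) (ι → ZMod 3)}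
    (hC : ∀ f ∈ C, ∀ τ ∈ T, f ∘ τ ∈ C) {e : ι → ZMod 3} {c₁ c₂ : ZMod 3} (hne : c₁ ≠ c₂)
    (h₁ : ∀ i ∈ O, e i = c₁) (h₂ : ∀ i ∉ O, e i = c₂) {σ : Equiv.Perm ι}
    (hσ : ¬ 3 ∣ Nat.card {i // i ∈ O ∧ σ i ∉ O}) (hf : e - e ∘ σ ∈ C) :
    ∃ f ∈ C, ∃ c, ∀ i, e i + f i = c := by
  classical
  let f := e - e ∘ σ
  let G : ι → ZMod 3 := ∑ τ : T, f ∘ (τ : Equiv.Perm ι)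
  have hG : G ∈ C := C.sum_mem fun τ _ => hC f hf τ τ.2
  have hGapp : ∀ i, G i = ∑ τ : T, f ((τ : Equiv.Perm ι) i) := fun i => by
    simp [G, Finset.sum_apply]
  have hGT : ∀ τ ∈ T, ∀ i, G (τ i) = G i := fun τ hτ i => by
    rw [hGapp, hGapp]
    exact Fintype.sum_equiv (Equiv.mulRight (⟨τ, hτ⟩ : T)) _ _ fun ρ => rfl
  have hTc : (Fintype.card T : ZMod 3) ≠ 0 := by
    rw [Ne, ZMod.natCast_eq_zero_iff]
    obtain ⟨k, hk⟩ := IsPGroup.iff_card.1 hT2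
    rw [← Nat.card_eq_fintype_card, hk]
    intro h
    have := Nat.Prime.dvd_of_dvd_pow Nat.prime_three h
    omega
  have hOcard : ∀ P : Set ι, (Nat.card P : ZMod 3) = ∑ i : ι, if i ∈ P then 1 else 0 := fun P => by
    rw [Finset.sum_boole, Nat.card_eq_fintype_card, Fintype.card_subtype]
  have hOne : (Nat.card O : ZMod 3) ≠ 0 := by rwa [Ne, ZMod.natCast_eq_zero_iff]
  have hOeq : (Nat.card O : ZMod 3) = (Nat.card (Oᶜ : Set ι) : ZMod 3) :=
    (ZMod.natCast_eq_natCast_iff _ _ _).2 hO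
  obtain ⟨i₀, hi₀⟩ : O.Nonempty := by
    rw [Set.nonempty_iff_ne_empty]; rintro rfl; simp at hO3
  obtain ⟨j₀, hj₀⟩ : (Oᶜ : Set ι).Nonempty := by
    rw [Set.nonempty_iff_ne_empty]; intro h
    rw [hOeq, h] at hOne; simp at hOne
  have hu : ∀ i ∈ O, G i = G i₀ := fun i hi => by
    obtain ⟨τ, hτ, rfl⟩ := ht' i₀ hi₀ i hi
    exact hGT τ hτ _
  have hv : ∀ i ∉ O, G i = G j₀ := fun i hi => by
    obtain ⟨τ, hτ, rfl⟩ := ht j₀ hj₀ i hi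
    exact hGT τ hτ _
  have hfsum : ∑ i, f i = 0 := by
    simp only [f, Pi.sub_apply, Finset.sum_sub_distrib, Function.comp]
    rw [Equiv.sum_comp σ e, sub_self]
  have hGsum : ∑ i, G i = 0 := by
    simp only [hGapp]
    rw [Finset.sum_comm]
    refine Finset.sum_eq_zero fun τ _ => ?_
    rw [Equiv.sum_comp (τ : Equiv.Perm ι) f, hfsum]
  have hGsum' : ∑ i, G i = Nat.card O * G i₀ + Nat.card (Oᶜ : Set ι) * G j₀ := by
    rw [hOcard, hOcard, Finset.sum_mul, Finset.sum_mul, ← Finset.sum_add_distrib]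
    refine Finset.sum_congr rfl fun i _ => ?_
    by_cases hi : i ∈ O
    · simp [hi, hu i hi]
    · simp [hi, hv i hi]
  have huv : G j₀ = - G i₀ := by
    rw [hGsum', ← hOeq, ← mul_add] at hGsum
    exact eq_neg_of_add_eq_zero_right ((mul_eq_zero.1 hGsum).resolve_left hOne)
  have hfO : ∑ i, (if i ∈ O then f i else 0) =
      (c₁ - c₂) * (Nat.card {i // i ∈ O ∧ σ i ∉ O} : ZMod 3) := by
    have := hOcard {i | i ∈ O ∧ σ i ∉ O}
    rw [show Nat.card {i // i ∈ O ∧ σ i ∉ O} = Nat.card ({i | i ∈ O ∧ σ i ∉ O} : Set ι) from rfl,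
      this, Finset.mul_sum]
    refine Finset.sum_congr rfl fun i _ => ?_
    by_cases hi : i ∈ O
    · by_cases hi' : σ i ∈ O
      · simp [hi, hi', f, h₁ i hi, h₁ _ hi']
      · simp [hi, hi', f, h₁ i hi, h₂ _ hi']
    · simp [hi]
  have hGO : ∑ i, (if i ∈ O then G i else 0) =
      Fintype.card T * ((c₁ - c₂) * (Nat.card {i // i ∈ O ∧ σ i ∉ O} : ZMod 3)) := by
    have h1 : ∀ i, (if i ∈ O then G i else 0) =
        ∑ τ : T, if i ∈ O then f ((τ : Equiv.Perm ι) i) else 0 := fun i => by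
      split_ifs
      · exact hGapp i
      · simp
    simp only [h1]
    rw [Finset.sum_comm, ← hfO, ← nsmul_eq_mul, Fintype.card, ← Finset.sum_const]
    refine Finset.sum_congr rfl fun τ _ => ?_
    rw [← Equiv.sum_comp (τ : Equiv.Perm ι) (fun i => if i ∈ O then f i else 0)]
    refine Finset.sum_congr rfl fun i _ => ?_
    simp only [hTO τ.2 i]
  have hu0 : G i₀ ≠ 0 := by
    intro h
    have h1 : ∑ i, (if i ∈ O then G i else 0) = 0 := Finset.sum_eq_zero fun i _ => by
      split_ifs with hi
      · rw [hu i hi, h]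
      · rfl
    rw [hGO] at h1
    refine mul_ne_zero hTc (mul_ne_zero (sub_ne_zero.2 hne) ?_) h1
    rwa [Ne, ZMod.natCast_eq_zero_iff]
  refine ⟨((c₁ - c₂) / G i₀) • G, C.smul_mem _ hG, 2 * c₁ - c₂, fun i => ?_⟩
  rw [Pi.smul_apply, smul_eq_mul]
  by_cases hi : i ∈ O
  · rw [hu i hi, h₁ i hi, div_mul_cancel₀ _ hu0]; ring
  · rw [hv i hi, h₂ i hi, huv, mul_neg, div_mul_cancel₀ _ hu0]
    have : (3 : ZMod 3) = 0 := by decide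
    linear_combination (c₂ - c₁) * this

/-- An odd-index overgroup of `T` normalized by a permutation not stabilizing the smaller `T`-orbit
is transitive. -/
lemma exists_apply_eq_of_not_mem_setStab {T X : Subgroup (Equiv.Perm ι)} {O : Set ι}
    (ht : ∀ i ∈ Oᶜ, ∀ j ∈ Oᶜ, ∃ σ ∈ T, σ i = j)
    (ht' : ∀ i ∈ O, ∀ j ∈ O, ∃ σ ∈ T, σ i = j) (hc : Nat.card O < Nat.card (Oᶜ : Set ι))
    (hTX : T ≤ X) {ρ : Equiv.Perm ι} (hρ : ρ ∉ setStab O) (hρX : ∀ σ ∈ X, ρ * σ * ρ⁻¹ ∈ X)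
    (i j : ι) : ∃ σ ∈ X, σ i = j := by
  classical
  obtain ⟨σ, hσ, i₀, hi₀, hσi₀⟩ : ∃ σ ∈ X, ∃ i ∈ O, σ i ∉ O := by
    by_contra! hno
    have hXO : X ≤ setStab O := fun σ hσ i => ⟨fun h => by
      have := hno σ⁻¹ (X.inv_mem hσ) _ h
      rwa [show σ⁻¹ (σ i) = i from σ.symm_apply_apply i] at this, hno σ hσ i⟩
    have hP : ∀ τ ∈ T, ∀ i, ρ (τ i) ∈ O ↔ ρ i ∈ O := fun τ hτ i => by
      have := hXO (hρX τ (hTX hτ)) (ρ i)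
      simpa using this
    let P : Set ι := {i | ρ i ∈ O}
    have hPc : Nat.card P = Nat.card O :=
      Nat.card_congr (ρ.subtypeEquiv fun i => Iff.rfl)
    have hPO : P ⊆ O := fun i hi => by
      by_contra hiO
      refine hc.not_ge (hPc ▸ Nat.card_mono (Set.toFinite _) fun j hj => ?_)
      obtain ⟨τ, hτ, rfl⟩ := ht i hiO j hj
      exact (hP τ hτ i).2 hi
    have hPe : P = O := Set.eq_of_subset_of_ncard_le hPO hPc.ge (Set.toFinite _)
    exact hρ fun i => Set.ext_iff.1 hPe i
  have key : ∀ y, ∃ ρ ∈ X, ρ i₀ = y := fun y => by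
    by_cases hy : y ∈ O
    · obtain ⟨τ, hτ, rfl⟩ := ht' i₀ hi₀ y hy
      exact ⟨τ, hTX hτ, rfl⟩
    · obtain ⟨τ, hτ, rfl⟩ := ht _ hσi₀ y hy
      exact ⟨τ * σ, X.mul_mem (hTX hτ) hσ, rfl⟩
  obtain ⟨α, hα, rfl⟩ := key i
  obtain ⟨β, hβ, rfl⟩ := key j
  exact ⟨β * α⁻¹, X.mul_mem hβ (X.inv_mem hα), by simp⟩

end Averaging

section Local

open Quaternion Matrix

variable {F : Type*} [Field F] {ι : Type*} [Fintype ι] [DecidableEq ι]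

/-- The permutations underlying the monomial matrices in `K`. -/
def permsOf (K : Subgroup (UnitMat ι F)) : Subgroup (Equiv.Perm ι) where
  carrier := {σ | ∃ d, mon σ d ∈ K}
  one_mem' := ⟨1, by
    have := K.one_mem
    rwa [← mon_one] at this⟩
  mul_mem' := fun {x y} ⟨d, hd⟩ ⟨d', hd'⟩ => ⟨_, by
    have := K.mul_mem hd hd'
    rwa [mon_mul_mon] at this⟩
  inv_mem' := fun {x} ⟨d, hd⟩ => ⟨_, by
    have := K.inv_mem hd
    rwa [mon_inv] at this⟩

/-- The standing hypotheses of the local argument: `B` and `N` are overgroups of the Sylow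
subgroup `monGroup T Q`, both normalized by `A`, and `T` has two orbits of different sizes (one of
them possibly empty). -/
structure IsLocal (T : Subgroup (Equiv.Perm ι)) (O : Set ι) (A B N : Subgroup (UnitMat ι F)) :
    Prop where
  isMaxTwo : IsMaxTwo T ⊤
  le_setStab : T ≤ setStab O
  trans_compl : ∀ i ∈ Oᶜ, ∀ j ∈ Oᶜ, ∃ σ ∈ T, σ i = j
  trans : ∀ i ∈ O, ∀ j ∈ O, ∃ σ ∈ T, σ i = j
  card_lt : Nat.card O < Nat.card (Oᶜ : Set ι)
  card_mod : O.Nonempty → ¬ 3 ∣ Nat.card O ∧ Nat.card O ≡ Nat.card (Oᶜ : Set ι) [MOD 3]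
  mon_le : monGroup T (quatGroup F) ≤ B
  le_left : B ≤ A
  le_right : B ≤ N
  normal : ∀ h ∈ A, ∀ x ∈ B, h * x * h⁻¹ ∈ B
  normalizes : ∀ h ∈ A, ∀ x ∈ N, h * x * h⁻¹ ∈ N

variable [NeZero (2 : F)] [Finite F] {T : Subgroup (Equiv.Perm ι)} {O : Set ι}
  {A B N : Subgroup (UnitMat ι F)}

lemma IsLocal.isRoot (hL : IsLocal T O A B N) (l : ι) : IsRoot B (stdVec F l) :=
  (stdVec_isRoot_monGroup T le_rfl l).mono hL.mon_le

lemma IsLocal.exists_smul_eq (hL : IsLocal T O A B N) (hns : ¬ IsSquare (2 : F))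
    {h : UnitMat ι F} (hh : h ∈ A) {a : ι} (ha : IsFree N a) :
    ∃ b, IsFree N b ∧ ∃ q, h • stdVec F a = (stdVec F b).rsmul q :=
  IsFree.exists_smul_eq hns (fun l => (hL.isRoot l).mono hL.le_right) (hL.normalizes h hh)
    (fun x hx => by simpa using hL.normalizes h⁻¹ (A.inv_mem hh) x hx) ha

lemma IsLocal.comm_mem (hL : IsLocal T O A B N) (hns : ¬ IsSquare (2 : F)) {e : ι → ZMod 3}
    (he : ∀ x ∈ B, (diagOmega F e)⁻¹ * x * diagOmega F e ∈ N)
    (he0 : ∀ a, ¬ IsFree N a → e a = 0)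
    (hc : ∀ h ∈ A, ∀ a b q, IsFree N a → IsFree N b →
      h • stdVec F a = (stdVec F b).rsmul q → e b = e a)
    {h : UnitMat ι F} (hh : h ∈ A) : h⁻¹ * (diagOmega F e)⁻¹ * h * diagOmega F e ∈ B := by
  refine mul_comm_diagOmega_mem hns hL.mon_le (Ω := {a | IsFree N a}) (fun a ha => he0 a ha)
    (fun h hh a ha => ?_) hL.normal (fun a ha => ?_) hh
  · obtain ⟨b, hb, q, hq⟩ := hL.exists_smul_eq hns hh ha
    exact ⟨b, hb, q, hq, hc h hh a b q ha hb hq⟩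
  · refine localGroup_le_quatGroup hns hL.isRoot hL.le_right he (a := a) ?_ ha
    by_contra h1
    exact ha (he0 a fun hf => hf.1 h1)

lemma conj_diagOmega_add_mem {e f : ι → ZMod 3}
    (he : ∀ x ∈ B, (diagOmega F e)⁻¹ * x * diagOmega F e ∈ N) (hf : f ∈ code N) :
    ∀ x ∈ B, (diagOmega F (e + f))⁻¹ * x * diagOmega F (e + f) ∈ N := fun x hx => by
  rw [diagOmega_add]
  have := N.mul_mem (N.mul_mem (N.inv_mem hf) (he x hx)) hf
  rw [_root_.mem_code] at hf
  simpa [mul_assoc] using this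

lemma exists_comm_of_add {e f : ι → ZMod 3} (hf : f ∈ code N)
    (h : ∃ k ∈ N, ∀ h ∈ A, h⁻¹ * (diagOmega F (e + f) * k)⁻¹ * h * (diagOmega F (e + f) * k) ∈ B) :
    ∃ k ∈ N, ∀ h ∈ A, h⁻¹ * (diagOmega F e * k)⁻¹ * h * (diagOmega F e * k) ∈ B := by
  obtain ⟨k, hk, h⟩ := h
  refine ⟨diagOmega F f * k, N.mul_mem hf hk, fun x hx => ?_⟩
  rw [← mul_assoc (diagOmega F e), ← diagOmega_add]
  exact h x hx

lemma comp_mem_code (hN : monGroup T (quatGroup F) ≤ N) {f : ι → ZMod 3} (hf : f ∈ code N)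
    {τ : Equiv.Perm ι} (hτ : τ ∈ T) : f ∘ τ ∈ code N := by
  rw [_root_.mem_code] at hf ⊢
  have hm := mon_one_mem_of_monGroup_le hN hτ
  have := N.mul_mem (N.mul_mem (N.inv_mem hm) hf) hm
  have he : diagOmega F (f ∘ τ) = (mon τ 1)⁻¹ * diagOmega F f * mon τ 1 := by
    rw [mul_assoc, eq_inv_mul_iff_mul_eq, diagOmega, diagOmega, mon_mul_mon, mon_mul_mon, mul_one,
      one_mul]
    congr 1
    funext q
    simp
  rwa [he]

/-- When every index is free and the permutations from `B` do not stabilize `O`, a code vector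
makes `e` constant. -/
lemma IsLocal.exists_code_add_const (hL : IsLocal T O A B N) (hns : ¬ IsSquare (2 : F))
    {e : ι → ZMod 3} (he : ∀ x ∈ B, (diagOmega F e)⁻¹ * x * diagOmega F e ∈ N)
    (heT : ∀ τ ∈ T, ∀ i, e (τ i) = e i) (hfree : ∀ a, IsFree N a) (hO : O.Nonempty)
    {a₀ b₀ : ι} (hne : e a₀ ≠ e b₀)
    (htX : ∀ i j, ∃ σ ∈ permsOf B, σ i = j) :
    ∃ f ∈ code N, ∃ c, ∀ i, e i + f i = c := by
  have hO1 : ∀ i ∈ O, ∀ j ∈ O, e i = e j := fun i hi j hj => by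
    obtain ⟨τ, hτ, rfl⟩ := hL.trans i hi j hj
    exact (heT τ hτ i).symm
  have hO2 : ∀ i ∉ O, ∀ j ∉ O, e i = e j := fun i hi j hj => by
    obtain ⟨τ, hτ, rfl⟩ := hL.trans_compl i hi j hj
    exact (heT τ hτ i).symm
  obtain ⟨hO3, hOm⟩ := hL.card_mod hO
  obtain ⟨i₀, hi₀⟩ := hO
  have hOu : O ≠ Set.univ := by
    rintro rfl
    have := hL.card_lt
    simp at this
  obtain ⟨j₀, hj₀⟩ := (Set.ne_univ_iff_exists_notMem O).1 hOu
  have hij : e i₀ ≠ e j₀ := fun h => by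
    have : ∀ i, e i = e i₀ := fun i => by
      by_cases hi : i ∈ O
      · exact hO1 i hi _ hi₀
      · rw [h]; exact hO2 i hi _ hj₀
    exact hne (by rw [this a₀, this b₀])
  obtain ⟨a, ha⟩ : ∃ a, e a ≠ 0 := by
    by_contra! h; exact hij (by rw [h, h])
  have hMa : localGroup B (stdVec F a) ≤ quatGroup F :=
    localGroup_le_quatGroup hns hL.isRoot hL.le_right he (hfree a).1 ha
  have hBB : ∀ h ∈ B, ∀ x ∈ B, h * x * h⁻¹ ∈ B := fun h hh x hx =>
    B.mul_mem (B.mul_mem hh hx) (B.inv_mem hh)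
  have hBB' : ∀ h ∈ B, ∀ x ∈ B, h⁻¹ * x * h ∈ B := fun h hh x hx =>
    B.mul_mem (B.mul_mem (B.inv_mem hh) hx) hh
  have hMb : ∀ b, localGroup B (stdVec F b) ≤ quatGroup F := fun b => by
    obtain ⟨σ, ⟨d, hd⟩, rfl⟩ := htX a b
    have hs := mon_smul_stdVec (F := F) σ d a
    have hq : ∀ u ∈ localGroup B (stdVec F (σ a)), (d a)⁻¹ * u * d a ∈ quatGroup F :=
      fun u hu => hMa (mem_conj_of_mem (hBB' _ hd) hs hu)
    obtain ⟨c, hc⟩ := exists_isCls hns (u := (d a)⁻¹) fun u hu => by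
      rw [inv_inv]; exact hq u (hL.isRoot _ u hu)
    intro u hu
    have := hc.inv.conj_mem (hq u hu)
    rw [inv_inv] at this
    simpa [mul_assoc] using this
  have hcls : ∀ σ d, (mon σ d : UnitMat ι F) ∈ B → ∀ l, ∃ c, IsCls (d l) c := fun σ d hd l => by
    obtain ⟨c, hc⟩ := exists_isCls hns (u := (d l)⁻¹) fun u hu => by
      rw [inv_inv]
      exact hMb l (mem_conj_of_mem (hBB' _ hd) (mon_smul_stdVec (F := F) σ d l)
        (hL.isRoot _ u hu))
    exact ⟨-c, by simpa using hc.inv⟩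
  have hTX : T ≤ permsOf B := fun τ hτ => ⟨1, mon_one_mem_of_monGroup_le hL.mon_le hτ⟩
  obtain ⟨σ, ⟨d, hd⟩, hσ⟩ := exists_card_movers (hL.isMaxTwo.odd_index hTX) htX hO3 hOu
  have hSN : monGroup T (quatGroup F) ≤ N := hL.mon_le.trans hL.le_right
  refine exists_mem_add_const (hL.isMaxTwo.isPGroup) hL.le_setStab hL.trans_compl hL.trans hO3
    hOm (fun f hf τ hτ => comp_mem_code hSN hf hτ) hij (fun i hi => hO1 i hi _ hi₀)
    (fun i hi => hO2 i hi _ hj₀) hσ ?_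
  have h1 : (mon σ d)⁻¹ * (diagOmega F e)⁻¹ * mon σ d * diagOmega F e ∈ N := by
    have := N.mul_mem (N.inv_mem (hL.le_right hd)) (he _ hd)
    simpa [mul_assoc] using this
  have h2 : ∀ l, ((mon σ d)⁻¹ * (diagOmega F e)⁻¹ * mon σ d * diagOmega F e) • stdVec F l =
      (stdVec F l).rsmul ((d l)⁻¹ * (wpow (-(e (σ l))) * (d l * wpow (e l)))) := fun l => by
    rw [mul_smul, mul_smul, mul_smul, diagOmega_smul_stdVec, UnitVec.smul_rsmul, mon_smul_stdVec,
      UnitVec.rsmul_rsmul, UnitVec.smul_rsmul, ← diagOmega_neg, diagOmega_smul_stdVec,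
      UnitVec.rsmul_rsmul, UnitVec.smul_rsmul, inv_smul_stdVec (mon_smul_stdVec σ d l),
      UnitVec.rsmul_rsmul]
    rfl
  have h3 : (mon σ d)⁻¹ * (diagOmega F e)⁻¹ * mon σ d * diagOmega F e =
      mon 1 (fun l => (d l)⁻¹ * (wpow (-(e (σ l))) * (d l * wpow (e l)))) :=
    UnitMat.ext_stdVec fun l => by rw [h2, mon_smul_stdVec]; rfl
  have h4 : ∀ l, IsCls ((d l)⁻¹ * (wpow (-(e (σ l))) * (d l * wpow (e l)))) ((e - e ∘ σ) l) :=
    fun l => by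
      obtain ⟨c, hc⟩ := hcls σ d hd l
      have := hc.inv.mul ((isCls_wpow (-(e (σ l)))).mul (hc.mul (isCls_wpow (e l))))
      convert this using 1
      simp only [Pi.sub_apply, Function.comp]; ring
  rw [h3] at h1
  rw [_root_.mem_code]
  have h5 : diagOmega F (e - e ∘ σ) = mon 1 (fun l => (d l)⁻¹ * (wpow (-(e (σ l))) *
      (d l * wpow (e l)))) * (mon 1 (fun l => (wpow ((e - e ∘ σ) l))⁻¹ *
        ((d l)⁻¹ * (wpow (-(e (σ l))) * (d l * wpow (e l)))) ))⁻¹ := by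
    rw [eq_mul_inv_iff_mul_eq, diagOmega, mon_mul_mon, mul_one]
    congr 1
    funext l
    exact mul_inv_cancel_left _ _
  rw [h5]
  exact N.mul_mem h1 (N.inv_mem (hSN (mon_mem_monGroup.2 ⟨T.one_mem, h4⟩)))

theorem IsLocal.exists_comm_diagOmega (hL : IsLocal T O A B N) (hns : ¬ IsSquare (2 : F))
    {e : ι → ZMod 3} (he : ∀ x ∈ B, (diagOmega F e)⁻¹ * x * diagOmega F e ∈ N)
    (heT : ∀ τ ∈ T, ∀ i, e (τ i) = e i) :
    ∃ k ∈ N, ∀ h ∈ A, h⁻¹ * (diagOmega F e * k)⁻¹ * h * (diagOmega F e * k) ∈ B := by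
  classical
  have hSN : monGroup T (quatGroup F) ≤ N := hL.mon_le.trans hL.le_right
  have hf := (code N).neg_mem (restrict_mem_code hns hSN hL.le_setStab hL.trans_compl hL.trans
    hL.card_lt heT)
  refine exists_comm_of_add hf ?_
  have he1 := conj_diagOmega_add_mem he hf
  set e₁ : ι → ZMod 3 := e + -(fun a => if IsFree N a then 0 else e a) with he₁
  have he0 : ∀ a, ¬ IsFree N a → e₁ a = 0 := fun a ha => by simp [he₁, ha]
  have heF : ∀ a, IsFree N a → e₁ a = e a := fun a ha => by simp [he₁, ha]
  have hfT : ∀ τ ∈ T, ∀ i, IsFree N i → IsFree N (τ i) := fun τ hτ i hi => hi.perm hSN hτ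
  by_cases hc : ∀ h ∈ A, ∀ a b q, IsFree N a → IsFree N b →
      h • stdVec F a = (stdVec F b).rsmul q → e₁ b = e₁ a
  · refine ⟨1, N.one_mem, fun h hh => ?_⟩
    rw [mul_one]
    exact hL.comm_mem hns he1 he0 hc hh
  push Not at hc
  obtain ⟨h₀, hh₀, a₀, b₀, q₀, ha₀, hb₀, hq₀, hne⟩ := hc
  rw [heF _ ha₀, heF _ hb₀] at hne
  have hO1 : ∀ i ∈ O, ∀ j ∈ O, e i = e j := fun i hi j hj => by
    obtain ⟨τ, hτ, rfl⟩ := hL.trans i hi j hj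
    exact (heT τ hτ i).symm
  have hO2 : ∀ i ∉ O, ∀ j ∉ O, e i = e j := fun i hi j hj => by
    obtain ⟨τ, hτ, rfl⟩ := hL.trans_compl i hi j hj
    exact (heT τ hτ i).symm
  have hab : ¬ (b₀ ∈ O ↔ a₀ ∈ O) := fun h => by
    by_cases ha : a₀ ∈ O
    · exact hne (hO1 _ (h.2 ha) _ ha)
    · exact hne (hO2 _ (fun hb => ha (h.1 hb)) _ ha)
  obtain ⟨x, hx, hxO⟩ : ∃ x, IsFree N x ∧ x ∈ O := by
    by_cases ha : a₀ ∈ O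
    · exact ⟨_, ha₀, ha⟩
    · exact ⟨_, hb₀, by tauto⟩
  obtain ⟨y, hy, hyO⟩ : ∃ x, IsFree N x ∧ x ∉ O := by
    by_cases ha : a₀ ∈ O
    · exact ⟨_, hb₀, by tauto⟩
    · exact ⟨_, ha₀, ha⟩
  have hfree : ∀ a, IsFree N a := fun a => by
    by_cases ha : a ∈ O
    · obtain ⟨τ, hτ, rfl⟩ := hL.trans x hxO a ha
      exact hfT τ hτ _ hx
    · obtain ⟨τ, hτ, rfl⟩ := hL.trans_compl y hyO a ha
      exact hfT τ hτ _ hy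
  have hee : e₁ = e := funext fun a => heF a (hfree a)
  rw [hee] at he1 ⊢
  obtain ⟨σ₀, d₀, rfl⟩ := mem_monGroup_top.1 (mem_monGroup_of_stdVec (k := h₀) fun l => by
    obtain ⟨b, -, q, hq⟩ := hL.exists_smul_eq hns hh₀ (hfree l)
    exact ⟨b, q, hq⟩)
  rw [mon_smul_stdVec] at hq₀
  have hσ₀ : σ₀ a₀ = b₀ := (stdVec_rsmul_inj hq₀).1
  have hTX : T ≤ permsOf B := fun τ hτ => ⟨1, mon_one_mem_of_monGroup_le hL.mon_le hτ⟩
  have htX := exists_apply_eq_of_not_mem_setStab hL.trans_compl hL.trans hL.card_lt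
    hTX (ρ := σ₀) (fun h => hab (hσ₀ ▸ h a₀)) (fun σ ⟨d, hd⟩ => by
      have := hL.normal _ hh₀ _ hd
      rw [mon_inv, mon_mul_mon, mon_mul_mon] at this
      exact ⟨_, this⟩)
  obtain ⟨f, hf', c, hfc⟩ := hL.exists_code_add_const hns he heT hfree ⟨x, hxO⟩ hne.symm htX
  refine exists_comm_of_add hf' ⟨1, N.one_mem, fun h hh => ?_⟩
  rw [mul_one]
  exact hL.comm_mem hns (conj_diagOmega_add_mem he hf')
    (fun a ha => absurd (hfree a) ha)
    (fun h hh a b q _ _ _ => by rw [Pi.add_apply, Pi.add_apply, hfc, hfc]) hh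

end Local

/-- The commutator condition on a maximal `2`-subgroup `S` of `U` that allows Frattini-type
arguments to be carried out factor by factor in direct products. -/
structure HasLocalProperty {U : Type*} [Group U] (S : Subgroup U) : Prop where
  isMaxTwo : IsMaxTwo S ⊤
  exists_comm : ∀ A B N : Subgroup U, S ≤ B → B ≤ A → B ≤ N → (∀ h ∈ A, ∀ x ∈ B, h * x * h⁻¹ ∈ B) →
    (∀ h ∈ A, ∀ x ∈ N, h * x * h⁻¹ ∈ N) → ∀ g, (∀ x ∈ S, g * x * g⁻¹ ∈ S) →
    (∀ x ∈ B, g⁻¹ * x * g ∈ N) → ∃ k ∈ N, ∀ h ∈ A, h⁻¹ * (g * k)⁻¹ * h * (g * k) ∈ B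

lemma exists_orbit_of_card {ι : Type*} [Finite ι] {T : Subgroup (Equiv.Perm ι)}
    (hT : IsMaxTwo T ⊤)
    (hn : (∃ w, Nat.card ι = 2 ^ w) ∨ ∃ w k, Nat.card ι = 2 ^ w * (2 ^ (2 * k) + 1)) :
    ∃ O : Set ι, T ≤ setStab O ∧ (∀ i ∈ Oᶜ, ∀ j ∈ Oᶜ, ∃ σ ∈ T, σ i = j) ∧
      (∀ i ∈ O, ∀ j ∈ O, ∃ σ ∈ T, σ i = j) ∧ Nat.card O < Nat.card (Oᶜ : Set ι) ∧
      (O.Nonempty → ¬ 3 ∣ Nat.card O ∧ Nat.card O ≡ Nat.card (Oᶜ : Set ι) [MOD 3]) := by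
  have hodd : Odd T.index := hT.odd_index le_rfl
  have hpow : ∀ w, Nat.card ι = 2 ^ w → ∃ O : Set ι, T ≤ setStab O ∧
      (∀ i ∈ Oᶜ, ∀ j ∈ Oᶜ, ∃ σ ∈ T, σ i = j) ∧
      (∀ i ∈ O, ∀ j ∈ O, ∃ σ ∈ T, σ i = j) ∧ Nat.card O < Nat.card (Oᶜ : Set ι) ∧
      (O.Nonempty → ¬ 3 ∣ Nat.card O ∧ Nat.card O ≡ Nat.card (Oᶜ : Set ι) [MOD 3]) := by
    intro w hw
    refine ⟨∅, fun σ _ i => by simp, fun i _ j _ => exists_apply_eq_of_card_two_pow hodd hw i j,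
      fun i hi => hi.elim, ?_, fun h => absurd h (by simp)⟩
    rw [Set.compl_empty]
    simp [hw]
  obtain ⟨w, hw⟩ | ⟨w, k, hk⟩ := hn
  · exact hpow w hw
  · obtain _ | k := k
    · exact hpow (w + 1) (by rw [hk, pow_succ]; simp)
    · obtain ⟨O, h1, h2, h3⟩ := exists_two_orbits hT (a := w) (b := w + 2 * (k + 1)) (by omega)
        (by rw [hk, pow_add]; ring)
      refine ⟨O, h3, fun i hi j hj => exists_apply_eq_of_setStab hodd (by rwa [setStab_compl]) h2
        hi hj, fun i hi j hj => exists_apply_eq_of_setStab hodd h3 h1 hi hj, ?_, fun _ => ⟨?_, ?_⟩⟩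
      · rw [h1, h2]
        exact Nat.pow_lt_pow_right (by norm_num) (by omega)
      · rw [h1]
        intro h
        have := Nat.Prime.dvd_of_dvd_pow Nat.prime_three h
        omega
      · rw [h1, h2, pow_add, pow_mul]
        have h4 : (2 ^ 2) ^ (k + 1) ≡ 1 ^ (k + 1) [MOD 3] := Nat.ModEq.pow _ rfl
        rw [one_pow] at h4
        simpa using (Nat.ModEq.mul_left (2 ^ w) h4).symm

section

open Quaternion Matrix

variable {F : Type*} [Field F] {ι : Type*} [Fintype ι] [DecidableEq ι] [NeZero (2 : F)] [Finite F]

lemma exists_hasLocalProperty_of_isSquare (hs : IsSquare (2 : F)) :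
    ∃ S : Subgroup (UnitMat ι F), HasLocalProperty S := by
  have hT : IsMaxTwo ((default : Sylow 2 (Equiv.Perm ι)) : Subgroup (Equiv.Perm ι)) ⊤ :=
    Sylow.isMaxTwo _
  obtain ⟨T, hTe⟩ : ∃ T, T = ((default : Sylow 2 (Equiv.Perm ι)) : Subgroup (Equiv.Perm ι)) :=
    ⟨_, rfl⟩
  rw [← hTe] at hT
  have : Fact (Nat.Prime 2) := ⟨Nat.prime_two⟩
  refine ⟨monGroup T (bigQuatGroup F), isMaxTwo_monGroup hT (isMaxTwo_bigQuatGroup hs)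
    quatGroup_le_bigQuatGroup, fun A B N hSB _ hBN _ _ g hg _ => ?_⟩
  obtain ⟨σ, hσ, d, hd, rfl⟩ := eq_mon_of_normalizing (fun σ h =>
    hT.isPGroup.mem_of_normalizing_perm (hT.odd_index le_rfl) h) quatGroup_le_bigQuatGroup hg
  have : (mon σ d : UnitMat ι F) ∈ monGroup T (bigQuatGroup F) :=
    mon_mem_monGroup.2 ⟨hσ, fun l => mem_bigQuatGroup_of_normalizing hs (hd l)⟩
  refine ⟨(mon σ d)⁻¹, N.inv_mem (hBN (hSB this)), fun h _ => ?_⟩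
  simp [B.one_mem]

lemma exists_hasLocalProperty_of_not_isSquare (hns : ¬ IsSquare (2 : F))
    (hn : (∃ w, Nat.card ι = 2 ^ w) ∨ ∃ w k, Nat.card ι = 2 ^ w * (2 ^ (2 * k) + 1)) :
    ∃ S : Subgroup (UnitMat ι F), HasLocalProperty S := by
  have hT : IsMaxTwo ((default : Sylow 2 (Equiv.Perm ι)) : Subgroup (Equiv.Perm ι)) ⊤ :=
    Sylow.isMaxTwo _
  obtain ⟨T, hTe⟩ : ∃ T, T = ((default : Sylow 2 (Equiv.Perm ι)) : Subgroup (Equiv.Perm ι)) :=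
    ⟨_, rfl⟩
  rw [← hTe] at hT
  have : Fact (Nat.Prime 2) := ⟨Nat.prime_two⟩
  obtain ⟨O, hO1, hO2, hO3, hO4, hO5⟩ := exists_orbit_of_card hT hn
  refine ⟨monGroup T (quatGroup F), isMaxTwo_monGroup hT (isMaxTwo_quatGroup hns) le_rfl,
    fun A B N hSB hBA hBN hAB hAN g hg hgN => ?_⟩
  have hL : IsLocal T O A B N := ⟨hT, hO1, hO2, hO3, hO4, hO5, hSB, hBA, hBN, hAB, hAN⟩
  obtain ⟨σ, hσ, d, hd, hgm⟩ := eq_mon_of_normalizing (fun σ h =>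
    hT.isPGroup.mem_of_normalizing_perm (hT.odd_index le_rfl) h) le_rfl hg
  choose c hc using fun l => exists_isCls hns (hd l)
  let e : ι → ZMod 3 := fun l => c (σ⁻¹ l)
  let s : UnitMat ι F := mon σ fun l => (wpow (c l))⁻¹ * d l
  have hs : s ∈ monGroup T (quatGroup F) := mon_mem_monGroup.2 ⟨hσ, hc⟩
  have hge : g = diagOmega F e * s := by
    rw [hgm, diagOmega, mon_mul_mon, one_mul]
    congr 1
    funext l
    simp [e]
  have heS : ∀ x ∈ monGroup T (quatGroup F),
      diagOmega F e * x * (diagOmega F e)⁻¹ ∈ monGroup T (quatGroup F) := fun x hx => by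
    have := hg (s⁻¹ * x * s) (mul_mem (mul_mem (inv_mem hs) hx) hs)
    rw [hge] at this
    simpa [mul_assoc] using this
  have heT : ∀ τ ∈ T, ∀ i, e (τ i) = e i := fun τ hτ i => by
    have h1 := heS _ (mon_one_mem_of_monGroup_le le_rfl hτ)
    rw [diagOmega, mon_inv, mon_mul_mon, mon_mul_mon, mon_mem_monGroup] at h1
    have h2 := h1.2 i
    simp only [inv_one, Equiv.Perm.one_apply, Pi.one_apply, mul_one] at h2
    rw [← wpow_neg, ← wpow_add, wpow_mem_iff, ← sub_eq_add_neg, sub_eq_zero] at h2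
    exact h2
  obtain ⟨k, hk, hkA⟩ := hL.exists_comm_diagOmega hns (e := e) (fun x hx => by
    have h1 := hgN x hx
    rw [hge] at h1
    have h2 := mul_mem (mul_mem (hBN (hSB hs)) h1) (inv_mem (hBN (hSB hs)))
    simpa [mul_assoc] using h2) heT
  refine ⟨s⁻¹ * k, N.mul_mem (N.inv_mem (hBN (hSB hs))) hk, fun h hh => ?_⟩
  have : g * (s⁻¹ * k) = diagOmega F e * k := by rw [hge]; group
  rw [this]
  exact hkA h hh

end

section Pronormal

variable {G : Type*} [Group G]

lemma map_conj_apply_hom {G' : Type*} [Group G'] (φ : G →* G') (H : Subgroup G) (g : G) :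
    (H.map (MulAut.conj g).toMonoidHom).map φ =
      (H.map φ).map (MulAut.conj (φ g)).toMonoidHom := by
  rw [Subgroup.map_map, Subgroup.map_map]
  congr 1
  ext x
  simp

lemma IsPronormal.map {G' : Type*} [Group G'] {H : Subgroup G} (h : IsPronormal H) {φ : G →* G'}
    (hφ : Function.Surjective φ) : IsPronormal (H.map φ) := fun g' => by
  obtain ⟨g, rfl⟩ := hφ g'
  obtain ⟨x, hx, hxg⟩ := h g
  refine ⟨φ x, ?_, ?_⟩
  · rw [← map_conj_apply_hom, ← Subgroup.map_sup]
    exact Subgroup.mem_map_of_mem _ hx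
  · rw [← map_conj_apply_hom, ← map_conj_apply_hom, hxg]

/-- Pronormality of all subgroups of odd index passes to quotients. -/
lemma isPronormal_of_surjective {G' : Type*} [Group G']
    (h : ∀ H : Subgroup G, Odd H.index → IsPronormal H) {φ : G →* G'}
    (hφ : Function.Surjective φ) {H : Subgroup G'} (hH : Odd H.index) : IsPronormal H := by
  have := (h (H.comap φ) (by rwa [Subgroup.index_comap_of_surjective _ hφ])).map hφ
  rwa [Subgroup.map_comap_eq_self_of_surjective hφ] at this

lemma map_conj_eq_iff [Finite G] {H : Subgroup G} {x g : G} :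
    H.map (MulAut.conj x).toMonoidHom = H.map (MulAut.conj g).toMonoidHom ↔
      ∀ h ∈ H, (g⁻¹ * x) * h * (g⁻¹ * x)⁻¹ ∈ H := by
  constructor
  · intro he h hh
    have h1 : x * h * x⁻¹ ∈ H.map (MulAut.conj g).toMonoidHom := by
      rw [← he]; exact ⟨h, hh, rfl⟩
    obtain ⟨y, hy, hyx⟩ := h1
    have h2 : g * y * g⁻¹ = x * h * x⁻¹ := hyx
    rw [show g⁻¹ * x * h * (g⁻¹ * x)⁻¹ = g⁻¹ * (x * h * x⁻¹) * g by group, ← h2]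
    simpa [mul_assoc] using hy
  · intro h
    refine Subgroup.eq_of_le_of_card_ge ?_ ?_
    · rintro _ ⟨y, hy, rfl⟩
      refine ⟨_, h y hy, ?_⟩
      simp [mul_assoc]
    · rw [Subgroup.card_map_of_injective (MulAut.conj g).injective,
        Subgroup.card_map_of_injective (MulAut.conj x).injective]

variable {η : Type*} [Finite η] {U : η → Type*} [∀ i, Group (U i)]

lemma isPGroup_pi {p : ℕ} {S : ∀ i, Subgroup (U i)} (h : ∀ i, IsPGroup p (S i)) :
    IsPGroup p (Subgroup.pi Set.univ S) := by
  classical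
  have := Fintype.ofFinite η
  rintro ⟨x, hx⟩
  choose k hk using fun i => h i ⟨x i, hx i trivial⟩
  refine ⟨∑ i, k i, Subtype.ext (funext fun i => ?_)⟩
  have h1 : x i ^ p ^ k i = 1 := congrArg Subtype.val (hk i)
  change x i ^ p ^ (∑ i, k i) = 1
  rw [← Finset.add_sum_erase _ _ (Finset.mem_univ i), pow_add, pow_mul, h1, one_pow]

lemma isMaxTwo_pi {S : ∀ i, Subgroup (U i)} (h : ∀ i, IsMaxTwo (S i) ⊤) :
    IsMaxTwo (Subgroup.pi Set.univ S) ⊤ := by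
  classical
  refine ⟨le_top, isPGroup_pi fun i => (h i).isPGroup, fun R hR _ hR2 x hx i _ => ?_⟩
  refine (h i).max (R.map (Pi.evalMonoidHom U i)) (fun y hy => ?_) le_top (hR2.map _) ⟨x, hx, rfl⟩
  refine ⟨Pi.mulSingle i y, hR ((Subgroup.mulSingle_mem_pi i y).2 fun _ => hy), ?_⟩
  simp

/-- The local property of the factors gives pronormality of the subgroups of odd index of a direct
product. -/
theorem isPronormal_pi [∀ i, Finite (U i)] {S : ∀ i, Subgroup (U i)}
    (hS : ∀ i, HasLocalProperty (S i)) {H : Subgroup (∀ i, U i)} (hH : Odd H.index) :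
    IsPronormal H := by
  classical
  have hmax := isMaxTwo_pi fun i => (hS i).isMaxTwo
  obtain ⟨x, hx⟩ := hmax.exists_conj_of_odd_index hH
  suffices h : IsPronormal (H.map (MulAut.conj x⁻¹).toMonoidHom) by
    have h1 := h.map (φ := (MulAut.conj x).toMonoidHom) (MulAut.conj x).surjective
    convert! h1
    rw [Subgroup.map_map]
    ext y
    simp [mul_assoc]
  have hSH : Subgroup.pi Set.univ S ≤ H.map (MulAut.conj x⁻¹).toMonoidHom := fun y hy =>
    ⟨_, hx y hy, by simp [mul_assoc]⟩
  generalize H.map (MulAut.conj x⁻¹).toMonoidHom = H' at hSH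
  clear hx x hH H
  intro g
  obtain ⟨K, hK⟩ : ∃ K, K = H' ⊔ H'.map (MulAut.conj g).toMonoidHom := ⟨_, rfl⟩
  rw [← hK]
  have hHK : H' ≤ K := hK ▸ le_sup_left
  have hgK : ∀ h ∈ H', g * h * g⁻¹ ∈ K := fun h hh => by
    rw [hK]; exact Subgroup.mem_sup_right ⟨h, hh, rfl⟩
  obtain ⟨y, hy, hyS⟩ := (hmax.mono (hSH.trans hHK) le_top).exists_conj
    (R := (Subgroup.pi Set.univ S).map (MulAut.conj g).toMonoidHom) (hmax.isPGroup.map _) (by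
      rintro _ ⟨s, hs, rfl⟩
      exact hgK s (hSH hs))
  have hn : ∀ s ∈ Subgroup.pi Set.univ S, (g⁻¹ * y⁻¹) * s * (g⁻¹ * y⁻¹)⁻¹ ∈
      Subgroup.pi Set.univ S := by
    rw [← map_conj_eq_iff, eq_comm]
    rw [map_conj_eq_iff]
    intro s hs
    have := hyS _ ⟨s, hs, rfl⟩
    simpa [mul_assoc] using this
  have key : ∀ i, ∃ k : U i, Pi.mulSingle i k ∈ K ∧ ∀ h ∈ H',
      Pi.mulSingle i ((h i)⁻¹ * ((g⁻¹ * y⁻¹) i * k)⁻¹ * h i * ((g⁻¹ * y⁻¹) i * k)) ∈ H' := by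
    intro i
    have hconj : ∀ (h : ∀ i, U i) (x : U i),
        h * Pi.mulSingle i x * h⁻¹ = Pi.mulSingle i (h i * x * (h i)⁻¹) := fun h x => by
      funext j
      by_cases hj : j = i
      · subst hj; simp
      · simp [hj]
    obtain ⟨k, hk, hkH⟩ := (hS i).exists_comm (H'.map (Pi.evalMonoidHom U i))
      (H'.comap (MonoidHom.mulSingle U i)) (K.comap (MonoidHom.mulSingle U i))
      (fun s hs => hSH ((Subgroup.mulSingle_mem_pi i s).2 fun _ => hs))
      (fun b hb => ⟨_, hb, by simp⟩) (Subgroup.comap_mono hHK)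
      (by
        rintro _ ⟨h, hh, rfl⟩ x hx
        have := H'.mul_mem (H'.mul_mem hh hx) (H'.inv_mem hh)
        rw [MonoidHom.mulSingle_apply, hconj] at this
        exact this)
      (by
        rintro _ ⟨h, hh, rfl⟩ x hx
        have := K.mul_mem (K.mul_mem (hHK hh) hx) (K.inv_mem (hHK hh))
        rw [MonoidHom.mulSingle_apply, hconj] at this
        exact this)
      ((g⁻¹ * y⁻¹) i)
      (fun s hs => by
        have := hn _ ((Subgroup.mulSingle_mem_pi i s).2 fun _ => hs)
        rw [hconj] at this
        simpa using this i trivial)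
      (fun b hb => by
        have := K.mul_mem (K.mul_mem hy (hgK _ hb)) (K.inv_mem hy)
        rw [MonoidHom.mulSingle_apply, hconj, hconj] at this
        rw [Subgroup.mem_comap, MonoidHom.mulSingle_apply,
          show ((g⁻¹ * y⁻¹) i)⁻¹ * b * (g⁻¹ * y⁻¹) i = y i * (g i * b * (g i)⁻¹) * (y i)⁻¹ by
            simp [mul_assoc]]
        exact this)
    exact ⟨k, hk, fun h hh => hkH _ ⟨h, hh, rfl⟩⟩
  choose k hkK hkH using key
  refine ⟨y⁻¹ * k, K.mul_mem (K.inv_mem hy) (Subgroup.pi_mem_of_mulSingle_mem k hkK), ?_⟩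
  rw [eq_comm, map_conj_eq_iff]
  intro h hh
  have h1 : h⁻¹ * ((g⁻¹ * y⁻¹) * k)⁻¹ * h * ((g⁻¹ * y⁻¹) * k) ∈ H' :=
    Subgroup.pi_mem_of_mulSingle_mem _ fun i => hkH i h hh
  have h2 := H'.mul_mem hh h1
  convert h2 using 1
  group

end Pronormal

section Symplectic

open Quaternion Matrix

variable {F : Type*} [Field F]

/-- The additive map on quaternions with values `a, b, c, d` at `1, i, j, k`. -/
def quatFunctional (a b c d : F) : ℍ[F] →+ F where
  toFun z := z.re * a + z.imI * b + z.imJ * c + z.imK * d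
  map_zero' := by simp
  map_add' z w := by simp; ring

lemma quatFunctional_apply (a b c d : F) (z : ℍ[F]) :
    quatFunctional a b c d z = z.re * a + z.imI * b + z.imJ * c + z.imK * d := rfl

variable {ι : Type*} [Fintype ι] [DecidableEq ι]

/-- The matrix over `F` of twice the size attached to a quaternionic matrix by the splitting of the
quaternion algebra given by a solution of `x ^ 2 + y ^ 2 = -1`. -/
def splitMat (x y : F) (A : Matrix ι ι ℍ[F]) : Matrix (ι ⊕ ι) (ι ⊕ ι) F :=
  fromBlocks (A.map (quatFunctional 1 0 x y)) (A.map (quatFunctional 0 1 y (-x)))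
    (A.map (quatFunctional 0 (-1) y (-x))) (A.map (quatFunctional 1 0 (-x) (-y)))

lemma splitMat_one (x y : F) : splitMat x y (1 : Matrix ι ι ℍ[F]) = 1 := by
  rw [← fromBlocks_one, splitMat, fromBlocks_inj]
  refine ⟨?_, ?_, ?_, ?_⟩ <;> ext p q <;> by_cases h : p = q <;>
    simp [h, Matrix.one_apply, quatFunctional_apply]

lemma splitMat_mul {x y : F} (hxy : x ^ 2 + y ^ 2 = -1) (A B : Matrix ι ι ℍ[F]) :
    splitMat x y (A * B) = splitMat x y A * splitMat x y B := by
  rw [splitMat, splitMat, splitMat, fromBlocks_multiply, fromBlocks_inj]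
  refine ⟨?_, ?_, ?_, ?_⟩ <;> ext p q <;>
    simp only [Matrix.map_apply, Matrix.mul_apply, Matrix.add_apply, map_sum, ← Finset.sum_add_distrib] <;>
    refine Finset.sum_congr rfl fun l _ => ?_ <;>
    simp only [quatFunctional_apply, re_mul, imI_mul, imJ_mul, imK_mul]
  · linear_combination (-((A p l).imJ * (B l q).imJ + (A p l).imK * (B l q).imK)) * hxy
  · linear_combination (((A p l).imJ * (B l q).imK - (A p l).imK * (B l q).imJ)) * hxy
  · linear_combination (-((A p l).imJ * (B l q).imK - (A p l).imK * (B l q).imJ)) * hxy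
  · linear_combination (-((A p l).imJ * (B l q).imJ + (A p l).imK * (B l q).imK)) * hxy

lemma splitMat_star (x y : F) (A : Matrix ι ι ℍ[F]) :
    splitMat x y (star A) = J ι F * (splitMat x y A)ᵀ * (-J ι F) := by
  simp only [splitMat, J, fromBlocks_transpose, fromBlocks_neg, fromBlocks_multiply]
  rw [fromBlocks_inj]
  refine ⟨?_, ?_, ?_, ?_⟩ <;> ext p q <;>
    simp [star_apply, quatFunctional_apply, Matrix.map_apply] <;> ring

lemma splitMat_injective [NeZero (2 : F)] {x y : F} (hxy : x ^ 2 + y ^ 2 = -1) :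
    Function.Injective (splitMat x y : Matrix ι ι ℍ[F] → _) := by
  intro A B h
  rw [splitMat, splitMat, fromBlocks_inj] at h
  obtain ⟨h1, h2, h3, h4⟩ := h
  have h20 := NeZero.ne (2 : F)
  ext1 p q
  have e1 := congrFun (congrFun h1 p) q
  have e2 := congrFun (congrFun h2 p) q
  have e3 := congrFun (congrFun h3 p) q
  have e4 := congrFun (congrFun h4 p) q
  simp only [Matrix.map_apply, quatFunctional_apply] at e1 e2 e3 e4
  ext <;> refine mul_left_cancel₀ h20 ?_
  · linear_combination e1 + e4
  · linear_combination e2 - e3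
  · linear_combination (-x) * (e1 - e4) - y * (e2 + e3) + 2 * ((A p q).imJ - (B p q).imJ) * hxy
  · linear_combination x * (e2 + e3) - y * (e1 - e4) + 2 * ((A p q).imK - (B p q).imK) * hxy

lemma splitMat_surjective [NeZero (2 : F)] {x y : F} (hxy : x ^ 2 + y ^ 2 = -1) :
    Function.Surjective (splitMat x y : Matrix ι ι ℍ[F] → _) := by
  intro M
  have h20 := NeZero.ne (2 : F)
  refine ⟨Matrix.of fun p q => qmk
      ((M (.inl p) (.inl q) + M (.inr p) (.inr q)) / 2)
      ((M (.inl p) (.inr q) - M (.inr p) (.inl q)) / 2)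
      ((-x * (M (.inl p) (.inl q) - M (.inr p) (.inr q)) -
        y * (M (.inl p) (.inr q) + M (.inr p) (.inl q))) / 2)
      ((x * (M (.inl p) (.inr q) + M (.inr p) (.inl q)) -
        y * (M (.inl p) (.inl q) - M (.inr p) (.inr q))) / 2), ?_⟩
  rw [splitMat, ← fromBlocks_toBlocks M, fromBlocks_inj]
  refine ⟨?_, ?_, ?_, ?_⟩ <;> ext p q <;>
    rw [Matrix.map_apply, Matrix.of_apply] <;>
    simp only [Matrix.of_apply, qmk_re, qmk_imI, qmk_imJ, qmk_imK, quatFunctional_apply, toBlocks₁₁, toBlocks₁₂, toBlocks₂₁,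
      toBlocks₂₂, fromBlocks_apply₁₁, fromBlocks_apply₁₂, fromBlocks_apply₂₁,
      fromBlocks_apply₂₂] <;> field_simp
  · linear_combination (-(M (.inl p) (.inl q) - M (.inr p) (.inr q))) * hxy
  · linear_combination (-(M (.inl p) (.inr q) + M (.inr p) (.inl q))) * hxy
  · linear_combination (-(M (.inl p) (.inr q) + M (.inr p) (.inl q))) * hxy
  · linear_combination (M (.inl p) (.inl q) - M (.inr p) (.inr q)) * hxy

lemma splitMat_mem_iff [NeZero (2 : F)] {x y : F} (hxy : x ^ 2 + y ^ 2 = -1)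
    {A : Matrix ι ι ℍ[F]} :
    splitMat x y A ∈ symplecticGroup ι F ↔ A ∈ unitary (Matrix ι ι ℍ[F]) := by
  have h1 : splitMat x y A ∈ symplecticGroup ι F ↔ splitMat x y A * splitMat x y (star A) = 1 := by
    rw [SymplecticGroup.mem_iff, splitMat_star, mul_neg, mul_neg, ← mul_assoc, ← mul_assoc]
    constructor
    · intro h
      rw [h, J_squared, neg_neg]
    · intro h
      have h2 := congrArg (· * J ι F) h
      simp only [neg_mul, one_mul] at h2
      rw [mul_assoc _ (J ι F) (J ι F), J_squared, mul_neg, mul_one, neg_neg] at h2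
      exact h2
  rw [h1, Unitary.mem_iff]
  have h2 : splitMat x y A * splitMat x y (star A) = 1 ↔ A * star A = 1 := by
    rw [← splitMat_mul hxy, ← splitMat_one x y, (splitMat_injective hxy).eq_iff]
  have h3 : splitMat x y (star A) * splitMat x y A = 1 ↔ star A * A = 1 := by
    rw [← splitMat_mul hxy, ← splitMat_one x y, (splitMat_injective hxy).eq_iff]
  rw [← h2, ← h3, mul_eq_one_comm, and_self]

/-- A quaternionic unitary group is isomorphic to a symplectic group. -/
lemma exists_unitMat_mulEquiv_symplecticGroup (F : Type*) [Field F] [Finite F] [NeZero (2 : F)]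
    (ι : Type*) [Fintype ι] [DecidableEq ι] :
    Nonempty (UnitMat ι F ≃* symplecticGroup ι F) := by
  obtain ⟨x, y, hxy⟩ : ∃ x y : F, x ^ 2 + y ^ 2 = -1 := by
    obtain ⟨p, hp⟩ := CharP.exists F
    have hp' : p.Prime := (CharP.char_is_prime_or_zero F p).resolve_right
      (CharP.char_ne_zero_of_finite F p)
    have : NeZero p := ⟨hp'.ne_zero⟩
    obtain ⟨a, b, hab⟩ := CharP.sq_add_sq F p (-1)
    exact ⟨a, b, by simpa using hab⟩
  let f : UnitMat ι F →* symplecticGroup ι F :=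
    { toFun := fun A => ⟨splitMat x y A.1, (splitMat_mem_iff hxy).2 A.2⟩
      map_one' := Subtype.ext (splitMat_one x y)
      map_mul' := fun A B => Subtype.ext (splitMat_mul hxy A.1 B.1) }
  refine ⟨MulEquiv.ofBijective f ⟨fun A B h => ?_, fun M => ?_⟩⟩
  · exact Subtype.ext (splitMat_injective hxy (congrArg Subtype.val h))
  · obtain ⟨A, hA⟩ := splitMat_surjective hxy M.1
    exact ⟨⟨A, (splitMat_mem_iff hxy).1 (hA ▸ M.2)⟩, Subtype.ext hA⟩

end Symplectic

lemma three_dvd_two_pow_odd_add_one (k : ℕ) : 3 ∣ 2 ^ (2 * k + 1) + 1 := by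
  induction k with
  | zero => norm_num
  | succ k ih =>
    rw [show 2 * (k + 1) + 1 = 2 * k + 1 + 2 by ring, pow_add]
    omega

lemma three_dvd_two_pow_even_add_two (k : ℕ) : 3 ∣ 2 ^ (2 * k) + 2 := by
  induction k with
  | zero => norm_num
  | succ k ih =>
    rw [show 2 * (k + 1) = 2 * k + 2 by ring, pow_add]
    omega

/-- If `n` is neither a power of `2` nor of the form `2 ^ w * (2 ^ (2 * k) + 1)`, then some odd
binomial coefficient `n.choose m` has `m` a positive multiple of `3`. -/
lemma exists_odd_choose_three_dvd (n : ℕ) (hn : 0 < n)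
    (h : ¬ ((∃ w, n = 2 ^ w) ∨ ∃ w k, n = 2 ^ w * (2 ^ (2 * k) + 1))) :
    ∃ m, 0 < m ∧ 3 ∣ m ∧ Odd (n.choose m) := by
  induction n using Nat.strong_induction_on with
  | _ n ih =>
    obtain ⟨n', rfl | rfl⟩ := Nat.even_or_odd' n
    · obtain ⟨m, hm, h3, hc⟩ := ih n' (by omega) (by omega) (by
        rintro (⟨w, rfl⟩ | ⟨w, k, rfl⟩)
        · exact h (Or.inl ⟨w + 1, by ring⟩)
        · exact h (Or.inr ⟨w + 1, k, by ring⟩))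
      exact ⟨2 * m, by omega, h3.mul_left 2, (odd_choose_two_mul _ _).2 hc⟩
    · have hpow : ∀ w, n' = 2 ^ w → ∃ m, 0 < m ∧ 3 ∣ m ∧ Odd ((2 * n' + 1).choose m) := by
        rintro w rfl
        obtain ⟨k, hk | hk⟩ := Nat.even_or_odd' (w + 1)
        · exact absurd (Or.inr ⟨0, k, by rw [← hk]; ring⟩) h
        · refine ⟨2 * 2 ^ w + 1, by omega, ?_, by simp⟩
          rw [← pow_succ', hk]
          exact three_dvd_two_pow_odd_add_one k
      by_cases h' : (∃ w, n' = 2 ^ w) ∨ ∃ w k, n' = 2 ^ w * (2 ^ (2 * k) + 1)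
      · obtain ⟨w, hw⟩ | ⟨w, k, hk⟩ := h'
        · exact hpow w hw
        · obtain _ | k := k
          · exact hpow (w + 1) (by rw [hk, pow_succ]; simp)
          · obtain ⟨v, hv | hv⟩ := Nat.even_or_odd' (w + 1)
            · refine ⟨2 * n' + 1, by omega, ?_, by simp⟩
              have h1 := three_dvd_two_pow_even_add_two v
              have h2 := three_dvd_two_pow_even_add_two (v + (k + 1))
              have h3 : 2 * n' = 2 ^ (2 * v) + 2 ^ (2 * (v + (k + 1))) := by
                rw [mul_add 2 v, pow_add, ← hv, hk]; ring
              omega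
            · refine ⟨2 * 2 ^ w + 1, by omega, ?_, ?_⟩
              · rw [← pow_succ', hv]
                exact three_dvd_two_pow_odd_add_one v
              · rw [odd_choose_two_mul_add_one_add_one]
                have := odd_choose_two_pow (a := w) (b := w + 2 * (k + 1)) (by omega)
                convert! this using 2
                rw [hk, pow_add]; ring
      · obtain rfl | h0 := Nat.eq_zero_or_pos n'
        · exact absurd (Or.inl ⟨0, by simp⟩) h
        · obtain ⟨m, hm, h3, hc⟩ := ih n' (by omega) h0 h'
          exact ⟨2 * m, by omega, h3.mul_left 2, (odd_choose_two_mul_add_one _ _).2 hc⟩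

section

open Quaternion Matrix

variable {F : Type*} [Field F] {ι : Type*} [Fintype ι] [DecidableEq ι] [NeZero (2 : F)]

lemma sum_comp_of_mem_setStab {A : Finset ι} {σ : Equiv.Perm ι} (hσ : σ ∈ setStab (A : Set ι))
    (c : ι → ZMod 3) : ∑ l ∈ A, c (σ l) = ∑ l ∈ A, c l :=
  Finset.sum_equiv σ (fun l => (hσ l).symm) fun _ _ => rfl

/-- The monomial matrices preserving `A` whose entries have classes with sum zero over `A`. -/
def sumZeroGroup (F : Type*) [Field F] [NeZero (2 : F)] (A : Finset ι) :
    Subgroup (UnitMat ι F) where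
  carrier := {k | ∃ σ ∈ setStab (A : Set ι), ∃ d : ι → UnitQuat F, ∃ c : ι → ZMod 3,
    (∀ l, IsCls (d l) (c l)) ∧ ∑ l ∈ A, c l = 0 ∧ k = mon σ d}
  one_mem' := ⟨1, one_mem _, 1, 0, fun _ => isCls_zero.2 (one_mem _), by simp, mon_one.symm⟩
  mul_mem' := by
    rintro _ _ ⟨σ, hσ, d, c, hd, hc, rfl⟩ ⟨τ, hτ, d', c', hd', hc', rfl⟩
    refine ⟨_, mul_mem hσ hτ, _, fun q => c (τ q) + c' q, fun l => (hd _).mul (hd' l), ?_,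
      mon_mul_mon _ _ _ _⟩
    rw [Finset.sum_add_distrib, sum_comp_of_mem_setStab hτ, hc, hc', add_zero]
  inv_mem' := by
    rintro _ ⟨σ, hσ, d, c, hd, hc, rfl⟩
    refine ⟨_, inv_mem hσ, _, fun q => -c (σ⁻¹ q), fun l => (hd _).inv, ?_, mon_inv _ _⟩
    rw [Finset.sum_neg_distrib, sum_comp_of_mem_setStab (inv_mem hσ), hc, neg_zero]

variable [Finite F]

lemma center_le_monGroup {X : Subgroup (Equiv.Perm ι)} {T : Subgroup (Equiv.Perm ι)}
    (hT : IsMaxTwo T ⊤) (hTX : T ≤ X) {z : UnitMat ι F} (hz : ∀ k, z * k = k * z) :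
    z ∈ monGroup X (quatGroup F) := by
  have : Fact (Nat.Prime 2) := ⟨Nat.prime_two⟩
  obtain ⟨σ, hσ, d, -, rfl⟩ := eq_mon_of_normalizing (T := T) (D := quatGroup F) (fun σ h =>
    hT.isPGroup.mem_of_normalizing_perm (hT.odd_index le_rfl) h) le_rfl (g := z) (fun x hx => by
      rw [hz, mul_inv_cancel_right]; exact hx)
  refine mon_mem_monGroup.2 ⟨hTX hσ, fun l => ?_⟩
  have hcomm : ∀ a : UnitQuat F, d l * a = a * d l := fun a => by
    have h1 := hz (mon 1 fun _ => a)
    rw [mon_mul_mon, mon_mul_mon] at h1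
    exact congrFun (mon_inj h1).2 l
  have h1 := congrArg Subtype.val (hcomm (unitI F))
  have h2 := congrArg Subtype.val (hcomm (unitJ F))
  rw [Submonoid.coe_mul, Submonoid.coe_mul, coe_unitI] at h1
  rw [Submonoid.coe_mul, Submonoid.coe_mul, coe_unitJ] at h2
  obtain ⟨h3, h4⟩ := coords_of_comm_qi h1
  have h5 : ((d l : ℍ[F])).imI = 0 := by
    have := congrArg QuaternionAlgebra.imK h2
    simp at this
    have h6 : (2 : F) * ((d l : ℍ[F])).imI = 0 := by linear_combination this
    exact (mul_eq_zero.1 h6).resolve_left (NeZero.ne _)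
  have h7 := mem_unitQuat.1 (d l).2
  rw [h3, h4, h5] at h7
  rw [mem_quatGroup]
  have h8 : ((d l : ℍ[F])).re = 1 ∨ ((d l : ℍ[F])).re = -1 := by
    rw [← sq_eq_sq_iff_eq_or_eq_neg]; linear_combination h7
  rcases h8 with h8 | h8
  · left; ext <;> simp [*]
  · right; left; ext <;> simp [*]

/-- If the rank is not of the required form, then every central quotient of the quaternionic
unitary group has a subgroup of odd index which is not pronormal. -/
lemma exists_not_isPronormal (hns : ¬ IsSquare (2 : F)) (hpos : 0 < Nat.card ι)
    (hn : ¬ ((∃ w, Nat.card ι = 2 ^ w) ∨ ∃ w k, Nat.card ι = 2 ^ w * (2 ^ (2 * k) + 1)))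
    {G : Type*} [Group G] {φ : UnitMat ι F →* G} (hφ : Function.Surjective φ)
    (hker : ∀ z, φ z = 1 → ∀ k, z * k = k * z) :
    ∃ H : Subgroup G, Odd H.index ∧ ¬ IsPronormal H := by
  have : Fact (Nat.Prime 2) := ⟨Nat.prime_two⟩
  have hG : Finite G := Finite.of_surjective φ hφ
  obtain ⟨m, hm, h3, hc⟩ := exists_odd_choose_three_dvd _ hpos hn
  obtain ⟨A, -, rfl⟩ := Finset.exists_subset_card_eq (s := (Finset.univ : Finset ι)) (n := m) (by
    rw [Finset.card_univ, ← Nat.card_eq_fintype_card]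
    by_contra h
    rw [Nat.choose_eq_zero_of_lt (by omega)] at hc
    exact absurd hc (by decide))
  have hX : Odd (setStab (A : Set ι)).index := by
    rw [index_setStab]; simpa using hc
  obtain ⟨T, hT, hTX⟩ : ∃ T : Subgroup (Equiv.Perm ι), IsMaxTwo T ⊤ ∧ T ≤ setStab (A : Set ι) := by
    have hS : IsMaxTwo ((default : Sylow 2 (Equiv.Perm ι)) : Subgroup (Equiv.Perm ι)) ⊤ :=
      Sylow.isMaxTwo _
    obtain ⟨x, hx⟩ := hS.exists_conj_of_odd_index hX
    refine ⟨((x • (default : Sylow 2 (Equiv.Perm ι)) : Sylow 2 _) : Subgroup (Equiv.Perm ι)),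
      Sylow.isMaxTwo _, ?_⟩
    rintro _ ⟨y, hy, rfl⟩
    exact hx y hy
  obtain ⟨H, hH⟩ : ∃ H, H = monGroup (setStab (A : Set ι)) (quatGroup F) := ⟨_, rfl⟩
  have hker' : ∀ z, φ z = 1 → z ∈ H := fun z hz => hH ▸ center_le_monGroup hT hTX (hker z hz)
  have hHodd : Odd H.index := by
    rw [hH]
    refine (isMaxTwo_monGroup hT (isMaxTwo_quatGroup hns) le_rfl).odd_index ?_
    rintro _ ⟨σ, hσ, d, hd, rfl⟩
    exact mon_mem_monGroup.2 ⟨hTX hσ, hd⟩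
  refine ⟨H.map φ, hHodd.of_dvd_nat (H.index_map_dvd hφ), fun hpro => ?_⟩
  obtain ⟨a, ha⟩ := Finset.card_pos.1 hm
  let e : ι → ZMod 3 := Pi.single a 1
  have hesum : ∑ l ∈ A, e l = 1 := by simp [e, ha]
  obtain ⟨x', hx', hxg⟩ := hpro (φ (diagOmega F e))
  rw [← map_conj_apply_hom, ← Subgroup.map_sup] at hx'
  obtain ⟨x, hx, rfl⟩ := hx'
  have hxΓ : x ∈ sumZeroGroup F A := by
    refine (sup_le ?_ ?_ : H ⊔ H.map (MulAut.conj (diagOmega F e)).toMonoidHom ≤ _) hx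
    · rw [hH]
      rintro _ ⟨σ, hσ, d, hd, rfl⟩
      exact ⟨σ, hσ, d, 0, fun l => isCls_zero.2 (hd l), by simp, rfl⟩
    · rw [hH]
      rintro _ ⟨_, ⟨σ, hσ, d, hd, rfl⟩, rfl⟩
      refine ⟨σ, hσ, fun q => wpow (e (σ q)) * d q * wpow (-e q), fun q => e (σ q) + 0 + -e q,
        fun l => ((isCls_wpow _).mul (isCls_zero.2 (hd l))).mul (isCls_wpow _), ?_, ?_⟩
      · rw [Finset.sum_add_distrib, Finset.sum_add_distrib, sum_comp_of_mem_setStab hσ]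
        simp
      · change diagOmega F e * mon σ d * (diagOmega F e)⁻¹ = _
        rw [diagOmega, mon_inv, mon_mul_mon, mon_mul_mon]
        congr 1
        funext q
        simp [wpow_neg]
  obtain ⟨σ, hσ, d, c, hd, hcs, rfl⟩ := hxΓ
  rw [map_conj_eq_iff] at hxg
  have hnorm : ∀ h ∈ H, ((diagOmega F e)⁻¹ * mon σ d) * h * ((diagOmega F e)⁻¹ * mon σ d)⁻¹ ∈ H := by
    intro h hh
    obtain ⟨h', hh', he⟩ := hxg (φ h) ⟨h, hh, rfl⟩
    rw [← map_inv, ← map_mul, ← map_mul, ← map_inv, ← map_mul] at he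
    have h1 := hker' (h'⁻¹ * (((diagOmega F e)⁻¹ * mon σ d) * h *
      ((diagOmega F e)⁻¹ * mon σ d)⁻¹)) (by rw [map_mul, map_inv, he, inv_mul_cancel])
    simpa using H.mul_mem hh' h1
  let f : ι → ZMod 3 := fun q => -e (σ q) + c q
  let D : ι → UnitQuat F := fun q => wpow (-e (σ q)) * d q
  have hD : ∀ l, IsCls (D l) (f l) := fun l => (isCls_wpow _).mul (hd l)
  have hy : (diagOmega F e)⁻¹ * mon σ d = mon σ D := by
    rw [diagOmega, mon_inv, mon_mul_mon]
    congr 1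
    funext q
    simp [D, wpow_neg]
  rw [hy] at hnorm
  have hf : ∀ l ∈ A, f l = f a := fun l hl => by
    have h1 := hnorm (mon (Equiv.swap a l) 1) (hH ▸ mon_mem_monGroup.2
      ⟨swap_mem_setStab (iff_of_true ha hl), fun _ => one_mem _⟩)
    rw [hH, mon_inv, mon_mul_mon, mon_mul_mon, mon_mem_monGroup] at h1
    have h2 := h1.2 (σ a)
    simp only [show σ⁻¹ (σ a) = a from σ.symm_apply_apply a, Equiv.swap_apply_left, Pi.one_apply, mul_one] at h2
    have h3 := ((hD l).mul (hD a).inv).eq (isCls_zero.2 h2)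
    rwa [← sub_eq_add_neg, sub_eq_zero] at h3
  have h4 : ∑ l ∈ A, f l = -1 := by
    rw [Finset.sum_add_distrib, hcs, Finset.sum_neg_distrib, sum_comp_of_mem_setStab hσ, hesum,
      add_zero]
  rw [Finset.sum_congr rfl hf, Finset.sum_const, nsmul_eq_mul,
    (ZMod.natCast_eq_zero_iff _ _).2 h3, zero_mul] at h4
  exact absurd h4 (by decide)

end

section Projective

open Matrix

lemma isSquare_two_iff_card {F : Type*} [Field F] [Fintype F] (h : Odd (Fintype.card F)) :
    IsSquare (2 : F) ↔ ¬ (Fintype.card F % 8 = 3 ∨ Fintype.card F % 8 = 5) := by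
  rw [FiniteField.isSquare_two_iff]
  obtain ⟨k, hk⟩ := h
  omega

lemma neZero_two_of_odd_card {F : Type*} [Field F] [Fintype F] (h : Odd (Fintype.card F)) :
    NeZero (2 : F) := by
  refine ⟨fun h2 => ?_⟩
  have h1 : ((Fintype.card F : ℕ) : F) = 0 := FiniteField.cast_card_eq_zero F
  obtain ⟨k, hk⟩ := h
  rw [hk] at h1
  push_cast at h1
  rw [h2] at h1
  simp at h1

lemma exists_hasLocalProperty {F : Type*} [Field F] [Fintype F] [NeZero (2 : F)]
    (hq : Odd (Fintype.card F)) {m : ℕ} (hm : (Fintype.card F % 8 = 3 ∨ Fintype.card F % 8 = 5) →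
      ((∃ w, m = 2 ^ w) ∨ ∃ w k, m = 2 ^ w * (2 ^ (2 * k) + 1))) :
    ∃ S : Subgroup (UnitMat (Fin m) F), HasLocalProperty S := by
  by_cases hs : IsSquare (2 : F)
  · exact exists_hasLocalProperty_of_isSquare hs
  · refine exists_hasLocalProperty_of_not_isSquare hs ?_
    rw [isSquare_two_iff_card hq, not_not] at hs
    simpa using hm hs

/-- The projection of a quaternionic unitary group onto a projective symplectic group. -/
lemma exists_unitMat_hom_psp (F : Type*) [Field F] [Finite F] [NeZero (2 : F)] (m : ℕ) :
    ∃ φ : UnitMat (Fin m) F →* symplecticGroup (Fin m) F ⧸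
      Subgroup.center (symplecticGroup (Fin m) F),
      Function.Surjective φ ∧ ∀ z, φ z = 1 → ∀ k, z * k = k * z := by
  obtain ⟨f⟩ := exists_unitMat_mulEquiv_symplecticGroup F (Fin m)
  refine ⟨(QuotientGroup.mk' _).comp f.toMonoidHom,
    (QuotientGroup.mk'_surjective _).comp f.surjective, fun z hz k => f.injective ?_⟩
  have h1 : f z ∈ Subgroup.center (symplecticGroup (Fin m) F) :=
    (QuotientGroup.eq_one_iff _).1 hz
  rw [map_mul, map_mul]
  exact (Subgroup.mem_center_iff.1 h1 (f k)).symm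

end Projective

/-- Criterion for pronormality of all subgroups of odd index in a direct product
`G = ∏ PSp_{2 n i}(q i)` of projective symplectic groups over fields of odd order, where
`PSp_{2 n i}(q i)` is the quotient of `Sp_{2 n i}(q i)` by its center: statements
(1) all subgroups of odd index in `G` are pronormal in `G`;
(2) for each `i`, all subgroups of odd index in `PSp_{2 n i}(q i)` are pronormal in it;
(3) for each `i`, if `q i ≡ ±3 (mod 8)` then `n i` is a power of `2` or of the form
`2 ^ w * (2 ^ (2 * k) + 1)`;
are pairwise equivalent. -/
theorem psp_direct_product_criterion (t : ℕ) (ht : 0 < t) (n q : Fin t → ℕ)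
    (hn : ∀ i, 0 < n i) (hq : ∀ i, Odd (q i)) (hq' : ∀ i, IsPrimePow (q i))
    (F : Fin t → Type) [∀ i, Field (F i)] [∀ i, Fintype (F i)]
    (hF : ∀ i, Fintype.card (F i) = q i) :
    ((∀ H : Subgroup (∀ i, (Matrix.symplecticGroup (Fin (n i)) (F i) ⧸
          Subgroup.center (Matrix.symplecticGroup (Fin (n i)) (F i)))),
        Odd H.index → IsPronormal H) ↔
      (∀ i, ∀ H : Subgroup (Matrix.symplecticGroup (Fin (n i)) (F i) ⧸
          Subgroup.center (Matrix.symplecticGroup (Fin (n i)) (F i))),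
        Odd H.index → IsPronormal H)) ∧
    ((∀ i, ∀ H : Subgroup (Matrix.symplecticGroup (Fin (n i)) (F i) ⧸
          Subgroup.center (Matrix.symplecticGroup (Fin (n i)) (F i))),
        Odd H.index → IsPronormal H) ↔
      (∀ i, (q i % 8 = 3 ∨ q i % 8 = 5) →
        ((∃ w, n i = 2 ^ w) ∨ ∃ w k, n i = 2 ^ w * (2 ^ (2 * k) + 1)))) := by
  have h2 : ∀ i, NeZero (2 : F i) := fun i => neZero_two_of_odd_card ((hF i).symm ▸ hq i)
  have hodd : ∀ i, Odd (Fintype.card (F i)) := fun i => (hF i).symm ▸ hq i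
  have h31 : (∀ i, (q i % 8 = 3 ∨ q i % 8 = 5) →
      ((∃ w, n i = 2 ^ w) ∨ ∃ w k, n i = 2 ^ w * (2 ^ (2 * k) + 1))) →
      ∀ H : Subgroup (∀ i, (Matrix.symplecticGroup (Fin (n i)) (F i) ⧸
          Subgroup.center (Matrix.symplecticGroup (Fin (n i)) (F i)))),
        Odd H.index → IsPronormal H := by
    intro h3 H hH
    choose S hS using fun i => exists_hasLocalProperty (F := F i) (hodd i) (m := n i)
      (by rw [hF i]; exact h3 i)
    choose φ hφ _ using fun i => exists_unitMat_hom_psp (F i) (n i)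
    refine isPronormal_of_surjective (fun K hK => isPronormal_pi hS hK)
      (φ := MonoidHom.pi fun i => (φ i).comp (Pi.evalMonoidHom _ i)) (fun y => ?_) hH
    choose x hx using fun i => hφ i (y i)
    exact ⟨x, funext hx⟩
  have h12 : (∀ H : Subgroup (∀ i, (Matrix.symplecticGroup (Fin (n i)) (F i) ⧸
          Subgroup.center (Matrix.symplecticGroup (Fin (n i)) (F i)))),
        Odd H.index → IsPronormal H) →
      (∀ i, ∀ H : Subgroup (Matrix.symplecticGroup (Fin (n i)) (F i) ⧸
          Subgroup.center (Matrix.symplecticGroup (Fin (n i)) (F i))),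
        Odd H.index → IsPronormal H) := fun h i H hH =>
    isPronormal_of_surjective h (φ := Pi.evalMonoidHom _ i) (Function.surjective_eval i) hH
  have h23 : (∀ i, ∀ H : Subgroup (Matrix.symplecticGroup (Fin (n i)) (F i) ⧸
          Subgroup.center (Matrix.symplecticGroup (Fin (n i)) (F i))),
        Odd H.index → IsPronormal H) →
      (∀ i, (q i % 8 = 3 ∨ q i % 8 = 5) →
        ((∃ w, n i = 2 ^ w) ∨ ∃ w k, n i = 2 ^ w * (2 ^ (2 * k) + 1))) := by
    intro h i hi
    by_contra hc
    obtain ⟨φ, hφ, hker⟩ := exists_unitMat_hom_psp (F i) (n i)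
    obtain ⟨H, hH, hHn⟩ := exists_not_isPronormal (F := F i) (ι := Fin (n i))
      (by rw [isSquare_two_iff_card (hodd i), not_not, hF i]; exact hi)
      (by simpa using hn i) (by simpa using hc) hφ hker
    exact hHn (h i H hH)
  exact ⟨⟨h12, fun h => h31 (h23 h)⟩, ⟨h23, fun h => h12 (h31 h)⟩⟩
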